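/- arXiv:2012.13066 — 13 statements merged into one kernel-verified Lean document; each statement's English description precedes it below -/
import Mathlib

section
/- Let d = 2d₁, let H : ℝ^d → ℝ be continuously differentiable, and let f = J⁻¹∇H, where J is the canonical symplectic matrix. Let h > 0 and let Y_h be a vector space of continuous real-valued functions on [0,1]. Suppose u : [0,1] → ℝ^d is continuously differentiable with u(0) = y₀, every component of u′ belongs to Y_h, and for every v ∈ Y_h and every component index i, ∫₀¹ v(τ) u′_i(τ) dτ = h ∫₀¹ v(τ) f(u(τ))_i dτ. Then the Hamiltonian is exactly preserved: H(u(1)) = H(u(0)). -/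
open MeasureTheory Set

/-- **Energy preservation of the FFCFE method.**
For `d = 2d₁`, the canonical symplectic matrix `J` is the block matrix
`[[0, I], [-I, 0]]` (indices written as `Fin d₁ ⊕ Fin d₁`), so
`f = J⁻¹∇H` has components `f (inl i) = -∂H/∂y_{inr i}` and
`f (inr i) = ∂H/∂y_{inl i}` (gradient components expressed via `fderiv`
applied to standard basis vectors).  If `u : [0,1] → ℝ^d` is C¹ with
`u 0 = y₀`, every component of `u'` lies in the test space `Yh`
(a vector space of continuous functions on `[0,1]`), and the variational
relation `⟨v, u'_i⟩ = h ⟨v, f(u(·))_i⟩` holds for all `v ∈ Yh` and all `i`,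
then the Hamiltonian is exactly preserved: `H (u 1) = H (u 0)`. -/
theorem ffcfe_energy_preservation (d₁ : ℕ)
    (H : ((Fin d₁ ⊕ Fin d₁) → ℝ) → ℝ) (hH : ContDiff ℝ 1 H)
    (f : ((Fin d₁ ⊕ Fin d₁) → ℝ) → ((Fin d₁ ⊕ Fin d₁) → ℝ))
    (hf_inl : ∀ y i, f y (Sum.inl i) = - fderiv ℝ H y (Pi.single (Sum.inr i) 1))
    (hf_inr : ∀ y i, f y (Sum.inr i) = fderiv ℝ H y (Pi.single (Sum.inl i) 1))
    (h : ℝ) (hh : 0 < h)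
    (Yh : Submodule ℝ (ℝ → ℝ)) (hYcont : ∀ v ∈ Yh, ContinuousOn v (Icc 0 1))
    (y₀ : (Fin d₁ ⊕ Fin d₁) → ℝ)
    (u : ℝ → ((Fin d₁ ⊕ Fin d₁) → ℝ)) (hu : ContDiff ℝ 1 u) (hu0 : u 0 = y₀)
    (hu' : ∀ i, (fun τ => deriv u τ i) ∈ Yh)
    (hvar : ∀ v ∈ Yh, ∀ i, ∫ τ in (0:ℝ)..1, v τ * deriv u τ i
        = h * ∫ τ in (0:ℝ)..1, v τ * f (u τ) i) :
    H (u 1) = H (u 0) := by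
  have hu'c : ∀ k, Continuous fun τ => deriv u τ k := fun k =>
    (continuous_apply k).comp (hu.continuous_deriv le_rfl)
  have hgc : ∀ k, Continuous fun τ => fderiv ℝ H (u τ) (Pi.single k 1) := fun k =>
    ((hH.continuous_fderiv one_ne_zero).comp hu.continuous).clm_apply continuous_const
  have hfc : ∀ k, Continuous fun τ => f (u τ) k := by
    rintro (i | i)
    · simpa only [hf_inl] using (hgc (Sum.inr i)).fun_neg
    · simpa only [hf_inr] using hgc (Sum.inl i)
  have hint : ∀ j k, IntervalIntegrable (fun τ => deriv u τ j * f (u τ) k) volume 0 1 :=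
    fun j k => ((hu'c j).mul (hfc k)).intervalIntegrable 0 1
  have hderiv : ∀ τ, HasDerivAt (fun t => H (u t))
      (∑ i, (deriv u τ (Sum.inl i) * f (u τ) (Sum.inr i)
        - deriv u τ (Sum.inr i) * f (u τ) (Sum.inl i))) τ := by
    intro τ
    have hc := ((hH.differentiable one_ne_zero) (u τ)).hasFDerivAt.comp_hasDerivAt τ
      ((hu.differentiable one_ne_zero) τ).hasDerivAt
    refine hc.congr_deriv ?_
    conv_lhs => rw [pi_eq_sum_univ' (deriv u τ), map_sum]
    simp [hf_inl, hf_inr, Finset.sum_add_distrib]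
  have hftc := intervalIntegral.integral_eq_sub_of_hasDerivAt (a := 0) (b := 1)
    (fun τ _ => hderiv τ)
    ((continuous_finsetSum _ fun i _ => ((hu'c _).mul (hfc _)).sub
      ((hu'c _).mul (hfc _))).intervalIntegrable 0 1)
  rw [← sub_eq_zero, ← hftc, intervalIntegral.integral_finsetSum
    fun i _ => (hint _ _).sub (hint _ _)]
  refine Finset.sum_eq_zero fun i _ => ?_
  rw [intervalIntegral.integral_sub (hint _ _) (hint _ _), sub_eq_zero]
  apply mul_left_cancel₀ hh.ne'
  rw [← hvar _ (hu' (Sum.inl i)) (Sum.inr i), ← hvar _ (hu' (Sum.inr i)) (Sum.inl i)]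
  simp only [mul_comm]
end

section
/- Let f : ℝ^d → ℝ^d be continuous, h ∈ ℝ, y₀ ∈ ℝ^d, and let Y be a vector space of continuous real-valued functions on [0,1]. Suppose u : [0,1] → ℝ^d is continuously differentiable with u(0) = y₀ and ∫₀¹ v(τ) u′_i(τ) dτ = h ∫₀¹ v(τ) f(u(τ))_i dτ for every v ∈ Y and every component index i. Then the reflected function ũ(τ) = u(1−τ) is continuously differentiable, satisfies ũ(0) = u(1) and ũ(1) = y₀, and satisfies ∫₀¹ v(τ) ũ′_i(τ) dτ = −h ∫₀¹ v(τ) f(ũ(τ))_i dτ for every v in the reflected space Y̌ = {τ ↦ v(1−τ) : v ∈ Y} and every i. -/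
open MeasureTheory Set

/-- **Reflection of an FFCFE solution (key step of the symmetry proof).**
If `u : [0,1] → ℝ^d` is C¹ with `u 0 = y₀` and satisfies the variational
relation `∫₀¹ v(τ) u'_i(τ) dτ = h ∫₀¹ v(τ) f(u(τ))_i dτ` for every `v` in a
vector space `Y` of continuous functions on `[0,1]` and every component `i`,
then the reflected function `ũ(τ) = u(1-τ)` is C¹, satisfies `ũ 0 = u 1`,
`ũ 1 = y₀`, and satisfies the variational relation with step `-h` for every
test function in the reflected space `{τ ↦ v(1-τ) : v ∈ Y}`. -/
theorem ffcfe_reflected_solution (d : ℕ)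
    (f : (Fin d → ℝ) → (Fin d → ℝ)) (hf : Continuous f)
    (h : ℝ) (y₀ : Fin d → ℝ)
    (Y : Submodule ℝ (ℝ → ℝ)) (hY : ∀ v ∈ Y, ContinuousOn v (Icc 0 1))
    (u : ℝ → Fin d → ℝ) (hu : ContDiff ℝ 1 u) (hu0 : u 0 = y₀)
    (hvar : ∀ v ∈ Y, ∀ i, ∫ τ in (0:ℝ)..1, v τ * deriv u τ i
        = h * ∫ τ in (0:ℝ)..1, v τ * f (u τ) i) :
    ContDiff ℝ 1 (fun τ => u (1 - τ)) ∧
    (fun τ => u (1 - τ)) 0 = u 1 ∧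
    (fun τ => u (1 - τ)) 1 = y₀ ∧
    ∀ v ∈ Y, ∀ i, ∫ τ in (0:ℝ)..1, v (1 - τ) * deriv (fun σ => u (1 - σ)) τ i
        = -h * ∫ τ in (0:ℝ)..1, v (1 - τ) * f (u (1 - τ)) i := by
  refine ⟨hu.comp (contDiff_const.sub contDiff_id), by simp, by simpa using hu0, fun v hv i => ?_⟩
  have hderiv := intervalIntegral.integral_comp_sub_left (a := 0) (b := 1)
    (fun τ => v τ * deriv u τ i) 1
  have hfield := intervalIntegral.integral_comp_sub_left (a := 0) (b := 1)
    (fun τ => v τ * f (u τ) i) 1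
  simp only [sub_self, sub_zero] at hderiv hfield
  simp only [deriv_comp_const_sub, Pi.neg_apply, mul_neg, intervalIntegral.integral_neg]
  rw [hderiv, hfield, hvar v hv i, neg_mul]
end

section
/- Let f : ℝ^d → ℝ^d be continuous and h₀ > 0. Let X be a set of continuously differentiable functions [0,1] → ℝ^d and Y a vector space of continuous real-valued functions on [0,1], both invariant under the reflection w ↦ w(1−·). Assume that for every y₀ ∈ ℝ^d and every h ∈ [−h₀, h₀] there is exactly one u = u(·; y₀, h) ∈ X with u(0) = y₀ and ∫₀¹ v(τ) u′_i(τ) dτ = h ∫₀¹ v(τ) f(u(τ))_i dτ for all v ∈ Y and all components i, and define the one-step map Φ_h(y₀) = u(1; y₀, h). Then the method is symmetric: Φ_{−h}(Φ_h(y₀)) = y₀ for all y₀ ∈ ℝ^d and all h ∈ [−h₀, h₀]. -/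
open MeasureTheory Set

/-- **Symmetry of the FFCFE one-step method.**
Let `X` be a set of C¹ trial functions `[0,1] → ℝ^d` and `Y` a vector space of
continuous test functions on `[0,1]`, both invariant under the reflection
`w ↦ w(1 - ·)`.  Assume that for every initial value `y₀` and every
`h ∈ [-h₀, h₀]` the FFCFE variational problem (find `u ∈ X` with `u 0 = y₀` and
`∫₀¹ v(τ) u'_i(τ) dτ = h ∫₀¹ v(τ) f(u(τ))_i dτ` for all `v ∈ Y` and all `i`)
has exactly one solution, and that `Φ h y₀` equals `u 1` for that solution.
Then the one-step method is symmetric: `Φ (-h) (Φ h y₀) = y₀`. -/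
theorem ffcfe_symmetric (d : ℕ)
    (f : (Fin d → ℝ) → (Fin d → ℝ)) (hf : Continuous f)
    (h₀ : ℝ) (hh₀ : 0 < h₀)
    (X : Set (ℝ → Fin d → ℝ)) (hX : ∀ u ∈ X, ContDiff ℝ 1 u)
    (Y : Submodule ℝ (ℝ → ℝ)) (hY : ∀ v ∈ Y, ContinuousOn v (Icc 0 1))
    (hXrefl : ∀ u ∈ X, (fun τ => u (1 - τ)) ∈ X)
    (hYrefl : ∀ v ∈ Y, (fun τ => v (1 - τ)) ∈ Y)
    (Φ : ℝ → (Fin d → ℝ) → (Fin d → ℝ))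
    (hEU : ∀ y₀ : Fin d → ℝ, ∀ h ∈ Icc (-h₀) h₀,
      ∃! u : ℝ → Fin d → ℝ, u ∈ X ∧ u 0 = y₀ ∧
        ∀ v ∈ Y, ∀ i, ∫ τ in (0:ℝ)..1, v τ * deriv u τ i
          = h * ∫ τ in (0:ℝ)..1, v τ * f (u τ) i)
    (hΦ : ∀ y₀ : Fin d → ℝ, ∀ h ∈ Icc (-h₀) h₀, ∀ u : ℝ → Fin d → ℝ,
      (u ∈ X ∧ u 0 = y₀ ∧
        ∀ v ∈ Y, ∀ i, ∫ τ in (0:ℝ)..1, v τ * deriv u τ i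
          = h * ∫ τ in (0:ℝ)..1, v τ * f (u τ) i) →
      Φ h y₀ = u 1) :
    ∀ y₀ : Fin d → ℝ, ∀ h ∈ Icc (-h₀) h₀, Φ (-h) (Φ h y₀) = y₀ := by
  intro y₀ h hh
  obtain ⟨u, ⟨huX, hu0, hu⟩, -⟩ := hEU y₀ h hh
  have hneg : -h ∈ Icc (-h₀) h₀ := ⟨neg_le_neg hh.2, neg_le.mp hh.1⟩
  rw [hΦ y₀ h hh u ⟨huX, hu0, hu⟩,
    hΦ (u 1) (-h) hneg (fun τ => u (1 - τ)) ⟨hXrefl u huX, by simp, fun v hv i => ?_⟩]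
  · simpa using hu0
  have hderiv := intervalIntegral.integral_comp_sub_left
    (a := 0) (b := 1) (fun τ => v (1 - τ) * deriv u τ i) 1
  have hfield := intervalIntegral.integral_comp_sub_left
    (a := 0) (b := 1) (fun τ => v (1 - τ) * f (u τ) i) 1
  simp only [sub_sub_cancel, sub_self, sub_zero] at hderiv hfield
  simp only [deriv_comp_const_sub, Pi.neg_apply, mul_neg, intervalIntegral.integral_neg]
  rw [hderiv, hfield, hu _ (hYrefl v hv) i, neg_mul]
end

section
/- Let y₀ ∈ ℝ^d, R > 0, and B = {y ∈ ℝ^d : ‖y − y₀‖_∞ ≤ R}. Let f : ℝ^d → ℝ^d be continuous with ‖f(y)‖_∞ ≤ D₀ for all y ∈ B and ‖f(y) − f(z)‖_∞ ≤ D₁‖y − z‖_∞ for all y, z ∈ B. Let A : [0,1] × [0,1] → ℝ be continuous with |A(τ,σ)| ≤ M₀ for all τ, σ. If h ≥ 0 satisfies h·M₀·D₁ < 1 and h·M₀·D₀ ≤ R, then there exists a unique continuous u : [0,1] → B such that u(τ) = y₀ + h ∫₀¹ A(τ,σ) f(u(σ)) dσ for all τ ∈ [0,1]. -/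
open MeasureTheory Set

/-- The nonlinear Hammerstein integral operator `u ↦ y₀ + h ∫ k(·, σ) f(u(σ)) dμ(σ)` on continuous
functions on a compact space. -/
noncomputable def hammersteinOperator {X E : Type*} [PseudoMetricSpace X] [CompactSpace X]
    [MeasurableSpace X] [BorelSpace X] (μ : Measure X) [IsFiniteMeasure μ]
    [NormedAddCommGroup E] [NormedSpace ℝ E] (k : C(X × X, ℝ)) (f : C(E, E)) (y₀ : E) (h : ℝ)
    (u : C(X, E)) : C(X, E) where
  toFun τ := y₀ + h • ∫ σ, k (τ, σ) • f (u σ) ∂μ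
  continuous_toFun := by
    have hcont : Continuous (Function.uncurry fun τ σ => k (τ, σ) • f (u σ)) := by
      unfold Function.uncurry
      fun_prop
    have := continuous_parametric_integral_of_continuous (μ := μ) hcont isCompact_univ
    simp only [setIntegral_univ] at this
    fun_prop

theorem ContinuousMap.mem_closedBall_const_iff {X E : Type*} [TopologicalSpace X] [CompactSpace X]
    [PseudoMetricSpace E] {y₀ : E} {R : ℝ} (hR : 0 ≤ R) {u : C(X, E)} :
    u ∈ Metric.closedBall (ContinuousMap.const X y₀) R ↔ ∀ τ, u τ ∈ Metric.closedBall y₀ R := by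
  simp [Metric.mem_closedBall, ContinuousMap.dist_le hR]

section Hammerstein

variable {X E : Type*} [PseudoMetricSpace X] [CompactSpace X] [MeasurableSpace X] [BorelSpace X]
  {μ : Measure X} [IsProbabilityMeasure μ] [NormedAddCommGroup E] [NormedSpace ℝ E]
  {k : C(X × X, ℝ)} {f : C(E, E)} {y₀ : E} {R h M D L : ℝ}

theorem hammersteinOperator_mapsTo (hR : 0 ≤ R) (hh : 0 ≤ h) (hM : 0 ≤ M)
    (hk : ∀ p, |k p| ≤ M) (hf : ∀ y ∈ Metric.closedBall y₀ R, ‖f y‖ ≤ D)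
    (hMD : h * M * D ≤ R) :
    MapsTo (hammersteinOperator μ k f y₀ h) (Metric.closedBall (ContinuousMap.const X y₀) R)
      (Metric.closedBall (ContinuousMap.const X y₀) R) := by
  intro u hu
  rw [ContinuousMap.mem_closedBall_const_iff hR] at hu ⊢
  intro τ
  have hint : ‖∫ σ, k (τ, σ) • f (u σ) ∂μ‖ ≤ M * D := by
    refine (norm_integral_le_of_norm_le_const (C := M * D) (.of_forall fun σ => ?_)).trans_eq ?_
    · rw [norm_smul]
      exact mul_le_mul (hk _) (hf _ (hu σ)) (norm_nonneg _) hM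
    · simp
  calc dist (hammersteinOperator μ k f y₀ h u τ) y₀
      = h * ‖∫ σ, k (τ, σ) • f (u σ) ∂μ‖ := by
        simp [hammersteinOperator, norm_smul, abs_of_nonneg hh]
    _ ≤ h * (M * D) := by gcongr
    _ ≤ R := by linarith

theorem dist_hammersteinOperator_le (hR : 0 ≤ R) (hh : 0 ≤ h) (hM : 0 ≤ M) (hL : 0 ≤ L)
    (hk : ∀ p, |k p| ≤ M)
    (hf : ∀ y ∈ Metric.closedBall y₀ R, ∀ z ∈ Metric.closedBall y₀ R,
      ‖f y - f z‖ ≤ L * ‖y - z‖) {u v : C(X, E)}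
    (hu : u ∈ Metric.closedBall (ContinuousMap.const X y₀) R)
    (hv : v ∈ Metric.closedBall (ContinuousMap.const X y₀) R) :
    dist (hammersteinOperator μ k f y₀ h u) (hammersteinOperator μ k f y₀ h v)
      ≤ h * M * L * dist u v := by
  rw [ContinuousMap.mem_closedBall_const_iff hR] at hu hv
  refine (ContinuousMap.dist_le (by positivity)).2 fun τ => ?_
  have hintegrable (w : C(X, E)) : Integrable (fun σ => k (τ, σ) • f (w σ)) μ :=
    Continuous.integrable_of_hasCompactSupport (by fun_prop) (.of_compactSpace _)
  have hint : ‖∫ σ, (k (τ, σ) • f (u σ) - k (τ, σ) • f (v σ)) ∂μ‖ ≤ M * (L * dist u v) := by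
    refine (norm_integral_le_of_norm_le_const (C := M * (L * dist u v))
      (.of_forall fun σ => ?_)).trans_eq ?_
    · rw [← smul_sub, norm_smul]
      refine mul_le_mul (hk _) ((hf _ (hu σ) _ (hv σ)).trans ?_) (norm_nonneg _) hM
      rw [← dist_eq_norm]
      gcongr
      exact ContinuousMap.dist_apply_le_dist σ
    · simp
  rw [integral_sub (hintegrable u) (hintegrable v)] at hint
  calc dist (hammersteinOperator μ k f y₀ h u τ) (hammersteinOperator μ k f y₀ h v τ)
      = h * ‖(∫ σ, k (τ, σ) • f (u σ) ∂μ) - ∫ σ, k (τ, σ) • f (v σ) ∂μ‖ := by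
        simp [hammersteinOperator, dist_eq_norm, ← smul_sub, norm_smul, abs_of_nonneg hh]
    _ ≤ h * (M * (L * dist u v)) := by gcongr
    _ = h * M * L * dist u v := by ring

theorem existsUnique_hammersteinOperator_fixedPoint [CompleteSpace E] (hR : 0 ≤ R) (hh : 0 ≤ h)
    (hM : 0 ≤ M) (hL : 0 ≤ L) (hk : ∀ p, |k p| ≤ M)
    (hfD : ∀ y ∈ Metric.closedBall y₀ R, ‖f y‖ ≤ D)
    (hfL : ∀ y ∈ Metric.closedBall y₀ R, ∀ z ∈ Metric.closedBall y₀ R,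
      ‖f y - f z‖ ≤ L * ‖y - z‖) (hML : h * M * L < 1) (hMD : h * M * D ≤ R) :
    ∃! u : C(X, E), (∀ τ, u τ ∈ Metric.closedBall y₀ R) ∧
      hammersteinOperator μ k f y₀ h u = u := by
  simp only [← ContinuousMap.mem_closedBall_const_iff hR]
  have hmaps := hammersteinOperator_mapsTo (μ := μ) hR hh hM hk hfD hMD
  have hcontr : ContractingWith ⟨h * M * L, by positivity⟩ (hmaps.restrict _ _ _) :=
    ⟨NNReal.coe_lt_coe.1 hML, LipschitzWith.of_dist_le_mul fun u v =>
      dist_hammersteinOperator_le hR hh hM hL hk hfL u.2 v.2⟩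
  have hcomplete : IsComplete (Metric.closedBall (ContinuousMap.const X y₀) R) :=
    Metric.isClosed_closedBall.isComplete
  obtain ⟨u, hu, hfix, -⟩ := hcontr.exists_fixedPoint' hcomplete hmaps
    (Metric.mem_closedBall_self hR) (edist_ne_top _ _)
  refine ⟨u, ⟨hu, hfix⟩, fun v ⟨hv, hvfix⟩ => ?_⟩
  exact congrArg Subtype.val (hcontr.fixedPoint_unique' (x := ⟨v, hv⟩) (y := ⟨u, hu⟩)
    (Subtype.ext hvfix) (Subtype.ext hfix))

end Hammerstein

theorem unitInterval.integral_coe {E : Type*} [NormedAddCommGroup E] [NormedSpace ℝ E]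
    (g : ℝ → E) : ∫ σ : unitInterval, g σ = ∫ σ in (0 : ℝ)..1, g σ := by
  rw [intervalIntegral.integral_of_le zero_le_one, ← integral_Icc_eq_integral_Ioc]
  exact integral_subtype_comap measurableSet_Icc g

/-- **Existence and uniqueness for the continuous-stage Runge–Kutta form of the
FFCFE method.**  Here `ℝ^d = Fin d → ℝ` carries the maximum norm and
`B = Metric.closedBall y₀ R` is the closed `‖·‖∞`-ball.  If `f` is continuous,
bounded by `D₀` on `B` and `D₁`-Lipschitz on `B`, the kernel `A` is continuous on
`[0,1]²` with `|A| ≤ M₀` there, and `h ≥ 0` satisfies `h M₀ D₁ < 1` and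
`h M₀ D₀ ≤ R`, then there is a continuous `u : [0,1] → B` with
`u τ = y₀ + h ∫₀¹ A(τ,σ) f(u(σ)) dσ` on `[0,1]`, unique in the sense that any
other such solution agrees with it on `[0,1]`. -/
theorem ffcfe_crk_existence_uniqueness (d : ℕ) (y₀ : Fin d → ℝ) (R : ℝ) (hR : 0 < R)
    (f : (Fin d → ℝ) → (Fin d → ℝ)) (hf : Continuous f)
    (D₀ D₁ M₀ : ℝ)
    (hD0 : ∀ y ∈ Metric.closedBall y₀ R, ‖f y‖ ≤ D₀)
    (hD1 : ∀ y ∈ Metric.closedBall y₀ R, ∀ z ∈ Metric.closedBall y₀ R,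
        ‖f y - f z‖ ≤ D₁ * ‖y - z‖)
    (A : ℝ → ℝ → ℝ)
    (hA : ContinuousOn (fun p : ℝ × ℝ => A p.1 p.2) (Icc 0 1 ×ˢ Icc 0 1))
    (hM0 : ∀ τ ∈ Icc (0:ℝ) 1, ∀ σ ∈ Icc (0:ℝ) 1, |A τ σ| ≤ M₀)
    (h : ℝ) (hh : 0 ≤ h) (hc1 : h * M₀ * D₁ < 1) (hc2 : h * M₀ * D₀ ≤ R) :
    ∃ u : ℝ → Fin d → ℝ,
      (ContinuousOn u (Icc 0 1) ∧
        (∀ τ ∈ Icc (0:ℝ) 1, u τ ∈ Metric.closedBall y₀ R) ∧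
        ∀ τ ∈ Icc (0:ℝ) 1, u τ = y₀ + h • ∫ σ in (0:ℝ)..1, A τ σ • f (u σ)) ∧
      ∀ w : ℝ → Fin d → ℝ,
        (ContinuousOn w (Icc 0 1) ∧
          (∀ τ ∈ Icc (0:ℝ) 1, w τ ∈ Metric.closedBall y₀ R) ∧
          ∀ τ ∈ Icc (0:ℝ) 1, w τ = y₀ + h • ∫ σ in (0:ℝ)..1, A τ σ • f (w σ)) →
        EqOn w u (Icc 0 1) := by
  have hM : 0 ≤ M₀ := (abs_nonneg _).trans (hM0 0 (by simp) 0 (by simp))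
  let k : C(unitInterval × unitInterval, ℝ) :=
    ⟨fun p => A p.1 p.2, hA.comp_continuous
      (f := fun p : unitInterval × unitInterval => ((p.1 : ℝ), (p.2 : ℝ)))
      (by fun_prop) fun p => ⟨p.1.2, p.2.2⟩⟩
  have hlip : h * M₀ * max D₁ 0 < 1 := by
    rcases le_total D₁ 0 with hD | hD <;> simp [hD, hc1]
  have key := existsUnique_hammersteinOperator_fixedPoint (μ := (volume : Measure unitInterval))
    (k := k) (f := ⟨f, hf⟩) hR.le hh hM (le_max_right D₁ 0)
    (fun p => hM0 _ p.1.2 _ p.2.2) hD0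
    (fun y hy z hz => (hD1 y hy z hz).trans (by gcongr; exact le_max_left _ _)) hlip hc2
  have happly (w : ℝ → Fin d → ℝ) (v : C(unitInterval, Fin d → ℝ)) (hwv : ∀ σ, v σ = w σ)
      (τ : unitInterval) : hammersteinOperator volume k ⟨f, hf⟩ y₀ h v τ
        = y₀ + h • ∫ σ in (0:ℝ)..1, A τ σ • f (w σ) := by
    rw [← unitInterval.integral_coe]
    simp [hammersteinOperator, hwv, k]
  obtain ⟨u, ⟨hu, hfix⟩, huniq⟩ := key
  have hext (σ : unitInterval) : u σ = IccExtend zero_le_one u σ := by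
    rw [IccExtend_val]
  refine ⟨IccExtend zero_le_one u, ⟨u.continuous.Icc_extend'.continuousOn,
    fun τ hτ => ?_, fun τ hτ => ?_⟩, fun w ⟨hw, hwB, hweq⟩ τ hτ => ?_⟩
  · exact hext ⟨τ, hτ⟩ ▸ hu ⟨τ, hτ⟩
  · rw [← happly _ u hext ⟨τ, hτ⟩, hfix]
    exact (hext ⟨τ, hτ⟩).symm
  · let v : C(unitInterval, Fin d → ℝ) := ⟨(Icc 0 1).domRestrict w, hw.domRestrict⟩
    have hv : v = u := huniq v ⟨fun σ => hwB σ σ.2, ContinuousMap.ext fun σ =>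
      (happly w v (fun _ => rfl) σ).trans (hweq σ σ.2).symm⟩
    exact (DFunLike.congr_fun hv ⟨τ, hτ⟩).trans (hext ⟨τ, hτ⟩)
end

section
/- Let y₀ ∈ ℝ^d, R > 0, B = {y ∈ ℝ^d : ‖y − y₀‖_∞ ≤ R}. Let f : ℝ^d → ℝ^d be continuously differentiable with ‖f(y)‖_∞ ≤ D₀, ‖f′(y)‖ ≤ D₁ (operator norm induced by ‖·‖_∞), and ‖f′(y) − f′(z)‖ ≤ L₂‖y − z‖_∞ for all y, z ∈ B. Let ε > 0 satisfy ε·M₀·D₁ < 1 and ε·M₀·D₀ ≤ R, and let A : [0,1]² × [0,ε] → ℝ be continuous and continuously differentiable in the third variable h, with |A(τ,σ,h)| ≤ M₀ and |∂A/∂h(τ,σ,h)| ≤ M₁ for all τ, σ, h. For each h ∈ [0,ε] let u(·,h) : [0,1] → B be the unique continuous solution of u(τ,h) = y₀ + h∫₀¹ A(τ,σ,h) f(u(σ,h)) dσ. Then u is continuously differentiable with respect to h on [0,ε], and ‖∂u/∂h(τ,h)‖_∞ ≤ (M₀ + ε·M₁)·D₀ / (1 − ε·M₀·D₁) for all τ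 ∈ [0,1] and h ∈ [0,ε]. -/
open MeasureTheory Set

section Hammerstein

open Filter Topology Asymptotics
open scoped unitInterval

set_option maxSynthPendingDepth 6

/-- The integral operator on `C([0,1], E)` with continuous kernel `a`, as a continuous linear
function of the kernel. -/
noncomputable def integralOperator (E : Type*) [NormedAddCommGroup E] [NormedSpace ℝ E] :
    C(I × I, ℝ) →L[ℝ] C(I, E) →L[ℝ] C(I, E) :=
  LinearMap.mkContinuous₂
    (LinearMap.mk₂ ℝ
      (fun (a : C(I × I, ℝ)) (v : C(I, E)) => (⟨fun τ => ∫ s : I, a (τ, s) • v s, by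
        have := continuous_parametric_integral_of_continuous (μ := (volume : Measure I))
          (f := fun τ s : I => a (τ, s) • v s) (by fun_prop) isCompact_univ
        simpa using this⟩ : C(I, E)))
      (fun a b v => by
        ext τ
        simp only [ContinuousMap.coe_mk, ContinuousMap.add_apply, add_smul]
        exact integral_add (Continuous.integrable_of_hasCompactSupport (by fun_prop)
          (HasCompactSupport.of_compactSpace _)) (Continuous.integrable_of_hasCompactSupport
            (by fun_prop) (HasCompactSupport.of_compactSpace _)))
      (fun c a v => by
        ext τ
        simp [mul_smul, integral_smul])
      (fun a v w => by
        ext τ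
        simp only [ContinuousMap.coe_mk, ContinuousMap.add_apply, smul_add]
        exact integral_add (Continuous.integrable_of_hasCompactSupport (by fun_prop)
          (HasCompactSupport.of_compactSpace _)) (Continuous.integrable_of_hasCompactSupport
            (by fun_prop) (HasCompactSupport.of_compactSpace _)))
      (fun c a v => by
        ext τ
        simp [smul_comm _ c, integral_smul]))
    1 (fun a v => by
      rw [ContinuousMap.norm_le _ (by positivity)]
      intro τ
      have := norm_integral_le_of_norm_le_const (μ := (volume : Measure I))
        (f := fun s => a (τ, s) • v s) (C := 1 * ‖a‖ * ‖v‖) (ae_of_all _ fun s => by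
          rw [norm_smul, one_mul]
          gcongr
          · exact a.norm_coe_le_norm _
          · exact v.norm_coe_le_norm _)
      simpa using this)

section Operators

variable {E : Type*} [NormedAddCommGroup E] [NormedSpace ℝ E]

theorem integralOperator_apply (a : C(I × I, ℝ)) (v : C(I, E)) (τ : I) :
    integralOperator E a v τ = ∫ s : I, a (τ, s) • v s := rfl

theorem norm_integralOperator_le (a : C(I × I, ℝ)) : ‖integralOperator E a‖ ≤ ‖a‖ := by
  have h : ‖integralOperator E‖ ≤ 1 := LinearMap.mkContinuous₂_norm_le _ zero_le_one _
  simpa using (integralOperator E).le_of_opNorm_le h a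

/-- Pointwise application of a continuous family of operators to a continuous function,
as a continuous linear function of the family. -/
noncomputable def pointwiseOperator (E : Type*) [NormedAddCommGroup E] [NormedSpace ℝ E] :
    C(I, E →L[ℝ] E) →L[ℝ] C(I, E) →L[ℝ] C(I, E) :=
  LinearMap.mkContinuous₂
    (LinearMap.mk₂ ℝ (fun (m : C(I, E →L[ℝ] E)) (v : C(I, E)) =>
        (⟨fun s => m s (v s), by fun_prop⟩ : C(I, E)))
      (fun m n v => by ext; simp) (fun c m v => by ext; simp)
      (fun m v w => by ext; simp) (fun c m v => by ext; simp))
    1 (fun m v => by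
      rw [ContinuousMap.norm_le _ (by positivity)]
      intro s
      rw [one_mul]
      exact (m s).le_of_opNorm_le_of_le (m.norm_coe_le_norm s) (v.norm_coe_le_norm s))

theorem norm_pointwiseOperator_le (m : C(I, E →L[ℝ] E)) : ‖pointwiseOperator E m‖ ≤ ‖m‖ := by
  have h : ‖pointwiseOperator E‖ ≤ 1 := LinearMap.mkContinuous₂_norm_le _ zero_le_one _
  simpa using (pointwiseOperator E).le_of_opNorm_le h m

end Operators

/-- Implicit differentiation of a solution of `U k = c + J k (N k)`, where `N k` depends on `U k`
with linearization `L` at the point `h`. -/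
theorem hasDerivWithinAt_of_eq_add_apply {X : Type*} [NormedAddCommGroup X] [NormedSpace ℝ X]
    {S : Set ℝ} {U N : ℝ → X} {J : ℝ → X →L[ℝ] X} {J' L : X →L[ℝ] X} {c : X} {h : ℝ}
    (hh : h ∈ S) (hU : ∀ k ∈ S, U k = c + J k (N k)) (hJ : HasDerivWithinAt J J' S h)
    (hN : (fun k => N k - N h) =O[𝓝[S] h] fun k => k - h)
    (hL : (fun k => N k - N h - L (U k - U h)) =o[𝓝[S] h] fun k => k - h)
    (hunit : IsUnit (1 - J h * L)) :
    HasDerivWithinAt U (Ring.inverse (1 - J h * L) (J' (N h))) S h := by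
  have hsmall : Tendsto (fun k => J k - J h) (𝓝[S] h) (𝓝 0) := by
    simpa using hJ.continuousWithinAt.tendsto.sub_const (J h)
  have hprod : (fun k => (J k - J h) (N k - N h)) =o[𝓝[S] h] fun k => k - h := by
    have h1 : (fun k => ‖J k - J h‖ * ‖N k - N h‖) =o[𝓝[S] h] fun k => (1 : ℝ) * ‖k - h‖ :=
      ((isLittleO_one_iff ℝ).2 hsmall).norm_left.mul_isBigO hN.norm_norm
    simp only [one_mul] at h1
    exact (IsBigO.of_norm_le fun k => (J k - J h).le_opNorm _).trans_isLittleO h1.of_norm_right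
  have hlin : (fun k => (J k - J h - (k - h) • J') (N h)) =o[𝓝[S] h] fun k => k - h :=
    ((ContinuousLinearMap.apply ℝ X (N h)).isBigO_comp _ _).trans_isLittleO
      (hasDerivWithinAt_iff_isLittleO.1 hJ)
  have hφ : HasDerivWithinAt (fun k => (1 - J h * L) (U k)) (J' (N h)) S h := by
    rw [hasDerivWithinAt_iff_isLittleO]
    refine ((hprod.add hlin).add (((J h).isBigO_comp _ _).trans_isLittleO hL)).congr' ?_ .rfl
    filter_upwards [self_mem_nhdsWithin] with k hk
    have e : U k - U h = J k (N k) - J h (N h) := by rw [hU k hk, hU h hh]; abel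
    simp only [sub_apply, smul_apply, map_sub,
      one_apply_eq_self, mul_apply_eq_comp]
    rw [show U k - J h (L (U k)) - (U h - J h (L (U h)))
      = (U k - U h) - J h (L (U k)) + J h (L (U h)) by abel, e]
    abel
  have := (Ring.inverse (1 - J h * L)).hasFDerivAt.comp_hasDerivWithinAt h hφ
  refine this.congr_of_mem (fun k _ => ?_) hh
  change U k = (Ring.inverse (1 - J h * L) * (1 - J h * L)) (U k)
  rw [Ring.inverse_mul_cancel _ hunit, one_apply_eq_self]

/-- A curve in `C(K, ℝ)` with pointwise derivative given by a continuous curve in `C(K, ℝ)` is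
differentiable. -/
theorem ContinuousMap.hasDerivWithinAt_of_apply {K : Type*} [TopologicalSpace K] [CompactSpace K]
    {S : Set ℝ} (hS : Convex ℝ S) {a a' : ℝ → C(K, ℝ)} {h : ℝ} (hh : h ∈ S)
    (ha : ∀ q, ∀ k ∈ S, HasDerivWithinAt (fun s => a s q) (a' k q) S k)
    (ha' : ContinuousWithinAt a' S h) : HasDerivWithinAt a (a' h) S h := by
  rw [hasDerivWithinAt_iff_isLittleO, isLittleO_iff]
  intro c hc
  obtain ⟨δ, hδ, hball⟩ := Metric.continuousWithinAt_iff.1 ha' c hc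
  filter_upwards [self_mem_nhdsWithin, mem_nhdsWithin_of_mem_nhds (Metric.ball_mem_nhds h hδ)]
    with k hk hkδ
  rw [ContinuousMap.norm_le _ (by positivity)]
  intro q
  have hconv : Convex ℝ (S ∩ Metric.ball h δ) := hS.inter (convex_ball h δ)
  have := hconv.norm_image_sub_le_of_norm_hasDerivWithin_le
    (f := fun s => a s q - s * a' h q) (f' := fun s => a' s q - 1 * a' h q) (C := c)
    (fun s hs => ((ha q s hs.1).mono inter_subset_left).sub
      ((hasDerivWithinAt_id s _).mul_const _))
    (fun s hs => by
      rw [one_mul]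
      have h1 := (a' s - a' h).norm_coe_le_norm q
      have h2 := hball hs.1 hs.2
      rw [dist_eq_norm] at h2
      exact h1.trans h2.le)
    ⟨hh, Metric.mem_ball_self hδ⟩ ⟨hk, hkδ⟩
  convert this using 1
  change ‖a k q - a h q - (k - h) * a' h q‖ = _
  congr 1
  ring

/-- Second-order Taylor bound for a function with Lipschitz derivative on a convex set. -/
theorem Convex.norm_image_sub_sub_fderiv_le {E F : Type*} [NormedAddCommGroup E] [NormedSpace ℝ E]
    [NormedAddCommGroup F] [NormedSpace ℝ F] {f : E → F} {s : Set E} (hs : Convex ℝ s) {C : ℝ}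
    (hf : ∀ x ∈ s, DifferentiableAt ℝ f x)
    (hC : ∀ x ∈ s, ∀ y ∈ s, ‖fderiv ℝ f x - fderiv ℝ f y‖ ≤ C * ‖x - y‖) {x y : E} (hx : x ∈ s)
    (hy : y ∈ s) : ‖f y - f x - fderiv ℝ f x (y - x)‖ ≤ |C| * ‖y - x‖ * ‖y - x‖ := by
  have hsub := hs.segment_subset hx hy
  refine (convex_segment x y).norm_image_sub_le_of_norm_fderiv_le'
    (fun z hz => hf z (hsub hz)) (fun z hz => ?_) (left_mem_segment ℝ x y)
    (right_mem_segment ℝ x y)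
  refine (hC z (hsub hz) x hx).trans ?_
  gcongr
  · exact le_abs_self C
  · exact norm_sub_le_of_mem_segment hz

/-- Continuously differentiable dependence on `h` of the solutions of the Hammerstein equation
`U = y₀ + h K (f ∘ U)`, where `K` is the integral operator with kernel `a h`. -/
theorem exists_hasDerivWithinAt_of_eq_add_smul_integralOperator {E : Type*} [NormedAddCommGroup E]
    [NormedSpace ℝ E] [CompleteSpace E] {f : C(E, E)} (hf : ContDiff ℝ 1 f) {B : Set E}
    (hB : Convex ℝ B) {D₀ D₁ L₂ M₀ M₁ ε : ℝ} (hε : 0 ≤ ε)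
    (hD0 : ∀ y ∈ B, ‖f y‖ ≤ D₀) (hD1 : ∀ y ∈ B, ‖fderiv ℝ f y‖ ≤ D₁)
    (hL2 : ∀ y ∈ B, ∀ z ∈ B, ‖fderiv ℝ f y - fderiv ℝ f z‖ ≤ L₂ * ‖y - z‖)
    (hc : ε * M₀ * D₁ < 1) {a a' : ℝ → C(I × I, ℝ)}
    (ha : ∀ h ∈ Icc 0 ε, HasDerivWithinAt a (a' h) (Icc 0 ε) h) (ha' : ContinuousOn a' (Icc 0 ε))
    (hM0 : ∀ h ∈ Icc 0 ε, ‖a h‖ ≤ M₀) (hM1 : ∀ h ∈ Icc 0 ε, ‖a' h‖ ≤ M₁)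
    {c : C(I, E)} {U : ℝ → C(I, E)} (hUB : ∀ h ∈ Icc 0 ε, ∀ s, U h s ∈ B)
    (hU : ∀ h ∈ Icc 0 ε, U h = c + h • integralOperator E (a h) (f.comp (U h))) :
    ∃ U' : ℝ → C(I, E), (∀ h ∈ Icc 0 ε, HasDerivWithinAt U (U' h) (Icc 0 ε) h) ∧
      ContinuousOn U' (Icc 0 ε) ∧
      ∀ h ∈ Icc 0 ε, ‖U' h‖ ≤ (M₀ + ε * M₁) * D₀ / (1 - ε * M₀ * D₁) := by
  have h0 : (0 : ℝ) ∈ Icc 0 ε := ⟨le_rfl, hε⟩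
  have hM0' : 0 ≤ M₀ := (norm_nonneg _).trans (hM0 0 h0)
  have hM1' : 0 ≤ M₁ := (norm_nonneg _).trans (hM1 0 h0)
  have hD0' : 0 ≤ D₀ := (norm_nonneg _).trans (hD0 _ (hUB 0 h0 0))
  have hD1' : 0 ≤ D₁ := (norm_nonneg _).trans (hD1 _ (hUB 0 h0 0))
  have hq : 0 < 1 - ε * M₀ * D₁ := by linarith
  have hdiff : ∀ x, DifferentiableAt ℝ f x := hf.differentiable one_ne_zero
  let f' : C(E, E →L[ℝ] E) := ⟨fderiv ℝ f, hf.continuous_fderiv one_ne_zero⟩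
  let N : ℝ → C(I, E) := fun h => f.comp (U h)
  let J : ℝ → C(I, E) →L[ℝ] C(I, E) := fun h => h • integralOperator E (a h)
  let J' : ℝ → C(I, E) →L[ℝ] C(I, E) := fun h =>
    h • integralOperator E (a' h) + (1 : ℝ) • integralOperator E (a h)
  let L : ℝ → C(I, E) →L[ℝ] C(I, E) := fun h => pointwiseOperator E (f'.comp (U h))
  have hK : ∀ h ∈ Icc 0 ε, ‖integralOperator E (a h)‖ ≤ M₀ := fun h hh =>
    (norm_integralOperator_le _).trans (hM0 h hh)
  have hK' : ∀ h ∈ Icc 0 ε, ‖integralOperator E (a' h)‖ ≤ M₁ := fun h hh =>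
    (norm_integralOperator_le _).trans (hM1 h hh)
  have habs : ∀ h ∈ Icc 0 ε, ‖h‖ ≤ ε := fun h hh => by
    rw [Real.norm_of_nonneg hh.1]; exact hh.2
  have hNle : ∀ h ∈ Icc 0 ε, ‖N h‖ ≤ D₀ := fun h hh =>
    (ContinuousMap.norm_le _ hD0').2 fun s => hD0 _ (hUB h hh s)
  have hLle : ∀ h ∈ Icc 0 ε, ‖L h‖ ≤ D₁ := fun h hh =>
    (norm_pointwiseOperator_le _).trans
      ((ContinuousMap.norm_le _ hD1').2 fun s => hD1 _ (hUB h hh s))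
  have hJle : ∀ h ∈ Icc 0 ε, ‖J h‖ ≤ ε * M₀ := fun h hh => by
    rw [norm_smul]
    exact mul_le_mul (habs h hh) (hK h hh) (norm_nonneg _) hε
  have hJ'le : ∀ h ∈ Icc 0 ε, ‖J' h‖ ≤ M₀ + ε * M₁ := fun h hh => by
    refine (norm_add_le _ _).trans ?_
    rw [norm_smul, one_smul, add_comm]
    exact add_le_add (hK h hh) (mul_le_mul (habs h hh) (hK' h hh) (norm_nonneg _) hε)
  have hJ : ∀ h ∈ Icc 0 ε, HasDerivWithinAt J (J' h) (Icc 0 ε) h := fun h hh =>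
    (hasDerivWithinAt_id h _).smul
      ((integralOperator E).hasFDerivAt.comp_hasDerivWithinAt h (ha h hh))
  have hJL : ∀ h ∈ Icc 0 ε, ‖J h * L h‖ ≤ ε * M₀ * D₁ := fun h hh =>
    (norm_mul_le _ _).trans
      (mul_le_mul (hJle h hh) (hLle h hh) (norm_nonneg _) (by positivity))
  have hunit : ∀ h ∈ Icc 0 ε, IsUnit (1 - J h * L h) := fun h hh =>
    isUnit_one_sub_of_norm_lt_one ((hJL h hh).trans_lt hc)
  have hNlip : ∀ h ∈ Icc 0 ε, ∀ k ∈ Icc 0 ε, ‖N k - N h‖ ≤ D₁ * ‖U k - U h‖ :=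
    fun h hh k hk => by
      rw [ContinuousMap.norm_le _ (by positivity)]
      intro s
      refine (hB.norm_image_sub_le_of_norm_fderiv_le (fun x _ => hdiff x) hD1 (hUB h hh s)
        (hUB k hk s)).trans ?_
      gcongr
      exact (U k - U h).norm_coe_le_norm s
  have hNquad : ∀ h ∈ Icc 0 ε, ∀ k ∈ Icc 0 ε,
      ‖N k - N h - L h (U k - U h)‖ ≤ |L₂| * ‖U k - U h‖ * ‖U k - U h‖ :=
    fun h hh k hk => by
      rw [ContinuousMap.norm_le _ (by positivity)]
      intro s
      refine (hB.norm_image_sub_sub_fderiv_le (fun x _ => hdiff x) hL2 (hUB h hh s)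
        (hUB k hk s)).trans ?_
      gcongr <;> exact (U k - U h).norm_coe_le_norm s
  have hUlip : ∀ h ∈ Icc 0 ε, ∀ k ∈ Icc 0 ε,
      ‖U k - U h‖ ≤ (M₀ + ε * M₁) * D₀ / (1 - ε * M₀ * D₁) * ‖k - h‖ := fun h hh k hk => by
    have e : U k - U h = (J k - J h) (N k) + J h (N k - N h) := by
      rw [hU k hk, hU h hh, sub_apply, map_sub]
      change c + J k (N k) - (c + J h (N h)) = _
      abel
    have h1 : ‖J k - J h‖ ≤ (M₀ + ε * M₁) * ‖k - h‖ :=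
      (convex_Icc 0 ε).norm_image_sub_le_of_norm_hasDerivWithin_le hJ hJ'le hh hk
    have h2 : ‖U k - U h‖ ≤ (M₀ + ε * M₁) * ‖k - h‖ * D₀ + ε * M₀ * (D₁ * ‖U k - U h‖) := by
      conv_lhs => rw [e]
      exact (norm_add_le _ _).trans (add_le_add
        ((J k - J h).le_of_opNorm_le_of_le h1 (hNle k hk))
        ((J h).le_of_opNorm_le_of_le (hJle h hh) (hNlip h hh k hk)))
    rw [div_mul_eq_mul_div, le_div_iff₀ hq]
    linarith
  have hUO : ∀ h ∈ Icc 0 ε, (fun k => U k - U h) =O[𝓝[Icc 0 ε] h] fun k => k - h :=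
    fun h hh => IsBigO.of_bound _ (eventually_mem_nhdsWithin.mono fun k hk => hUlip h hh k hk)
  have hUcont : ContinuousOn U (Icc 0 ε) := fun h hh => by
    have : Tendsto (fun k => k - h) (𝓝[Icc 0 ε] h) (𝓝 0) := by
      simpa using (continuousWithinAt_id (x := h) (s := Icc 0 ε)).tendsto.sub_const h
    exact tendsto_sub_nhds_zero_iff.1 ((hUO h hh).trans_tendsto this)
  have hNO : ∀ h ∈ Icc 0 ε, (fun k => N k - N h) =O[𝓝[Icc 0 ε] h] fun k => k - h :=
    fun h hh => (IsBigO.of_bound _ (eventually_mem_nhdsWithin.mono fun k hk =>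
      hNlip h hh k hk)).trans (hUO h hh)
  have hNo : ∀ h ∈ Icc 0 ε,
      (fun k => N k - N h - L h (U k - U h)) =o[𝓝[Icc 0 ε] h] fun k => k - h := fun h hh => by
    have h1 : (fun k => N k - N h - L h (U k - U h)) =O[𝓝[Icc 0 ε] h]
        fun k => ‖U k - U h‖ * ‖U k - U h‖ := by
      refine IsBigO.of_bound |L₂| (eventually_mem_nhdsWithin.mono fun k hk => ?_)
      rw [norm_mul, norm_norm, ← mul_assoc]
      exact hNquad h hh k hk
    have h2 : (fun k => U k - U h) =o[𝓝[Icc 0 ε] h] fun _ => (1 : ℝ) :=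
      (isLittleO_one_iff ℝ).2 (tendsto_sub_nhds_zero_iff.2 (hUcont h hh))
    have h3 := h2.norm_left.mul_isBigO (hUO h hh).norm_left
    simp only [one_mul] at h3
    exact h1.trans_isLittleO h3
  refine ⟨fun h => Ring.inverse (1 - J h * L h) (J' h (N h)), fun h hh =>
    hasDerivWithinAt_of_eq_add_apply hh hU (hJ h hh) (hNO h hh) (hNo h hh) (hunit h hh), ?_, ?_⟩
  · have hNc : ContinuousOn N (Icc 0 ε) := f.continuous_postcomp.comp_continuousOn hUcont
    have hLc : ContinuousOn L (Icc 0 ε) := (pointwiseOperator E).continuous.comp_continuousOn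
      (f'.continuous_postcomp.comp_continuousOn hUcont)
    have hac : ContinuousOn a (Icc 0 ε) := fun h hh => (ha h hh).continuousWithinAt
    have hJc : ContinuousOn J (Icc 0 ε) := fun h hh => (hJ h hh).continuousWithinAt
    have hJ'c : ContinuousOn J' (Icc 0 ε) :=
      (continuousOn_id.smul ((integralOperator E).continuous.comp_continuousOn ha')).add
        (((integralOperator E).continuous.comp_continuousOn hac).const_smul (1 : ℝ))
    refine ContinuousOn.clm_apply (fun h hh => ?_) (hJ'c.clm_apply hNc)
    have hinv := NormedRing.inverse_continuousAt (hunit h hh).unit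
    exact ContinuousAt.comp_continuousWithinAt (g := Ring.inverse) (f := fun h => 1 - J h * L h)
      hinv ((continuousOn_const.sub (hJc.mul hLc)) h hh)
  · intro h hh
    set w := Ring.inverse (1 - J h * L h) (J' h (N h)) with hw
    have hw1 : (1 - J h * L h) w = J' h (N h) := by
      rw [hw, ← mul_apply_eq_comp, Ring.mul_inverse_cancel _ (hunit h hh), one_apply_eq_self]
    have hw2 : w = J' h (N h) + (J h * L h) w := by
      rw [← hw1, sub_apply, one_apply_eq_self, sub_add_cancel]
    have hw3 : ‖w‖ ≤ (M₀ + ε * M₁) * D₀ + ε * M₀ * D₁ * ‖w‖ := by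
      conv_lhs => rw [hw2]
      exact (norm_add_le _ _).trans (add_le_add
        ((J' h).le_of_opNorm_le_of_le (hJ'le h hh) (hNle h hh))
        ((J h * L h).le_of_opNorm_le (hJL h hh) w))
    rw [le_div_iff₀ hq]
    linarith

/-- A kernel continuous on `[0,1]² × [0,ε]` as a continuous curve in `C([0,1]², ℝ)`,
constant outside the parameter interval. -/
noncomputable def kernelCurve {ε : ℝ} (hε : 0 ≤ ε) (A : ℝ → ℝ → ℝ → ℝ)
    (hA : ContinuousOn (fun q : ℝ × ℝ × ℝ => A q.1 q.2.1 q.2.2)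
      (Icc 0 1 ×ˢ Icc 0 1 ×ˢ Icc 0 ε)) : C(ℝ, C(I × I, ℝ)) :=
  ContinuousMap.curry ⟨fun p => A p.2.1 p.2.2 (projIcc 0 ε hε p.1),
    hA.comp_continuous (f := fun p : ℝ × I × I =>
      ((p.2.1 : ℝ), (p.2.2 : ℝ), (projIcc 0 ε hε p.1 : ℝ)))
      (by
        have : Continuous (projIcc 0 ε hε) := continuous_projIcc
        fun_prop)
      fun p => ⟨p.2.1.2, p.2.2.2, (projIcc 0 ε hε p.1).2⟩⟩

theorem kernelCurve_apply {ε : ℝ} (hε : 0 ≤ ε) {A : ℝ → ℝ → ℝ → ℝ}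
    (hA : ContinuousOn (fun q : ℝ × ℝ × ℝ => A q.1 q.2.1 q.2.2)
      (Icc 0 1 ×ˢ Icc 0 1 ×ˢ Icc 0 ε)) {h : ℝ} (hh : h ∈ Icc 0 ε) (q : I × I) :
    kernelCurve hε A hA h q = A q.1 q.2 h := by
  change A q.1 q.2 (projIcc 0 ε hε h) = _
  rw [projIcc_of_mem hε hh]

end Hammerstein

/-- **Smooth dependence of the FFCFE solution on the stepsize (first derivative
with explicit bound).**  Here `ℝ^d = Fin d → ℝ` carries the maximum norm and
`B = Metric.closedBall y₀ R`.  Let `f` be C¹ with `‖f‖ ≤ D₀`,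
`‖f'‖ ≤ D₁` (induced operator norm) and `f'` Lipschitz with constant `L₂` on
`B`.  Let `ε > 0` satisfy `ε M₀ D₁ < 1` and `ε M₀ D₀ ≤ R`, and let the kernel
`A(τ,σ,h)` be continuous on `[0,1]² × [0,ε]` and C¹ in `h` with derivative
`A'`, also continuous, and with `|A| ≤ M₀`, `|A'| ≤ M₁`.  If for each
`h ∈ [0,ε]` the function `u(·,h) : [0,1] → B` is a continuous solution of
`u(τ,h) = y₀ + h ∫₀¹ A(τ,σ,h) f(u(σ,h)) dσ`, then `u` is continuously
differentiable in `h` on `[0,ε]`, with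
`‖∂u/∂h(τ,h)‖ ≤ (M₀ + ε M₁) D₀ / (1 - ε M₀ D₁)`. -/
theorem ffcfe_smooth_dependence_on_stepsize (d : ℕ) (y₀ : Fin d → ℝ)
    (R : ℝ) (hR : 0 < R)
    (f : (Fin d → ℝ) → (Fin d → ℝ)) (hf : ContDiff ℝ 1 f)
    (D₀ D₁ L₂ M₀ M₁ ε : ℝ) (hε : 0 < ε)
    (hD0 : ∀ y ∈ Metric.closedBall y₀ R, ‖f y‖ ≤ D₀)
    (hD1 : ∀ y ∈ Metric.closedBall y₀ R, ‖fderiv ℝ f y‖ ≤ D₁)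
    (hL2 : ∀ y ∈ Metric.closedBall y₀ R, ∀ z ∈ Metric.closedBall y₀ R,
        ‖fderiv ℝ f y - fderiv ℝ f z‖ ≤ L₂ * ‖y - z‖)
    (hc1 : ε * M₀ * D₁ < 1) (hc2 : ε * M₀ * D₀ ≤ R)
    (A A' : ℝ → ℝ → ℝ → ℝ)
    (hAcont : ContinuousOn (fun q : ℝ × ℝ × ℝ => A q.1 q.2.1 q.2.2)
        (Icc 0 1 ×ˢ Icc 0 1 ×ˢ Icc 0 ε))
    (hA'cont : ContinuousOn (fun q : ℝ × ℝ × ℝ => A' q.1 q.2.1 q.2.2)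
        (Icc 0 1 ×ˢ Icc 0 1 ×ˢ Icc 0 ε))
    (hAderiv : ∀ τ ∈ Icc (0:ℝ) 1, ∀ σ ∈ Icc (0:ℝ) 1, ∀ h ∈ Icc (0:ℝ) ε,
        HasDerivWithinAt (fun s => A τ σ s) (A' τ σ h) (Icc 0 ε) h)
    (hM0 : ∀ τ ∈ Icc (0:ℝ) 1, ∀ σ ∈ Icc (0:ℝ) 1, ∀ h ∈ Icc (0:ℝ) ε, |A τ σ h| ≤ M₀)
    (hM1 : ∀ τ ∈ Icc (0:ℝ) 1, ∀ σ ∈ Icc (0:ℝ) 1, ∀ h ∈ Icc (0:ℝ) ε, |A' τ σ h| ≤ M₁)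
    (u : ℝ → ℝ → Fin d → ℝ)
    (hucont : ∀ h ∈ Icc (0:ℝ) ε, ContinuousOn (fun τ => u τ h) (Icc 0 1))
    (huB : ∀ h ∈ Icc (0:ℝ) ε, ∀ τ ∈ Icc (0:ℝ) 1, u τ h ∈ Metric.closedBall y₀ R)
    (hueq : ∀ h ∈ Icc (0:ℝ) ε, ∀ τ ∈ Icc (0:ℝ) 1,
        u τ h = y₀ + h • ∫ σ in (0:ℝ)..1, A τ σ h • f (u σ h)) :
    ∃ u' : ℝ → ℝ → Fin d → ℝ,
      (∀ τ ∈ Icc (0:ℝ) 1, ∀ h ∈ Icc (0:ℝ) ε,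
        HasDerivWithinAt (fun s => u τ s) (u' τ h) (Icc 0 ε) h) ∧
      (∀ τ ∈ Icc (0:ℝ) 1, ContinuousOn (fun s => u' τ s) (Icc 0 ε)) ∧
      ∀ τ ∈ Icc (0:ℝ) 1, ∀ h ∈ Icc (0:ℝ) ε,
        ‖u' τ h‖ ≤ (M₀ + ε * M₁) * D₀ / (1 - ε * M₀ * D₁) := by
  have h0 : (0 : ℝ) ∈ Icc (0 : ℝ) ε := ⟨le_rfl, hε.le⟩
  have hz : (0 : ℝ) ∈ Icc (0 : ℝ) 1 := ⟨le_rfl, zero_le_one⟩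
  have hM0' : 0 ≤ M₀ := (abs_nonneg _).trans (hM0 0 hz 0 hz 0 h0)
  have hM1' : 0 ≤ M₁ := (abs_nonneg _).trans (hM1 0 hz 0 hz 0 h0)
  let a := kernelCurve hε.le A hAcont
  let a' := kernelCurve hε.le A' hA'cont
  let U : ℝ → C(unitInterval, Fin d → ℝ) := fun h =>
    ⟨fun τ => u τ (projIcc 0 ε hε.le h), (hucont _ (projIcc 0 ε hε.le h).2).domRestrict⟩
  have hUapp : ∀ h ∈ Icc (0 : ℝ) ε, ∀ τ : unitInterval, U h τ = u τ h := fun h hh τ => by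
    change u τ (projIcc 0 ε hε.le h) = _
    rw [projIcc_of_mem hε.le hh]
  have ha : ∀ h ∈ Icc (0 : ℝ) ε, HasDerivWithinAt a (a' h) (Icc 0 ε) h := fun h hh =>
    ContinuousMap.hasDerivWithinAt_of_apply (convex_Icc 0 ε) hh
      (fun q k hk => by
        rw [kernelCurve_apply hε.le hA'cont hk]
        exact (hAderiv q.1 q.1.2 q.2 q.2.2 k hk).congr_of_mem
          (fun s hs => kernelCurve_apply hε.le hAcont hs q) hk)
      a'.continuous.continuousWithinAt
  obtain ⟨U', hU', hU'c, hU'le⟩ := exists_hasDerivWithinAt_of_eq_add_smul_integralOperator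
    (f := ⟨f, hf.continuous⟩) (a := a) (a' := a') (U := U) (c := ContinuousMap.const _ y₀)
    hf (convex_closedBall y₀ R) hε.le hD0 hD1 hL2 hc1 ha a'.continuous.continuousOn
    (fun h hh => (ContinuousMap.norm_le _ hM0').2 fun q => by
      rw [kernelCurve_apply hε.le hAcont hh]
      exact hM0 q.1 q.1.2 q.2 q.2.2 h hh)
    (fun h hh => (ContinuousMap.norm_le _ hM1').2 fun q => by
      rw [kernelCurve_apply hε.le hA'cont hh]
      exact hM1 q.1 q.1.2 q.2 q.2.2 h hh)
    (fun h hh s => by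
      rw [hUapp h hh]
      exact huB h hh s s.2)
    (fun h hh => by
      ext1 τ
      rw [hUapp h hh, hueq h hh τ τ.2, intervalIntegral.integral_of_le zero_le_one,
        ← integral_Icc_eq_integral_Ioc, ← integral_subtype measurableSet_Icc]
      change _ = y₀ + h • integralOperator (Fin d → ℝ) (a h) _ τ
      rw [integralOperator_apply]
      congr 2
      refine integral_congr_ae (ae_of_all _ fun s => ?_)
      change A τ s h • f (u s h) = a h (τ, s) • f (U h s)
      rw [hUapp h hh, kernelCurve_apply hε.le hAcont hh])
  refine ⟨fun τ h => U' h (projIcc 0 1 zero_le_one τ), fun τ hτ h hh => ?_, fun τ _ => ?_,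
    fun τ _ h hh => ((U' h).norm_coe_le_norm _).trans (hU'le h hh)⟩
  · have := (ContinuousMap.evalCLM ℝ (projIcc 0 1 zero_le_one τ)).hasFDerivAt.comp_hasDerivWithinAt
      h (hU' h hh)
    refine this.congr_of_mem (fun s hs => ?_) hh
    change _ = U s (projIcc 0 1 zero_le_one τ)
    rw [hUapp s hs, projIcc_of_mem zero_le_one hτ]
  · exact (ContinuousMap.evalCLM ℝ (projIcc 0 1 zero_le_one τ)).continuous.comp_continuousOn hU'c
end

section
/- Let r ≥ 1, t₀ ∈ ℝ, and let φ₀, …, φ_{r−1} : ℝ → ℝ be C^r functions whose Wronskian matrix W = (φ_j^{(i)}(t₀))_{0≤i,j≤r−1} is nonsingular. For h > 0 set φ̃_i(τ) = φ_i(t₀ + τh) and let M(h) be the Gram matrix with entries M(h)_{ij} = ∫₀¹ φ̃_i(τ) φ̃_j(τ) dτ. Then there exists h₀ > 0 such that M(h) is nonsingular for all 0 < h ≤ h₀, and, defining P_h(τ,σ) = Σ_{i,j=0}^{r−1} φ̃_i(τ) (M(h)⁻¹)_{ij} φ̃_j(σ), one has lim_{h→0⁺} P_h(τ,σ) = Σ_{i=0}^{r−1}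 p̂_i(τ) p̂_i(σ) for all τ, σ ∈ [0,1], where p̂₀, …, p̂_{r−1} are the shifted Legendre polynomials on [0,1]. -/
open MeasureTheory Set Filter

theorem exists_abs_sub_taylor_sum_le {r : ℕ} (hr : 1 ≤ r) {f : ℝ → ℝ} (hf : ContDiff ℝ r f)
    (t₀ : ℝ) : ∃ K, 0 ≤ K ∧ ∀ s ∈ Icc (0:ℝ) 1,
      |f (t₀ + s) - ∑ i : Fin r, iteratedDeriv i f t₀ / (i : ℕ).factorial * s ^ (i : ℕ)|
        ≤ K * s ^ r := by
  obtain ⟨n, rfl⟩ : ∃ n, r = n + 1 := ⟨r - 1, by omega⟩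
  obtain ⟨K, hK⟩ := exists_taylor_mean_remainder_bound (f := f) (a := t₀) (b := t₀ + 1) (n := n)
    (by linarith) (by exact_mod_cast hf.contDiffOn)
  refine ⟨|K|, abs_nonneg K, fun s hs => ?_⟩
  have h := hK (t₀ + s) ⟨by linarith [hs.1], by linarith [hs.2]⟩
  rw [taylor_within_apply, ← Fin.sum_univ_eq_sum_range (fun k => (((k.factorial : ℝ))⁻¹ *
    (t₀ + s - t₀) ^ k) • iteratedDerivWithin k f (Icc t₀ (t₀ + 1)) t₀), Real.norm_eq_abs] at h
  have hsum : ∑ i : Fin (n + 1), (((i : ℕ).factorial : ℝ)⁻¹ * (t₀ + s - t₀) ^ (i : ℕ)) •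
      iteratedDerivWithin i f (Icc t₀ (t₀ + 1)) t₀ =
      ∑ i : Fin (n + 1), iteratedDeriv i f t₀ / (i : ℕ).factorial * s ^ (i : ℕ) := by
    refine Finset.sum_congr rfl fun i _ => ?_
    rw [iteratedDerivWithin_eq_iteratedDeriv (uniqueDiffOn_Icc (by linarith))
      ((hf.of_le (by exact_mod_cast i.2.le)).contDiffAt) ⟨le_rfl, by linarith⟩,
      add_sub_cancel_left, smul_eq_mul]
    ring
  rw [hsum, add_sub_cancel_left] at h
  exact h.trans (mul_le_mul_of_nonneg_right (le_abs_self K) (pow_nonneg hs.1 _))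

/-- Near `t₀`, suitable `h`-dependent linear combinations of the rescaled functions
`τ ↦ φ j (t₀ + τ * h)` approximate any polynomial of degree less than `r` to order `h`. -/
theorem exists_coeff_abs_sum_sub_eval_le {r : ℕ} (hr : 1 ≤ r) (t₀ : ℝ)
    (φ : Fin r → ℝ → ℝ) (hφ : ∀ i, ContDiff ℝ r (φ i))
    (hW : (Matrix.of fun i j : Fin r => iteratedDeriv i (φ j) t₀).det ≠ 0)
    (q : Polynomial ℝ) (hq : q.natDegree < r) :
    ∃ (a : ℝ → Fin r → ℝ) (K : ℝ), ∀ h ∈ Ioc (0:ℝ) 1, ∀ τ ∈ Icc (0:ℝ) 1,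
      |∑ j, a h j * φ j (t₀ + τ * h) - q.eval τ| ≤ K * h := by
  choose R hR0 hR using fun j => exists_abs_sub_taylor_sum_le hr (hφ j) t₀
  set W : Matrix (Fin r) (Fin r) ℝ := Matrix.of fun i j => iteratedDeriv i (φ j) t₀ with hWdef
  let c : ℝ → Fin r → ℝ := fun h k => (k : ℕ).factorial * (h ^ (k : ℕ))⁻¹ * q.coeff k
  let a : ℝ → Fin r → ℝ := fun h => W⁻¹.mulVec (c h)
  have hWa : ∀ h i, ∑ j, W i j * a h j = c h i := fun h i => by
    have : W.mulVec (a h) = c h := by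
      simp only [a, Matrix.mulVec_mulVec, Matrix.mul_nonsing_inv W (isUnit_iff_ne_zero.2 hW),
        Matrix.one_mulVec]
    exact congrFun this i
  let B : Fin r → ℝ := fun j => ∑ k : Fin r, |W⁻¹ j k| * ((k : ℕ).factorial * |q.coeff k|)
  have hB : ∀ h ∈ Ioc (0:ℝ) 1, ∀ j, |a h j| * h ^ r ≤ B j * h := by
    intro h hh j
    have hpos := hh.1
    calc |a h j| * h ^ r
        ≤ (∑ k, |W⁻¹ j k * c h k|) * h ^ r := by
          exact mul_le_mul_of_nonneg_right
            (Finset.abs_sum_le_sum_abs (fun k => W⁻¹ j k * c h k) Finset.univ) (by positivity)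
      _ ≤ B j * h := by
          rw [Finset.sum_mul, Finset.sum_mul]
          refine Finset.sum_le_sum fun k _ => ?_
          have hk : (h ^ (k : ℕ))⁻¹ * h ^ r ≤ h := by
            rw [inv_mul_le_iff₀ (by positivity), ← pow_succ]
            exact pow_le_pow_of_le_one hpos.le hh.2 k.2
          have habs : |W⁻¹ j k * c h k| =
              |W⁻¹ j k| * ((k : ℕ).factorial * |q.coeff k|) * (h ^ (k : ℕ))⁻¹ := by
            simp only [c, abs_mul, abs_inv, abs_pow, abs_of_pos hpos, Nat.abs_cast]
            ring
          rw [habs, mul_assoc]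
          gcongr
  refine ⟨a, ∑ j, R j * B j, fun h hh τ hτ => ?_⟩
  have hpos := hh.1
  have hs : τ * h ∈ Icc (0:ℝ) 1 :=
    ⟨mul_nonneg hτ.1 hpos.le, mul_le_one₀ hτ.2 hpos.le hh.2⟩
  have hmain : ∑ j, a h j * (∑ i : Fin r, iteratedDeriv i (φ j) t₀ / (i : ℕ).factorial *
      (τ * h) ^ (i : ℕ)) = q.eval τ := by
    rw [Polynomial.eval_eq_sum_range' hq, ← Fin.sum_univ_eq_sum_range (fun k => q.coeff k * τ ^ k)]
    simp only [Finset.mul_sum]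
    rw [Finset.sum_comm]
    refine Finset.sum_congr rfl fun i _ => ?_
    calc ∑ j, a h j * (iteratedDeriv i (φ j) t₀ / (i : ℕ).factorial * (τ * h) ^ (i : ℕ))
        = (∑ j, W i j * a h j) * ((τ * h) ^ (i : ℕ) / (i : ℕ).factorial) := by
          rw [Finset.sum_mul]
          refine Finset.sum_congr rfl fun j _ => ?_
          simp only [hWdef, Matrix.of_apply]
          ring
      _ = q.coeff i * τ ^ (i : ℕ) := by
          rw [hWa, mul_pow]
          have : ((i : ℕ).factorial : ℝ) ≠ 0 := by positivity
          have : h ≠ 0 := hpos.ne'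
          simp only [c]
          field_simp
  rw [← hmain, ← Finset.sum_sub_distrib, Finset.sum_mul]
  refine (Finset.abs_sum_le_sum_abs _ _).trans (Finset.sum_le_sum fun j _ => ?_)
  rw [← mul_sub, abs_mul]
  calc _ ≤ |a h j| * (R j * (τ * h) ^ r) := by
        gcongr
        exact hR j _ hs
    _ ≤ |a h j| * (R j * h ^ r) := by
        have := hR0 j
        have := hs.1
        gcongr
        exact mul_le_of_le_one_left hpos.le hτ.2
    _ = R j * (|a h j| * h ^ r) := by ring
    _ ≤ R j * (B j * h) := mul_le_mul_of_nonneg_left (hB h hh j) (hR0 j)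
    _ = R j * B j * h := by ring

theorem dotProduct_inv_mulVec_eq_congruence {n : Type*} [Fintype n] [DecidableEq n]
    {A M : Matrix n n ℝ} (hA : A.det ≠ 0) (v w : n → ℝ) :
    v ⬝ᵥ M⁻¹.mulVec w =
      A.mulVec v ⬝ᵥ (A * M * A.transpose)⁻¹.mulVec (A.mulVec w) := by
  have hA' : IsUnit A.det := isUnit_iff_ne_zero.2 hA
  rw [Matrix.mul_inv_rev, Matrix.mul_inv_rev, Matrix.mulVec_mulVec, Matrix.mul_assoc,
    Matrix.mul_assoc, Matrix.nonsing_inv_mul A hA', Matrix.mul_one,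
    ← Matrix.mulVec_mulVec, Matrix.dotProduct_mulVec (A.mulVec v), ← Matrix.mulVec_transpose,
    Matrix.mulVec_mulVec, ← Matrix.transpose_nonsing_inv, Matrix.transpose_transpose,
    Matrix.nonsing_inv_mul A hA', Matrix.one_mulVec]

theorem mul_gram_mul_transpose {n : Type*} [Fintype n] (A : Matrix n n ℝ) {f : n → ℝ → ℝ}
    (hf : ∀ i, Continuous (f i)) :
    A * (Matrix.of fun i j => ∫ τ in (0:ℝ)..1, f i τ * f j τ) * A.transpose =
      Matrix.of fun i j => ∫ τ in (0:ℝ)..1, A.mulVec (fun k => f k τ) i *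
        A.mulVec (fun k => f k τ) j := by
  ext i j
  simp only [Matrix.mul_apply, Matrix.of_apply, Matrix.transpose_apply, Matrix.mulVec, dotProduct]
  simp only [Finset.sum_mul_sum]
  rw [intervalIntegral.integral_finsetSum
    fun k _ => Continuous.intervalIntegrable (by fun_prop) _ _]
  simp only [Finset.sum_mul]
  rw [Finset.sum_comm]
  refine Finset.sum_congr rfl fun k _ => ?_
  rw [intervalIntegral.integral_finsetSum
    fun l _ => Continuous.intervalIntegrable (by fun_prop) _ _]
  refine Finset.sum_congr rfl fun l _ => ?_
  rw [mul_right_comm, ← intervalIntegral.integral_const_mul]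
  exact intervalIntegral.integral_congr fun τ _ => by ring

theorem tendsto_of_abs_sub_le_mul {u : ℝ → ℝ} {l K : ℝ}
    (hu : ∀ h ∈ Ioc (0:ℝ) 1, |u h - l| ≤ K * h) :
    Tendsto u (nhdsWithin 0 (Ioi 0)) (nhds l) := by
  rw [tendsto_iff_dist_tendsto_zero]
  refine squeeze_zero' (g := fun h => K * h) (Eventually.of_forall fun _ => dist_nonneg) ?_ ?_
  · filter_upwards [Ioc_mem_nhdsGT (zero_lt_one (α := ℝ))] with h hh using hu h hh
  · have : Tendsto (fun h : ℝ => K * h) (nhds 0) (nhds (K * 0)) :=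
      (continuous_const.mul continuous_id).tendsto 0
    rw [mul_zero] at this
    exact this.mono_left nhdsWithin_le_nhds

theorem tendsto_integral_mul_of_abs_sub_le_mul {f g : ℝ → ℝ → ℝ} {p q : ℝ → ℝ} {K L : ℝ}
    (hf : ∀ h, Continuous (f h)) (hg : ∀ h, Continuous (g h))
    (hp : Continuous p) (hq : Continuous q)
    (hfp : ∀ h ∈ Ioc (0:ℝ) 1, ∀ τ ∈ Icc (0:ℝ) 1, |f h τ - p τ| ≤ K * h)
    (hgq : ∀ h ∈ Ioc (0:ℝ) 1, ∀ τ ∈ Icc (0:ℝ) 1, |g h τ - q τ| ≤ L * h) :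
    Tendsto (fun h => ∫ τ in (0:ℝ)..1, f h τ * g h τ) (nhdsWithin 0 (Ioi 0))
      (nhds (∫ τ in (0:ℝ)..1, p τ * q τ)) := by
  have bound : ∀ {u : ℝ → ℝ → ℝ} {v : ℝ → ℝ} {C : ℝ},
      (∀ h ∈ Ioc (0:ℝ) 1, ∀ τ ∈ Icc (0:ℝ) 1, |u h τ - v τ| ≤ C * h) →
      ∀ h ∈ Ioc (0:ℝ) 1, ∀ τ ∈ Icc (0:ℝ) 1, |u h τ| ≤ |v τ| + |C| := by
    intro u v C huv h hh τ hτ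
    have h1 := huv h hh τ hτ
    have h2 : C * h ≤ |C| := (mul_le_mul_of_nonneg_right (le_abs_self C) hh.1.le).trans
      (mul_le_of_le_one_right (abs_nonneg C) hh.2)
    linarith [abs_sub_abs_le_abs_sub (u h τ) (v τ)]
  have hmem : ∀ τ ∈ uIoc (0:ℝ) 1, τ ∈ Icc (0:ℝ) 1 := fun τ hτ => by
    rw [uIoc_of_le zero_le_one] at hτ
    exact Ioc_subset_Icc_self hτ
  refine intervalIntegral.tendsto_integral_filter_of_dominated_convergence
    (fun τ => (|p τ| + |K|) * (|q τ| + |L|))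
    (Eventually.of_forall fun h => ((hf h).mul (hg h)).aestronglyMeasurable) ?_
    (Continuous.intervalIntegrable (by fun_prop) _ _) ?_
  · filter_upwards [Ioc_mem_nhdsGT (zero_lt_one (α := ℝ))] with h hh
    refine Eventually.of_forall fun τ hτ => ?_
    rw [Real.norm_eq_abs, abs_mul]
    exact mul_le_mul (bound hfp h hh τ (hmem τ hτ)) (bound hgq h hh τ (hmem τ hτ))
      (abs_nonneg _) (by positivity)
  · exact Eventually.of_forall fun τ hτ =>
      (tendsto_of_abs_sub_le_mul fun h hh => hfp h hh τ (hmem τ hτ)).mul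
        (tendsto_of_abs_sub_le_mul fun h hh => hgq h hh τ (hmem τ hτ))

/-- **Removable singularity of the FFCFE projection kernel at `h = 0`.**
Let `φ 0, …, φ (r-1)` be C^r functions whose Wronskian matrix at `t₀` is
nonsingular.  For `h > 0` put `φ̃ᵢ(τ) = φᵢ(t₀ + τ h)` and let `M h` be the Gram
matrix `(∫₀¹ φ̃ᵢ φ̃ⱼ)`.  Then `M h` is nonsingular for all sufficiently small
`h > 0`, and the projection kernel
`P_h(τ,σ) = Σᵢⱼ φ̃ᵢ(τ) (M h)⁻¹ᵢⱼ φ̃ⱼ(σ)` converges, as `h → 0⁺`, to the shifted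
Legendre kernel `Σᵢ p̂ᵢ(τ) p̂ᵢ(σ)`, where the `p̂ᵢ` are the shifted Legendre
polynomials on `[0,1]` (characterized by `deg p̂ᵢ = i` and orthonormality). -/
theorem ffcfe_kernel_limit (r : ℕ) (hr : 1 ≤ r) (t₀ : ℝ)
    (φ : Fin r → ℝ → ℝ) (hφ : ∀ i, ContDiff ℝ r (φ i))
    (hW : (Matrix.of fun i j : Fin r => iteratedDeriv i (φ j) t₀).det ≠ 0)
    (p : Fin r → Polynomial ℝ)
    (hdeg : ∀ i : Fin r, (p i).degree = (i : ℕ))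
    (horth : ∀ i j : Fin r,
        ∫ τ in (0:ℝ)..1, (p i).eval τ * (p j).eval τ = if i = j then 1 else 0) :
    ∃ h₀ > (0:ℝ),
      (∀ h : ℝ, 0 < h → h ≤ h₀ →
        (Matrix.of fun i j : Fin r =>
          ∫ τ in (0:ℝ)..1, φ i (t₀ + τ * h) * φ j (t₀ + τ * h)).det ≠ 0) ∧
      ∀ τ ∈ Icc (0:ℝ) 1, ∀ σ ∈ Icc (0:ℝ) 1,
        Tendsto (fun h : ℝ =>
            ∑ i : Fin r, ∑ j : Fin r, φ i (t₀ + τ * h) *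
              (Matrix.of fun i' j' : Fin r =>
                ∫ τ' in (0:ℝ)..1, φ i' (t₀ + τ' * h) * φ j' (t₀ + τ' * h))⁻¹ i j *
              φ j (t₀ + σ * h))
          (nhdsWithin 0 (Ioi 0))
          (nhds (∑ i : Fin r, (p i).eval τ * (p i).eval σ)) := by
  have hdeg' : ∀ i, (p i).natDegree < r := fun i => by
    rw [Polynomial.natDegree_eq_of_degree_eq_some (hdeg i)]
    exact i.2
  choose A K hAK using fun i => exists_coeff_abs_sum_sub_eval_le hr t₀ φ hφ hW (p i) (hdeg' i)
  let S : ℝ → Matrix (Fin r) (Fin r) ℝ := fun h => Matrix.of fun i j => A i h j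
  let M : ℝ → Matrix (Fin r) (Fin r) ℝ := fun h => Matrix.of fun i j =>
    ∫ τ in (0:ℝ)..1, φ i (t₀ + τ * h) * φ j (t₀ + τ * h)
  let G : ℝ → Matrix (Fin r) (Fin r) ℝ := fun h => S h * M h * (S h).transpose
  have hcont : ∀ (h : ℝ) i, Continuous fun τ => φ i (t₀ + τ * h) := fun h i =>
    (hφ i).continuous.comp (by fun_prop)
  have hG : Tendsto G (nhdsWithin 0 (Ioi 0)) (nhds 1) := by
    refine tendsto_pi_nhds.2 fun i => tendsto_pi_nhds.2 fun j => ?_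
    have hcomb : ∀ i h, Continuous fun τ => ∑ k, A i h k * φ k (t₀ + τ * h) := fun i h =>
      continuous_finsetSum _ fun k _ => continuous_const.mul (hcont h k)
    have hlim := tendsto_integral_mul_of_abs_sub_le_mul (hcomb i) (hcomb j)
      (p i).continuous (p j).continuous (hAK i) (hAK j)
    rw [horth, ← Matrix.one_apply] at hlim
    refine hlim.congr fun h => ?_
    simp only [G, M, mul_gram_mul_transpose (S h) (hcont h)]
    rfl
  have hdetG : ∀ᶠ h in nhdsWithin 0 (Ioi 0), (G h).det ≠ 0 := by
    have hdet : Tendsto (fun h => (G h).det) (nhdsWithin 0 (Ioi 0)) (nhds 1) := by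
      simpa [Function.comp_def] using (continuous_id.matrix_det.tendsto (1 : Matrix (Fin r) (Fin r) ℝ)).comp hG
    exact hdet.eventually_ne one_ne_zero
  have hdets : ∀ h, (G h).det ≠ 0 → (S h).det ≠ 0 ∧ (M h).det ≠ 0 := fun h hh => by
    simp only [G, Matrix.det_mul] at hh
    exact mul_ne_zero_iff.1 (mul_ne_zero_iff.1 hh).1
  obtain ⟨h₀, hh₀, hsub⟩ := mem_nhdsGT_iff_exists_Ioc_subset.1 hdetG
  refine ⟨h₀, hh₀, fun h h1 h2 => (hdets h (hsub ⟨h1, h2⟩)).2, fun τ hτ σ hσ => ?_⟩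
  have hvec : ∀ τ ∈ Icc (0:ℝ) 1,
      Tendsto (fun h => (S h).mulVec fun k => φ k (t₀ + τ * h)) (nhdsWithin 0 (Ioi 0))
        (nhds fun i => (p i).eval τ) := fun τ hτ =>
    tendsto_pi_nhds.2 fun i => tendsto_of_abs_sub_le_mul fun h hh => hAK i h hh τ hτ
  have hinv : Tendsto (fun h => (G h)⁻¹) (nhdsWithin 0 (Ioi 0)) (nhds 1) := by
    have hc : ContinuousAt Ring.inverse (1 : Matrix (Fin r) (Fin r) ℝ).det := by
      rw [Matrix.det_one, Ring.inverse_eq_inv']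
      exact continuousAt_inv₀ one_ne_zero
    simpa [Function.comp_def] using (continuousAt_matrix_inv 1 hc).tendsto.comp hG
  have hlim : Tendsto (fun h => (S h).mulVec (fun k => φ k (t₀ + τ * h)) ⬝ᵥ
      (G h)⁻¹.mulVec ((S h).mulVec fun k => φ k (t₀ + σ * h))) (nhdsWithin 0 (Ioi 0))
      (nhds ((fun i => (p i).eval τ) ⬝ᵥ
        (1 : Matrix (Fin r) (Fin r) ℝ).mulVec fun i => (p i).eval σ)) := by
    have hc : Continuous fun x : (Fin r → ℝ) × Matrix (Fin r) (Fin r) ℝ × (Fin r → ℝ) =>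
        x.1 ⬝ᵥ x.2.1.mulVec x.2.2 := by fun_prop
    exact (hc.tendsto _).comp ((hvec τ hτ).prodMk_nhds (hinv.prodMk_nhds (hvec σ hσ)))
  rw [Matrix.one_mulVec] at hlim
  refine hlim.congr' ?_
  filter_upwards [hdetG] with h hh
  rw [← dotProduct_inv_mulVec_eq_congruence (hdets h hh).1]
  simp only [dotProduct, Matrix.mulVec, Finset.mul_sum, mul_assoc, M]
end

section
/- Let r ≥ 1, t₀ ∈ ℝ, and let φ₀, …, φ_{r−1} : ℝ → ℝ be C^r functions whose Wronskian matrix (φ_j^{(i)}(t₀))_{0≤i,j≤r−1} is nonsingular. Let h₀ > 0 and let P : [0,1] × [0,1] × [0,h₀] → ℝ be continuous and (r−1) times continuously differentiable in the third variable h, with all these h-derivatives continuous on [0,1]² × [0,h₀], such that for every h ∈ (0,h₀], every τ ∈ [0,1], and every i, ∫₀¹ P(τ,σ,h) φ_i(t₀ + σh) dσ = φ_i(t₀ + τh). Define P^{[n]}(τ,σ) = (1/n!) ∂ⁿP/∂hⁿ(τ,σ,0). Then: (i) for every real polynomial g of degree ≤ r−1 and every τ ∈ [0,1], ∫₀¹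 P^{[0]}(τ,σ) g(σ) dσ = g(τ); and (ii) for every 1 ≤ n ≤ r−1, every real polynomial g of degree ≤ r−1−n, and every τ ∈ [0,1], ∫₀¹ P^{[n]}(τ,σ) g(σ) dσ = 0. -/
open MeasureTheory Set
open scoped Topology Asymptotics Interval

/-- Taylor's formula at the left endpoint `0` for a chain of successive derivatives, with an
explicit remainder governed by the oscillation of the last derivative. -/
theorem abs_sub_taylor_sum_le_of_hasDerivWithinAt_chain {m : ℕ} {f : ℕ → ℝ → ℝ} {δ ε : ℝ}
    (hf : ∀ n < m, ∀ x ∈ Icc 0 δ, HasDerivWithinAt (f n) (f (n + 1) x) (Icc 0 δ) x)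
    (hosc : ∀ x ∈ Icc 0 δ, |f m x - f m 0| ≤ ε) :
    ∀ x ∈ Icc 0 δ,
      |f 0 x - ∑ n ∈ Finset.range (m + 1), (n.factorial : ℝ)⁻¹ * f n 0 * x ^ n| ≤ ε * x ^ m := by
  induction m generalizing f with
  | zero => simpa using hosc
  | succ m ih =>
    intro x hx
    have hderiv := ih (f := fun n => f (n + 1)) (fun n hn => hf (n + 1) (by omega)) hosc
    have hε : 0 ≤ ε := (abs_nonneg _).trans (hosc x hx)
    have hsub : Icc 0 x ⊆ Icc 0 δ := Icc_subset_Icc_right hx.2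
    have key := (convex_Icc (0 : ℝ) x).norm_image_sub_le_of_norm_hasDerivWithin_le
      (f := fun y => f 0 y -
        ∑ n ∈ Finset.range (m + 1 + 1), (n.factorial : ℝ)⁻¹ * f n 0 * y ^ n)
      (f' := fun y => f 1 y -
        ∑ n ∈ Finset.range (m + 1), (n.factorial : ℝ)⁻¹ * f (n + 1) 0 * y ^ n)
      (C := ε * x ^ m) (x := 0) (y := x) ?_ ?_ ⟨le_rfl, hx.1⟩ ⟨hx.1, le_rfl⟩
    · rw [Finset.sum_range_succ' (fun n => (n.factorial : ℝ)⁻¹ * f n 0 * (0 : ℝ) ^ n)] at key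
      simpa [abs_of_nonneg hx.1, pow_succ, mul_assoc] using key
    · intro y hy
      refine ((hf 0 (by omega) y (hsub hy)).mono hsub).sub ?_
      simp_rw [Finset.sum_range_succ' _ (m + 1)]
      simp only [pow_zero]
      refine HasDerivWithinAt.add_const _ (HasDerivWithinAt.fun_sum fun n _ => ?_)
      have hpow := ((hasDerivAt_pow (n + 1) y).const_mul
        (((n + 1).factorial : ℝ)⁻¹ * f (n + 1) 0)).hasDerivWithinAt (s := Icc 0 x)
      refine hpow.congr_deriv ?_
      have h₁ : (n.factorial : ℝ) ≠ 0 := by positivity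
      have h₂ : ((n : ℝ) + 1) ≠ 0 := by positivity
      rw [Nat.factorial_succ]
      push_cast
      field_simp
    · intro y hy
      refine (hderiv y (hsub hy)).trans ?_
      have := hy.1
      have := hy.2
      gcongr

/-- A polynomial of degree at most `m` which is `o(h ^ m)` as `h → 0⁺` vanishes. -/
theorem eq_zero_of_sum_isLittleO_pow {m : ℕ} {a : ℕ → ℝ}
    (h : (fun x : ℝ => ∑ n ∈ Finset.range (m + 1), a n * x ^ n) =o[𝓝[>] 0] fun x => x ^ m) :
    ∀ n ≤ m, a n = 0 := by
  have hzero : ∀ {m : ℕ} {a : ℕ → ℝ}, ((fun x : ℝ => ∑ n ∈ Finset.range (m + 1), a n * x ^ n)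
      =o[𝓝[>] 0] fun x => x ^ m) → a 0 = 0 := by
    intro m a h
    have hlim : Filter.Tendsto (fun x : ℝ => ∑ n ∈ Finset.range (m + 1), a n * x ^ n)
        (𝓝[>] 0) (𝓝 (a 0)) := by
      have hc : Continuous fun x : ℝ => ∑ n ∈ Finset.range (m + 1), a n * x ^ n := by fun_prop
      have := hc.tendsto 0
      rw [Finset.sum_range_succ'] at this
      simp only [pow_succ, mul_zero, Finset.sum_const_zero, zero_add, pow_zero, mul_one] at this
      exact this.mono_left nhdsWithin_le_nhds
    have hbdd : (fun x : ℝ => x ^ m) =O[𝓝[>] 0] fun _ => (1 : ℝ) :=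
      (((continuous_pow m).tendsto (0 : ℝ)).mono_left nhdsWithin_le_nhds).isBigO_one ℝ
    exact tendsto_nhds_unique hlim
      ((Asymptotics.isLittleO_one_iff ℝ).1 (h.trans_isBigO hbdd))
  induction m generalizing a with
  | zero =>
    intro n hn
    rw [Nat.le_zero.1 hn]
    exact hzero h
  | succ m ih =>
    have h0 := hzero h
    have hshift : (fun x : ℝ => ∑ n ∈ Finset.range (m + 1), a (n + 1) * x ^ n)
        =o[𝓝[>] 0] fun x => x ^ m := by
      have hmul := (Asymptotics.isBigO_refl (fun x : ℝ => x⁻¹) (𝓝[>] 0)).mul_isLittleO h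
      refine hmul.congr' ?_ ?_
      · filter_upwards [self_mem_nhdsWithin] with x hx
        have hx' : x ≠ 0 := ne_of_gt hx
        rw [Finset.sum_range_succ', h0, zero_mul, add_zero, Finset.mul_sum]
        refine Finset.sum_congr rfl fun n _ => ?_
        field_simp
        ring
      · filter_upwards [self_mem_nhdsWithin] with x hx
        have hx' : x ≠ 0 := ne_of_gt hx
        field_simp
        ring
    intro n hn
    rcases n with _ | n
    · exact h0
    · exact ih hshift n (by omega)

/-- If the Wronskian matrix of `φ` at `t₀` is nonsingular, then some linear combination of the
`φ j` agrees with `(t - t₀) ^ k` up to `o((t - t₀) ^ (r - 1))`. -/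
theorem exists_sum_sub_pow_isLittleO_of_wronskian_det_ne_zero {r : ℕ} {t₀ : ℝ}
    {φ : Fin r → ℝ → ℝ} (hφ : ∀ i, ContDiff ℝ r (φ i))
    (hW : (Matrix.of fun i j : Fin r => iteratedDeriv i (φ j) t₀).det ≠ 0) {k : ℕ} (hk : k < r) :
    ∃ c : Fin r → ℝ, (fun x : ℝ => ∑ j, c j * φ j (t₀ + x) - x ^ k)
      =o[𝓝 0] fun x => x ^ (r - 1) := by
  set W := Matrix.of fun i j : Fin r => iteratedDeriv i (φ j) t₀ with hWdef
  let v : Fin r → ℝ := Pi.single ⟨k, hk⟩ (k.factorial : ℝ)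
  have hWc : W.mulVec (W⁻¹.mulVec v) = v := by
    rw [Matrix.mulVec_mulVec, Matrix.mul_nonsing_inv _ (isUnit_iff_ne_zero.2 hW),
      Matrix.one_mulVec]
  set c := W⁻¹.mulVec v
  refine ⟨c, ?_⟩
  have hψ : ContDiff ℝ (r - 1 : ℕ) fun t => ∑ j, c j * φ j t := by
    refine ContDiff.sum fun j _ => contDiff_const.mul ((hφ j).of_le ?_)
    exact_mod_cast Nat.sub_le r 1
  have hderiv : ∀ i < r, iteratedDeriv i (fun t => ∑ j, c j * φ j t) t₀ =
      if i = k then (k.factorial : ℝ) else 0 := by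
    intro i hi
    have hsmooth : ∀ j, ContDiffAt ℝ i (φ j) t₀ := fun j =>
      ((hφ j).of_le (by exact_mod_cast hi.le)).contDiffAt
    rw [iteratedDeriv_fun_sum fun j _ => contDiffAt_const.mul (hsmooth j)]
    have hrow := congrFun hWc ⟨i, hi⟩
    simp only [Matrix.mulVec, dotProduct, hWdef, Matrix.of_apply, v, Pi.single_apply,
      Fin.mk.injEq] at hrow
    rw [← hrow]
    refine Finset.sum_congr rfl fun j _ => ?_
    rw [iteratedDeriv_const_mul_field, mul_comm]
  have htaylor := taylor_isLittleO_univ (x₀ := t₀) hψ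
  have hshift : Filter.Tendsto (fun x : ℝ => t₀ + x) (𝓝 0) (𝓝 t₀) := by
    simpa using (continuous_const_add t₀).tendsto 0
  refine (htaylor.comp_tendsto hshift).congr (fun x => ?_) fun x => ?_
  · simp only [Function.comp_apply, taylor_within_apply, iteratedDerivWithin_univ, smul_eq_mul,
      add_sub_cancel_left]
    congr 1
    rw [Finset.sum_eq_single_of_mem k (Finset.mem_range.2 (by omega))]
    · rw [hderiv k hk, if_pos rfl]
      have : (k.factorial : ℝ) ≠ 0 := by positivity
      field_simp
    · intro i hi hik
      rw [hderiv i (by have := Finset.mem_range.1 hi; omega), if_neg hik, mul_zero]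
  · simp

/-- Taylor expansion under the integral sign of the moments of a kernel that is
continuously differentiable `m` times in its second variable. -/
theorem integral_mul_pow_sub_taylor_sum_isLittleO {m : ℕ} {h₀ : ℝ} (hh₀ : 0 < h₀)
    {Q : ℕ → ℝ → ℝ → ℝ}
    (hcont : ∀ n ≤ m, ContinuousOn (fun q : ℝ × ℝ => Q n q.1 q.2) (Icc 0 1 ×ˢ Icc 0 h₀))
    (hderiv : ∀ n < m, ∀ σ ∈ Icc (0 : ℝ) 1, ∀ h ∈ Icc (0 : ℝ) h₀,
      HasDerivWithinAt (Q n σ) (Q (n + 1) σ h) (Icc 0 h₀) h) (k : ℕ) :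
    (fun h : ℝ => (∫ σ in (0 : ℝ)..1, Q 0 σ h * σ ^ k) -
      ∑ n ∈ Finset.range (m + 1),
        (∫ σ in (0 : ℝ)..1, ((n.factorial : ℝ)⁻¹ * Q n σ 0) * σ ^ k) * h ^ n)
      =o[𝓝[>] 0] fun h => h ^ m := by
  rw [Asymptotics.isLittleO_iff]
  intro ε hε
  have hslice : ∀ n ≤ m, ∀ h ∈ Icc 0 h₀, ContinuousOn (fun σ => Q n σ h) (Icc 0 1) :=
    fun n hn h hh => (hcont n hn).comp (f := fun σ : ℝ => (σ, h)) (by fun_prop)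
      fun σ hσ => ⟨hσ, hh⟩
  have hunif := (isCompact_Icc.prod isCompact_Icc).uniformContinuousOn_of_continuous
    (hcont m le_rfl)
  obtain ⟨δ, hδ, hδQ⟩ := Metric.uniformContinuousOn_iff.1 hunif ε hε
  have hmem : Ioo 0 (min δ h₀) ∈ 𝓝[>] (0 : ℝ) := Ioo_mem_nhdsGT (lt_min hδ hh₀)
  filter_upwards [hmem] with h hh
  have hhδ : h < δ := hh.2.trans_le (min_le_left _ _)
  have hhh₀ : h < h₀ := hh.2.trans_le (min_le_right _ _)
  have hsub : Icc 0 h ⊆ Icc 0 h₀ := Icc_subset_Icc_right hhh₀.le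
  have h0mem : (0 : ℝ) ∈ Icc 0 h₀ := ⟨le_rfl, hh₀.le⟩
  have hint0 : IntervalIntegrable (fun σ => Q 0 σ h * σ ^ k) volume 0 1 :=
    ((hslice 0 (Nat.zero_le m) h ⟨hh.1.le, hhh₀.le⟩).mul
      (by fun_prop)).intervalIntegrable_of_Icc zero_le_one
  have hintn : ∀ n ∈ Finset.range (m + 1), IntervalIntegrable
      (fun σ => ((n.factorial : ℝ)⁻¹ * Q n σ 0) * σ ^ k * h ^ n) volume 0 1 := fun n hn =>
    (((continuousOn_const.mul (hslice n (by have := Finset.mem_range.1 hn; omega) 0 h0mem)).mul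
      (by fun_prop)).mul continuousOn_const).intervalIntegrable_of_Icc zero_le_one
  simp_rw [← intervalIntegral.integral_mul_const]
  rw [← intervalIntegral.integral_finsetSum hintn,
    ← intervalIntegral.integral_sub hint0 (by
      simpa only [Finset.sum_fn] using! IntervalIntegrable.sum _ hintn)]
  have hbound : ∀ σ ∈ Ι (0 : ℝ) 1, ‖Q 0 σ h * σ ^ k - ∑ n ∈ Finset.range (m + 1),
      ((n.factorial : ℝ)⁻¹ * Q n σ 0) * σ ^ k * h ^ n‖ ≤ ε * h ^ m := by
    intro σ hσ
    rw [uIoc_of_le zero_le_one] at hσ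
    have hσ' : σ ∈ Icc (0 : ℝ) 1 := Ioc_subset_Icc_self hσ
    have hrem := abs_sub_taylor_sum_le_of_hasDerivWithinAt_chain (m := m)
      (f := fun n => Q n σ) (δ := h) (ε := ε)
      (fun n hn x hx => (hderiv n hn σ hσ' x (hsub hx)).mono hsub)
      (fun x hx => by
        have := hδQ (σ, x) ⟨hσ', hsub hx⟩ (σ, 0) ⟨hσ', h0mem⟩ (by
          simp [Prod.dist_eq, abs_of_nonneg hx.1, hx.2.trans_lt hhδ, hδ])
        exact this.le) h ⟨hh.1.le, le_rfl⟩
    have hfactor : Q 0 σ h * σ ^ k - ∑ n ∈ Finset.range (m + 1),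
        ((n.factorial : ℝ)⁻¹ * Q n σ 0) * σ ^ k * h ^ n =
        (Q 0 σ h - ∑ n ∈ Finset.range (m + 1), (n.factorial : ℝ)⁻¹ * Q n σ 0 * h ^ n) * σ ^ k := by
      rw [sub_mul, Finset.sum_mul]
      congr 1
      exact Finset.sum_congr rfl fun n _ => by ring
    rw [hfactor, norm_mul, Real.norm_eq_abs]
    refine (mul_le_of_le_one_right (abs_nonneg _) ?_).trans hrem
    rw [norm_pow, Real.norm_of_nonneg hσ'.1]
    exact pow_le_one₀ hσ'.1 hσ'.2
  refine (intervalIntegral.norm_integral_le_of_norm_le_const hbound).trans ?_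
  simp [abs_of_pos hh.1]

/-- If a bounded kernel reproduces `σ ↦ ψ (σ * h)` at `τ` and `ψ` agrees with the `k`-th power
up to `o(x ^ (k + m))`, then its `k`-th moment equals `τ ^ k` up to `o(h ^ m)`. -/
theorem integral_mul_pow_sub_pow_isLittleO_of_reproducing {k m : ℕ} {h₀ τ : ℝ} (hh₀ : 0 < h₀)
    (hτ : τ ∈ Icc (0 : ℝ) 1) {K : ℝ → ℝ → ℝ} {ψ : ℝ → ℝ}
    (hK : ContinuousOn (fun q : ℝ × ℝ => K q.1 q.2) (Icc 0 1 ×ˢ Icc 0 h₀))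
    (hψc : Continuous ψ) (hψ : (fun x => ψ x - x ^ k) =o[𝓝 0] fun x => x ^ (k + m))
    (hrepr : ∀ h ∈ Ioc (0 : ℝ) h₀, ∫ σ in (0 : ℝ)..1, K σ h * ψ (σ * h) = ψ (τ * h)) :
    (fun h : ℝ => (∫ σ in (0 : ℝ)..1, K σ h * σ ^ k) - τ ^ k) =o[𝓝[>] 0] fun h => h ^ m := by
  obtain ⟨M, hM⟩ := (isCompact_Icc.prod isCompact_Icc).exists_bound_of_continuousOn hK
  have hM0 : 0 ≤ M := (norm_nonneg _).trans (hM (0, 0) ⟨⟨le_rfl, zero_le_one⟩, le_rfl, hh₀.le⟩)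
  rw [Asymptotics.isLittleO_iff]
  intro ε hε
  have hε' : 0 < ε / (M + 1) := by positivity
  obtain ⟨δ, hδ, hδψ⟩ := Metric.eventually_nhds_iff.1 (Asymptotics.isLittleO_iff.1 hψ hε')
  have hmem : Ioo 0 (min δ h₀) ∈ 𝓝[>] (0 : ℝ) := Ioo_mem_nhdsGT (lt_min hδ hh₀)
  filter_upwards [hmem] with h hh
  have hhpos := hh.1
  have hhδ : h < δ := hh.2.trans_le (min_le_left _ _)
  have hhh₀ : h < h₀ := hh.2.trans_le (min_le_right _ _)
  have hhmem : h ∈ Icc 0 h₀ := ⟨hhpos.le, hhh₀.le⟩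
  have hsmall : ∀ σ ∈ Icc (0 : ℝ) 1,
      ‖ψ (σ * h) - (σ * h) ^ k‖ ≤ ε / (M + 1) * h ^ (k + m) := by
    intro σ hσ
    have hσh : 0 ≤ σ * h := mul_nonneg hσ.1 hhpos.le
    have hle : σ * h ≤ h := mul_le_of_le_one_left hhpos.le hσ.2
    refine (hδψ (y := σ * h) ?_).trans ?_
    · rw [Real.dist_0_eq_abs, abs_of_nonneg hσh]
      exact hle.trans_lt hhδ
    · rw [norm_pow, Real.norm_of_nonneg hσh]
      gcongr
  have hslice : ContinuousOn (fun σ => K σ h) (Icc 0 1) :=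
    hK.comp (f := fun σ : ℝ => (σ, h)) (by fun_prop) fun σ hσ => ⟨hσ, hhmem⟩
  have hint₁ : IntervalIntegrable (fun σ => K σ h * ψ (σ * h)) volume 0 1 :=
    (hslice.mul (by fun_prop)).intervalIntegrable_of_Icc zero_le_one
  have hint₂ : IntervalIntegrable (fun σ => K σ h * (σ * h) ^ k) volume 0 1 :=
    (hslice.mul (by fun_prop)).intervalIntegrable_of_Icc zero_le_one
  have hbound : ‖∫ σ in (0 : ℝ)..1, (K σ h * ψ (σ * h) - K σ h * (σ * h) ^ k)‖ ≤
      M * (ε / (M + 1) * h ^ (k + m)) := by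
    refine (intervalIntegral.norm_integral_le_of_norm_le_const
      (C := M * (ε / (M + 1) * h ^ (k + m))) fun σ hσ => ?_).trans (by simp)
    rw [uIoc_of_le zero_le_one] at hσ
    have hσ' : σ ∈ Icc (0 : ℝ) 1 := Ioc_subset_Icc_self hσ
    rw [← mul_sub, norm_mul]
    exact mul_le_mul (hM (σ, h) ⟨hσ', hhmem⟩) (hsmall σ hσ') (norm_nonneg _) hM0
  rw [intervalIntegral.integral_sub hint₁ hint₂, hrepr h ⟨hhpos, hhh₀.le⟩] at hbound
  have hscale : ∫ σ in (0 : ℝ)..1, K σ h * (σ * h) ^ k =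
      h ^ k * ∫ σ in (0 : ℝ)..1, K σ h * σ ^ k := by
    rw [← intervalIntegral.integral_const_mul]
    congr 1 with σ
    ring
  rw [hscale] at hbound
  set I := ∫ σ in (0 : ℝ)..1, K σ h * σ ^ k
  have hsplit : h ^ k * (I - τ ^ k) =
      (ψ (τ * h) - (τ * h) ^ k) - (ψ (τ * h) - h ^ k * I) := by ring
  have hfinal : h ^ k * ‖I - τ ^ k‖ ≤ h ^ k * (ε * h ^ m) := by
    calc h ^ k * ‖I - τ ^ k‖ = ‖h ^ k * (I - τ ^ k)‖ := by
          rw [norm_mul, norm_pow, Real.norm_of_nonneg hhpos.le]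
      _ ≤ ε / (M + 1) * h ^ (k + m) + M * (ε / (M + 1) * h ^ (k + m)) := by
          rw [hsplit]
          exact (norm_sub_le _ _).trans (add_le_add (hsmall τ hτ) hbound)
      _ = h ^ k * (ε * h ^ m) := by
          field_simp
          ring
  rw [norm_pow, Real.norm_of_nonneg hhpos.le]
  exact le_of_mul_le_mul_left hfinal (by positivity)

/-- **Taylor coefficients of the FFCFE projection kernel (Proposition 1).**
Let `φ 0, …, φ (r-1)` be C^r functions whose Wronskian matrix at `t₀` is
nonsingular.  The kernel is encoded by the family `P : ℕ → ℝ → ℝ → ℝ → ℝ`,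
where `P 0` is the kernel itself and `P (n+1) τ σ ·` is the `h`-derivative of
`P n τ σ ·` on `[0, h₀]` (so `P n τ σ 0 = ∂ⁿP/∂hⁿ(τ,σ,0)`); all
`P n`, `n ≤ r - 1`, are continuous on `[0,1]² × [0,h₀]`.  Assume the
reproducing relation `∫₀¹ P(τ,σ,h) φᵢ(t₀+σh) dσ = φᵢ(t₀+τh)` for `h ∈ (0,h₀]`.
Then the Taylor coefficients `P^[n](τ,σ) = (1/n!) ∂ⁿP/∂hⁿ(τ,σ,0)`
satisfy: (i) `∫₀¹ P^[0](τ,σ) g(σ) dσ = g(τ)` for every polynomial `g` of degree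
`≤ r-1`; (ii) `∫₀¹ P^[n](τ,σ) g(σ) dσ = 0` for `1 ≤ n ≤ r-1` and every
polynomial `g` of degree `≤ r-1-n`. -/
theorem ffcfe_kernel_taylor_coefficients (r : ℕ) (hr : 1 ≤ r) (t₀ h₀ : ℝ)
    (hh₀ : 0 < h₀)
    (φ : Fin r → ℝ → ℝ) (hφ : ∀ i, ContDiff ℝ r (φ i))
    (hW : (Matrix.of fun i j : Fin r => iteratedDeriv i (φ j) t₀).det ≠ 0)
    (P : ℕ → ℝ → ℝ → ℝ → ℝ)
    (hPcont : ∀ n ≤ r - 1, ContinuousOn (fun q : ℝ × ℝ × ℝ => P n q.1 q.2.1 q.2.2)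
        (Icc 0 1 ×ˢ Icc 0 1 ×ˢ Icc 0 h₀))
    (hPderiv : ∀ n < r - 1, ∀ τ ∈ Icc (0:ℝ) 1, ∀ σ ∈ Icc (0:ℝ) 1, ∀ h ∈ Icc (0:ℝ) h₀,
        HasDerivWithinAt (fun s => P n τ σ s) (P (n + 1) τ σ h) (Icc 0 h₀) h)
    (hrepr : ∀ h ∈ Ioc (0:ℝ) h₀, ∀ τ ∈ Icc (0:ℝ) 1, ∀ i : Fin r,
        ∫ σ in (0:ℝ)..1, P 0 τ σ h * φ i (t₀ + σ * h) = φ i (t₀ + τ * h)) :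
    (∀ g : Polynomial ℝ, g.natDegree ≤ r - 1 → ∀ τ ∈ Icc (0:ℝ) 1,
        ∫ σ in (0:ℝ)..1, ((Nat.factorial 0 : ℝ)⁻¹ * P 0 τ σ 0) * g.eval σ = g.eval τ) ∧
    ∀ n : ℕ, 1 ≤ n → n ≤ r - 1 → ∀ g : Polynomial ℝ, g.natDegree ≤ r - 1 - n →
      ∀ τ ∈ Icc (0:ℝ) 1,
        ∫ σ in (0:ℝ)..1, ((Nat.factorial n : ℝ)⁻¹ * P n τ σ 0) * g.eval σ = 0 := by
  have moment : ∀ τ ∈ Icc (0 : ℝ) 1, ∀ k n : ℕ, k + n ≤ r - 1 →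
      ∫ σ in (0:ℝ)..1, ((n.factorial : ℝ)⁻¹ * P n τ σ 0) * σ ^ k =
        if n = 0 then τ ^ k else 0 := by
    intro τ hτ k n hkn
    obtain ⟨m, hm⟩ : ∃ m, r - 1 = k + m := ⟨r - 1 - k, by omega⟩
    have hcont : ∀ n ≤ r - 1, ContinuousOn (fun q : ℝ × ℝ => P n τ q.1 q.2)
        (Icc 0 1 ×ˢ Icc 0 h₀) := fun n hn =>
      (hPcont n hn).comp (f := fun q : ℝ × ℝ => (τ, q.1, q.2)) (by fun_prop)
        fun q hq => ⟨hτ, hq.1, hq.2⟩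
    obtain ⟨c, hc⟩ := exists_sum_sub_pow_isLittleO_of_wronskian_det_ne_zero hφ hW
      (k := k) (by omega)
    rw [hm] at hc
    have hφc : ∀ i, Continuous (φ i) := fun i => (hφ i).continuous
    have hasymp := integral_mul_pow_sub_pow_isLittleO_of_reproducing hh₀ hτ
      (hcont 0 (Nat.zero_le _)) (by fun_prop) hc (fun h hh => by
        have hslice : ContinuousOn (fun σ => P 0 τ σ h) (Icc 0 1) :=
          (hcont 0 (Nat.zero_le _)).comp (f := fun σ : ℝ => (σ, h)) (by fun_prop)
            fun σ hσ => ⟨hσ, Ioc_subset_Icc_self hh⟩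
        simp_rw [Finset.mul_sum]
        rw [intervalIntegral.integral_finsetSum]
        swap
        · exact fun j _ => (hslice.mul (by fun_prop)).intervalIntegrable_of_Icc zero_le_one
        refine Finset.sum_congr rfl fun j _ => ?_
        rw [← hrepr h hh τ hτ j, ← intervalIntegral.integral_const_mul]
        congr 1 with σ
        ring)
    have htaylor := integral_mul_pow_sub_taylor_sum_isLittleO (m := m) hh₀ (Q := fun n => P n τ)
      (fun n hn => hcont n (by omega)) (fun n hn => hPderiv n (by omega) τ hτ) k
    have hcoeff := eq_zero_of_sum_isLittleO_pow (m := m)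
      (a := fun n => (∫ σ in (0:ℝ)..1, ((n.factorial : ℝ)⁻¹ * P n τ σ 0) * σ ^ k) -
        if n = 0 then τ ^ k else 0)
      ((hasymp.sub htaylor).congr_left fun h => by simp [sub_mul, Finset.sum_sub_distrib])
      n (by omega)
    exact sub_eq_zero.1 hcoeff
  have poly : ∀ τ ∈ Icc (0 : ℝ) 1, ∀ n ≤ r - 1, ∀ g : Polynomial ℝ, g.natDegree ≤ r - 1 - n →
      ∫ σ in (0:ℝ)..1, ((n.factorial : ℝ)⁻¹ * P n τ σ 0) * g.eval σ =
        if n = 0 then g.eval τ else 0 := by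
    intro τ hτ n hn g hg
    have hslice : ContinuousOn (fun σ => P n τ σ 0) (Icc 0 1) :=
      (hPcont n hn).comp (f := fun σ : ℝ => (τ, σ, (0 : ℝ))) (by fun_prop)
        fun σ hσ => ⟨hτ, hσ, le_rfl, hh₀.le⟩
    have hdeg : g.natDegree < r - 1 - n + 1 := Nat.lt_succ_of_le hg
    simp_rw [Polynomial.eval_eq_sum_range' hdeg, Finset.mul_sum]
    rw [intervalIntegral.integral_finsetSum]
    swap
    · exact fun k _ => ((continuousOn_const.mul hslice).mul
        (by fun_prop)).intervalIntegrable_of_Icc zero_le_one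
    have hterm : ∀ k ∈ Finset.range (r - 1 - n + 1),
        ∫ σ in (0:ℝ)..1, ((n.factorial : ℝ)⁻¹ * P n τ σ 0) * (g.coeff k * σ ^ k) =
          g.coeff k * if n = 0 then τ ^ k else 0 := by
      intro k hk
      have hk' := Finset.mem_range.1 hk
      rw [← moment τ hτ k n (by omega), ← intervalIntegral.integral_const_mul]
      congr 1 with σ
      ring
    rw [Finset.sum_congr rfl hterm]
    split_ifs <;> simp
  refine ⟨fun g hg τ hτ => ?_, fun n hn₁ hn g hg τ hτ => ?_⟩
  · simpa only [if_true] using poly τ hτ 0 (Nat.zero_le _) g hg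
  · rw [poly τ hτ n hn g hg, if_neg (by omega)]
end

section
/- Let r ≥ 1, ε > 0, and let w : [0,1] × [0,ε] → ℝ^d be C^r (jointly in (τ,h)) such that for each 0 ≤ n ≤ r−1 the function τ ↦ (1/n!) ∂ⁿw/∂hⁿ(τ,0) is, componentwise, a polynomial in τ of degree ≤ n. Let g : ℝ^d → ℝ^m be C^r. Then for each 0 ≤ n ≤ r−1, the function τ ↦ (1/n!) ∂ⁿ/∂hⁿ [g(w(τ,h))] evaluated at h = 0 is, componentwise, a polynomial in τ of degree ≤ n. -/
open MeasureTheory Set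

/-- On `T`, the function `f` agrees with a polynomial of degree at most `n`. -/
def EqPolynomialOn (T : Set ℝ) (n : ℕ) (f : ℝ → ℝ) : Prop :=
  ∃ q : Polynomial ℝ, q.natDegree ≤ n ∧ ∀ τ ∈ T, f τ = q.eval τ

namespace EqPolynomialOn

variable {T : Set ℝ} {n k : ℕ} {f g : ℝ → ℝ}

lemma congr (hf : EqPolynomialOn T n f) (h : ∀ τ ∈ T, g τ = f τ) : EqPolynomialOn T n g := by
  obtain ⟨q, hq, hfq⟩ := hf
  exact ⟨q, hq, fun τ hτ => (h τ hτ).trans (hfq τ hτ)⟩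

lemma mul (hf : EqPolynomialOn T n f) (hg : EqPolynomialOn T k g) :
    EqPolynomialOn T (n + k) (fun τ => f τ * g τ) := by
  obtain ⟨p, hp, hfp⟩ := hf
  obtain ⟨q, hq, hgq⟩ := hg
  refine ⟨p * q, Polynomial.natDegree_mul_le_of_le hp hq, fun τ hτ => ?_⟩
  simp only [Polynomial.eval_mul, hfp τ hτ, hgq τ hτ]

lemma const_mul (c : ℝ) (hf : EqPolynomialOn T n f) : EqPolynomialOn T n (fun τ => c * f τ) := by
  obtain ⟨q, hq, hfq⟩ := hf
  refine ⟨Polynomial.C c * q, (Polynomial.natDegree_C_mul_le c q).trans hq, fun τ hτ => ?_⟩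
  simp only [Polynomial.eval_C_mul, hfq τ hτ]

lemma sum {ι : Type*} (s : Finset ι) {F : ι → ℝ → ℝ} (hF : ∀ i ∈ s, EqPolynomialOn T n (F i)) :
    EqPolynomialOn T n (fun τ => ∑ i ∈ s, F i τ) := by
  choose! q hq hFq using hF
  refine ⟨∑ i ∈ s, q i, Polynomial.natDegree_sum_le_of_forall_le s q hq, fun τ hτ => ?_⟩
  rw [Polynomial.eval_finsetSum]
  exact Finset.sum_congr rfl fun i hi => hFq i hi τ hτ

end EqPolynomialOn

lemma iteratedDerivWithin_pi_apply {ι : Type*} [Fintype ι] {f : ℝ → ι → ℝ} {S : Set ℝ} {x : ℝ}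
    {n : ℕ} (hf : ContDiffOn ℝ n f S) (hS : UniqueDiffOn ℝ S) (hx : x ∈ S) (i : ι) :
    iteratedDerivWithin n f S x i = iteratedDerivWithin n (fun s => f s i) S x := by
  have h := ContinuousLinearMap.iteratedFDerivWithin_comp_left
    (ContinuousLinearMap.proj (R := ℝ) (φ := fun _ : ι => ℝ) i) (hf x hx) hS hx le_rfl
  exact (congrArg (fun L => L fun _ => (1 : ℝ)) h).symm

/-- The chain rule along a curve in `ℝ^ι`, in terms of partial derivatives. -/
lemma derivWithin_comp_eq_sum {ι : Type*} [Fintype ι] [DecidableEq ι] {g : (ι → ℝ) → ℝ}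
    {u : ℝ → ι → ℝ} {S : Set ℝ} {x : ℝ} (hg : DifferentiableAt ℝ g (u x))
    (hu : DifferentiableWithinAt ℝ u S x) (hS : UniqueDiffWithinAt ℝ S x) :
    derivWithin (fun s => g (u s)) S x =
      ∑ i, fderiv ℝ g (u x) (Pi.single i 1) * derivWithin (fun s => u s i) S x := by
  have h := (hg.hasFDerivAt.comp_hasDerivWithinAt x hu.hasDerivWithinAt).derivWithin hS
  rw [Function.comp_def] at h
  rw [h, derivWithin_pi fun i => (differentiableWithinAt_pi.1 hu) i,
    ← ContinuousLinearMap.coe_coe, LinearMap.pi_apply_eq_sum_univ]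
  refine Finset.sum_congr rfl fun i _ => ?_
  rw [smul_eq_mul, mul_comm]
  congr 2
  ext j
  simp [Pi.single_apply, eq_comm]

/-- If the derivatives of order `k ≤ n` of `w τ` at `x` are polynomials in `τ` of degree at most
`k`, then so is the derivative of order `n` of `g ∘ w τ`. -/
lemma eqPolynomialOn_iteratedDerivWithin_comp {ι : Type*} [Fintype ι] {T S : Set ℝ} {x : ℝ}
    (hS : UniqueDiffOn ℝ S) (hx : x ∈ S) {w : ℝ → ℝ → ι → ℝ} (n : ℕ)
    (hw : ∀ τ ∈ T, ContDiffOn ℝ n (w τ) S)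
    (hreg : ∀ k ≤ n, ∀ i, EqPolynomialOn T k
      (fun τ => iteratedDerivWithin k (fun s => w τ s i) S x))
    {g : (ι → ℝ) → ℝ} (hg : ContDiff ℝ n g) :
    EqPolynomialOn T n (fun τ => iteratedDerivWithin n (fun s => g (w τ s)) S x) := by
  classical
  induction n using Nat.strong_induction_on generalizing g with
  | _ n ih =>
  cases n with
  | zero =>
    choose q hq hwq using hreg 0 le_rfl
    refine ⟨Polynomial.C (g fun i => (q i).coeff 0), by simp, fun τ hτ => ?_⟩
    simp only [iteratedDerivWithin_zero, Polynomial.eval_C] at hwq ⊢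
    congr 1
    ext i
    rw [hwq i τ hτ, Polynomial.eq_C_of_natDegree_le_zero (hq i)]
    simp
  | succ n =>
    push_cast at hw hg
    have hdg (i : ι) : ContDiff ℝ n (fun y => fderiv ℝ g y (Pi.single i 1)) :=
      (hg.fderiv_right le_rfl).clm_apply contDiff_const
    have hdw (i : ι) (τ : ℝ) (hτ : τ ∈ T) : ContDiffOn ℝ n (derivWithin (fun s => w τ s i) S) S :=
      (contDiffOn_pi.1 (hw τ hτ) i).derivWithin hS le_rfl
    have hw' (τ : ℝ) (hτ : τ ∈ T) : ContDiffOn ℝ n (w τ) S :=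
      (hw τ hτ).of_le (by exact_mod_cast n.le_succ)
    have hleibniz (τ : ℝ) (hτ : τ ∈ T) :
        iteratedDerivWithin (n + 1) (fun s => g (w τ s)) S x =
          ∑ i, ∑ k ∈ Finset.range (n + 1), n.choose k *
            (iteratedDerivWithin k (fun s => fderiv ℝ g (w τ s) (Pi.single i 1)) S x *
              iteratedDerivWithin (n - k + 1) (fun s => w τ s i) S x) := by
      have hcomp (i : ι) : ContDiffWithinAt ℝ n
          (fun s => fderiv ℝ g (w τ s) (Pi.single i 1)) S x :=
        (hdg i).comp_contDiffOn (hw' τ hτ) x hx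
      have hderiv : EqOn (derivWithin (fun s => g (w τ s)) S)
          (fun s => ∑ i, fderiv ℝ g (w τ s) (Pi.single i 1) *
            derivWithin (fun s => w τ s i) S s) S := fun s hs =>
        derivWithin_comp_eq_sum ((hg.differentiable (by simp)) _)
          ((hw τ hτ).differentiableOn (by simp) s hs) (hS s hs)
      rw [iteratedDerivWithin_succ', iteratedDerivWithin_congr hderiv hx,
        iteratedDerivWithin_fun_sum hx hS fun i _ => (hcomp i).mul (hdw i τ hτ x hx)]
      refine Finset.sum_congr rfl fun i _ => ?_
      refine (iteratedDerivWithin_mul hx hS (hcomp i) (hdw i τ hτ x hx)).trans ?_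
      simp only [iteratedDerivWithin_succ', mul_assoc]
    refine (EqPolynomialOn.sum _ fun i _ => EqPolynomialOn.sum _ fun k hk => ?_).congr hleibniz
    have hkn : k ≤ n := Nat.lt_succ_iff.1 (Finset.mem_range.1 hk)
    have hkn' : (k : WithTop ℕ∞) ≤ n := by exact_mod_cast hkn
    have hprod := (ih k (Nat.lt_succ_of_le hkn) (fun τ hτ => (hw' τ hτ).of_le hkn')
      (fun l hl => hreg l (by omega)) ((hdg i).of_le hkn')).mul (hreg (n - k + 1) (by omega) i)
    rw [show k + (n - k + 1) = n + 1 by omega] at hprod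
    exact hprod.const_mul _

/-- **Composition of a regular function with a smooth map is regular.**
Let `w : [0,1] × [0,ε] → ℝ^d` be C^r (jointly) such that for each
`0 ≤ n ≤ r-1` the `n`-th Taylor coefficient in `h` at `h = 0`,
`τ ↦ (1/n!) ∂ⁿw/∂hⁿ(τ,0)` (expressed via `iteratedDerivWithin` in the second
variable on `[0,ε]`), is componentwise a polynomial in `τ` of degree `≤ n`.
If `g : ℝ^d → ℝ^m` is C^r, then for each `0 ≤ n ≤ r-1` the function
`τ ↦ (1/n!) ∂ⁿ/∂hⁿ [g(w(τ,h))] |_{h=0}` is componentwise a polynomial in `τ`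
of degree `≤ n`. -/
theorem regular_composition (d m r : ℕ) (hr : 1 ≤ r) (ε : ℝ) (hε : 0 < ε)
    (w : ℝ → ℝ → Fin d → ℝ)
    (hw : ContDiffOn ℝ r (fun p : ℝ × ℝ => w p.1 p.2) (Icc 0 1 ×ˢ Icc 0 ε))
    (hreg : ∀ n ≤ r - 1, ∀ i : Fin d, ∃ q : Polynomial ℝ, q.natDegree ≤ n ∧
        ∀ τ ∈ Icc (0:ℝ) 1,
          (Nat.factorial n : ℝ)⁻¹ * iteratedDerivWithin n (w τ) (Icc 0 ε) 0 i
            = q.eval τ)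
    (g : (Fin d → ℝ) → Fin m → ℝ) (hg : ContDiff ℝ r g) :
    ∀ n ≤ r - 1, ∀ j : Fin m, ∃ q : Polynomial ℝ, q.natDegree ≤ n ∧
      ∀ τ ∈ Icc (0:ℝ) 1,
        (Nat.factorial n : ℝ)⁻¹ *
            iteratedDerivWithin n (fun s => g (w τ s)) (Icc 0 ε) 0 j
          = q.eval τ := by
  intro n hn j
  have hS : UniqueDiffOn ℝ (Icc 0 ε) := uniqueDiffOn_Icc hε
  have h0 : (0 : ℝ) ∈ Icc 0 ε := ⟨le_rfl, hε.le⟩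
  have hcast {k : ℕ} (hk : k ≤ n) : (k : WithTop ℕ∞) ≤ r := by
    exact_mod_cast (by omega : k ≤ r)
  have hwτ : ∀ τ ∈ Icc (0 : ℝ) 1, ContDiffOn ℝ r (w τ) (Icc 0 ε) := fun τ hτ =>
    hw.comp (contDiffOn_const.prodMk contDiffOn_id) fun s hs => ⟨hτ, hs⟩
  have hpoly := eqPolynomialOn_iteratedDerivWithin_comp (T := Icc 0 1) hS h0 n
    (fun τ hτ => (hwτ τ hτ).of_le (hcast le_rfl))
    (fun k hk i => (EqPolynomialOn.const_mul (k.factorial : ℝ) (hreg k (hk.trans hn) i)).congr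
      fun τ hτ => by
        rw [iteratedDerivWithin_pi_apply ((hwτ τ hτ).of_le (hcast hk)) hS h0,
          mul_inv_cancel_left₀ (by exact_mod_cast k.factorial_ne_zero)])
    ((contDiff_pi.1 hg j).of_le (hcast le_rfl))
  refine (hpoly.const_mul (n.factorial : ℝ)⁻¹).congr fun τ hτ => ?_
  rw [iteratedDerivWithin_pi_apply (f := fun s => g (w τ s))
    ((hg.comp_contDiffOn (hwτ τ hτ)).of_le (hcast le_rfl)) hS h0]
end

section
/- Let r ≥ 1 and h₀ > 0. Let P : [0,1] × [0,1] × [0,h₀] → ℝ be continuous and r times continuously differentiable in the third variable h, with all h-derivatives up to order r continuous on [0,1]² × [0,h₀], and suppose its Taylor coefficients P^{[n]}(τ,σ) = (1/n!) ∂ⁿP/∂hⁿ(τ,σ,0) satisfy: ∫₀¹ P^{[0]}(τ,σ) g(σ) dσ = g(τ) for every polynomial g of degree ≤ r−1 and every τ ∈ [0,1], and ∫₀¹ P^{[n]}(τ,σ) g(σ) dσ = 0 for every 1 ≤ n ≤ r−1, every polynomial g of degree ≤ r−1−n, and every τ. Let w : [0,1] × [0,h₀] → ℝ be continuous and r times continuously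 differentiable in h with all h-derivatives up to order r continuous, such that for each 0 ≤ n ≤ r−1 the function τ ↦ (1/n!) ∂ⁿw/∂hⁿ(τ,0) is a polynomial in τ of degree ≤ n. Then there exists a constant C such that |∫₀¹ P(τ,σ,h) w(σ,h) dσ − w(τ,h)| ≤ C·h^r for all τ ∈ [0,1] and all h ∈ [0,h₀]. -/
open MeasureTheory Set

/-- Taylor's theorem with a crude remainder, for a family `f` of successive derivatives on `[0,H]`
whose member of order `k` is bounded by `M`. -/
lemma abs_sub_taylor_sum_le (k : ℕ) (H M : ℝ) (f : ℕ → ℝ → ℝ)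
    (hf : ∀ n < k, ∀ h ∈ Icc (0:ℝ) H, HasDerivWithinAt (f n) (f (n + 1) h) (Icc 0 H) h)
    (hM : ∀ h ∈ Icc (0:ℝ) H, |f k h| ≤ M) (h : ℝ) (hh : h ∈ Icc (0:ℝ) H) :
    |f 0 h - ∑ n ∈ Finset.range k, (Nat.factorial n : ℝ)⁻¹ * f n 0 * h ^ n| ≤ M * h ^ k := by
  induction k generalizing f h with
  | zero => simpa using hM h hh
  | succ k ih =>
    have hM0 : 0 ≤ M := (abs_nonneg _).trans (hM h hh)
    have hsub : Icc 0 h ⊆ Icc 0 H := Icc_subset_Icc le_rfl hh.2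
    have hderiv : ∀ s ∈ Icc 0 h, HasDerivWithinAt
        (fun s => f 0 s - ∑ n ∈ Finset.range (k + 1), (Nat.factorial n : ℝ)⁻¹ * f n 0 * s ^ n)
        (f 1 s - ∑ n ∈ Finset.range k, (Nat.factorial n : ℝ)⁻¹ * f (n + 1) 0 * s ^ n)
        (Icc 0 h) s := by
      intro s hs
      refine ((hf 0 (by omega) s (hsub hs)).mono hsub).sub ?_
      have hsum : HasDerivWithinAt
          (fun s : ℝ => ∑ n ∈ Finset.range (k + 1), (Nat.factorial n : ℝ)⁻¹ * f n 0 * s ^ n)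
          (∑ n ∈ Finset.range (k + 1),
            (Nat.factorial n : ℝ)⁻¹ * f n 0 * ((n : ℝ) * s ^ (n - 1))) (Icc 0 h) s :=
        HasDerivWithinAt.fun_sum fun n _ =>
          ((hasDerivAt_pow n s).hasDerivWithinAt).const_mul _
      refine hsum.congr_deriv ?_
      rw [Finset.sum_range_succ']
      simp only [Nat.cast_zero, zero_mul, mul_zero, add_zero, Nat.add_sub_cancel]
      refine Finset.sum_congr rfl fun n _ => ?_
      rw [Nat.factorial_succ]
      push_cast
      field_simp
    have hbound : ∀ s ∈ Icc 0 h,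
        ‖f 1 s - ∑ n ∈ Finset.range k, (Nat.factorial n : ℝ)⁻¹ * f (n + 1) 0 * s ^ n‖
          ≤ M * h ^ k := by
      intro s hs
      refine (ih (fun n => f (n + 1)) (fun n hn => hf (n + 1) (by omega)) hM s (hsub hs)).trans ?_
      have := hs.1
      have := hs.2
      gcongr
    have hmvt := (convex_Icc 0 h).norm_image_sub_le_of_norm_hasDerivWithin_le hderiv hbound
      (left_mem_Icc.2 hh.1) (right_mem_Icc.2 hh.1)
    have hzero : f 0 0 - ∑ n ∈ Finset.range (k + 1),
        (Nat.factorial n : ℝ)⁻¹ * f n 0 * (0:ℝ) ^ n = 0 := by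
      simp [Finset.sum_range_succ']
    rw [hzero, sub_zero, sub_zero, Real.norm_eq_abs, Real.norm_eq_abs, abs_of_nonneg hh.1] at hmvt
    rwa [pow_succ, ← mul_assoc]

/-- A kernel whose Taylor coefficient of order `0` reproduces `g`, and whose coefficients of
orders `1, …, k - 1` annihilate `g`, reproduces `g` up to `O(h^k)`. -/
lemma exists_abs_integral_mul_sub_le (k : ℕ) (hk : 1 ≤ k) (h₀ : ℝ)
    (P : ℕ → ℝ → ℝ → ℝ → ℝ)
    (hPcont : ∀ n ≤ k, ContinuousOn (fun q : ℝ × ℝ × ℝ => P n q.1 q.2.1 q.2.2)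
        (Icc 0 1 ×ˢ Icc 0 1 ×ˢ Icc 0 h₀))
    (hPderiv : ∀ n < k, ∀ τ ∈ Icc (0:ℝ) 1, ∀ σ ∈ Icc (0:ℝ) 1, ∀ h ∈ Icc (0:ℝ) h₀,
        HasDerivWithinAt (fun s => P n τ σ s) (P (n + 1) τ σ h) (Icc 0 h₀) h)
    (g : ℝ → ℝ) (hg : ContinuousOn g (Icc 0 1))
    (hP0 : ∀ τ ∈ Icc (0:ℝ) 1,
        ∫ σ in (0:ℝ)..1, ((Nat.factorial 0 : ℝ)⁻¹ * P 0 τ σ 0) * g σ = g τ)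
    (hPn : ∀ n : ℕ, 1 ≤ n → n < k → ∀ τ ∈ Icc (0:ℝ) 1,
        ∫ σ in (0:ℝ)..1, ((Nat.factorial n : ℝ)⁻¹ * P n τ σ 0) * g σ = 0) :
    ∃ C : ℝ, ∀ τ ∈ Icc (0:ℝ) 1, ∀ h ∈ Icc (0:ℝ) h₀,
      |(∫ σ in (0:ℝ)..1, P 0 τ σ h * g σ) - g τ| ≤ C * h ^ k := by
  obtain ⟨M, hM⟩ := (isCompact_Icc.prod (isCompact_Icc.prod isCompact_Icc)
    ).exists_bound_of_continuousOn (hPcont k le_rfl)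
  obtain ⟨B, hB⟩ := isCompact_Icc.exists_bound_of_continuousOn hg
  refine ⟨M * B, fun τ hτ h hh => ?_⟩
  have hint : ∀ n ≤ k, ∀ s ∈ Icc (0:ℝ) h₀, ContinuousOn (fun σ => P n τ σ s) (Icc 0 1) :=
    fun n hn s hs => (hPcont n hn).comp (f := fun σ : ℝ => (τ, σ, s)) (by fun_prop)
      fun σ hσ => ⟨hτ, hσ, hs⟩
  have hzero : (0:ℝ) ∈ Icc 0 h₀ := ⟨le_rfl, hh.1.trans hh.2⟩
  have hterm : ∀ n ∈ Finset.range k, IntervalIntegrable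
      (fun σ => (Nat.factorial n : ℝ)⁻¹ * P n τ σ 0 * g σ * h ^ n) volume 0 1 := by
    intro n hn
    refine ContinuousOn.intervalIntegrable_of_Icc zero_le_one ?_
    have := hint n (Finset.mem_range.1 hn).le 0 hzero
    fun_prop
  have hsum : ∫ σ in (0:ℝ)..1, ∑ n ∈ Finset.range k,
      (Nat.factorial n : ℝ)⁻¹ * P n τ σ 0 * g σ * h ^ n = g τ := by
    rw [intervalIntegral.integral_finsetSum hterm, Finset.sum_eq_single_of_mem 0 (by simp; omega)]
    · rw [intervalIntegral.integral_mul_const, hP0 τ hτ, pow_zero, mul_one]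
    · intro n hn hn0
      rw [intervalIntegral.integral_mul_const,
        hPn n (Nat.one_le_iff_ne_zero.2 hn0) (Finset.mem_range.1 hn) τ hτ, zero_mul]
  have hmain : IntervalIntegrable (fun σ => P 0 τ σ h * g σ) volume 0 1 :=
    ContinuousOn.intervalIntegrable_of_Icc zero_le_one ((hint 0 (by omega) h hh).mul hg)
  have hsumint : IntervalIntegrable (fun σ => ∑ n ∈ Finset.range k,
      (Nat.factorial n : ℝ)⁻¹ * P n τ σ 0 * g σ * h ^ n) volume 0 1 := by
    simpa only [Finset.sum_fn] using IntervalIntegrable.sum _ hterm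
  rw [← hsum, ← intervalIntegral.integral_sub hmain hsumint]
  have hle := intervalIntegral.norm_integral_le_of_norm_le_const (a := (0:ℝ)) (b := 1)
    (C := M * B * h ^ k)
    (f := fun σ => P 0 τ σ h * g σ - ∑ n ∈ Finset.range k,
      (Nat.factorial n : ℝ)⁻¹ * P n τ σ 0 * g σ * h ^ n) ?_
  · simpa using hle
  · intro σ hσ
    rw [uIoc_of_le zero_le_one] at hσ
    have hσ' : σ ∈ Icc (0:ℝ) 1 := Ioc_subset_Icc_self hσ
    have htaylor := abs_sub_taylor_sum_le k h₀ M (fun n => P n τ σ)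
      (fun n hn => hPderiv n hn τ hτ σ hσ') (fun s hs => hM (τ, σ, s) ⟨hτ, hσ', hs⟩) h hh
    have hfactor : P 0 τ σ h * g σ - ∑ n ∈ Finset.range k,
        (Nat.factorial n : ℝ)⁻¹ * P n τ σ 0 * g σ * h ^ n
        = (P 0 τ σ h - ∑ n ∈ Finset.range k,
            (Nat.factorial n : ℝ)⁻¹ * P n τ σ 0 * h ^ n) * g σ := by
      rw [sub_mul, Finset.sum_mul]
      congr 1
      exact Finset.sum_congr rfl fun n _ => by ring
    rw [hfactor, norm_mul, Real.norm_eq_abs]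
    calc _ ≤ (M * h ^ k) * B :=
          mul_le_mul htaylor (hB σ hσ') (norm_nonneg _) ((abs_nonneg _).trans htaylor)
      _ = M * B * h ^ k := by ring

/-- **The projection error of a regular function is `O(h^r)` (Lemma on
`P_h w − w`).**  The kernel is encoded by the family `P : ℕ → ℝ → ℝ → ℝ → ℝ`,
where `P 0` is the kernel itself and `P (n+1) τ σ ·` is the `h`-derivative of
`P n τ σ ·` on `[0,h₀]`; all `P n`, `n ≤ r`, are continuous on
`[0,1]² × [0,h₀]`.  The Taylor coefficients `P^[n](τ,σ) = (1/n!) P n τ σ 0`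
reproduce polynomials of degree `≤ r-1` (case `n = 0`) and annihilate
polynomials of degree `≤ r-1-n` (cases `1 ≤ n ≤ r-1`).  Similarly the function
`w` is encoded by the family `w : ℕ → ℝ → ℝ → ℝ` of successive `h`-derivatives,
all continuous on `[0,1] × [0,h₀]`, and it is regular: for `n ≤ r-1` its `n`-th
Taylor coefficient `τ ↦ (1/n!) w n τ 0` is a polynomial of degree `≤ n`.
Then there is a constant `C` with
`|∫₀¹ P(τ,σ,h) w(σ,h) dσ − w(τ,h)| ≤ C h^r` on `[0,1] × [0,h₀]`. -/
theorem regular_projection_error (r : ℕ) (hr : 1 ≤ r) (h₀ : ℝ) (hh₀ : 0 < h₀)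
    (P : ℕ → ℝ → ℝ → ℝ → ℝ)
    (hPcont : ∀ n ≤ r, ContinuousOn (fun q : ℝ × ℝ × ℝ => P n q.1 q.2.1 q.2.2)
        (Icc 0 1 ×ˢ Icc 0 1 ×ˢ Icc 0 h₀))
    (hPderiv : ∀ n < r, ∀ τ ∈ Icc (0:ℝ) 1, ∀ σ ∈ Icc (0:ℝ) 1, ∀ h ∈ Icc (0:ℝ) h₀,
        HasDerivWithinAt (fun s => P n τ σ s) (P (n + 1) τ σ h) (Icc 0 h₀) h)
    (hP0 : ∀ g : Polynomial ℝ, g.natDegree ≤ r - 1 → ∀ τ ∈ Icc (0:ℝ) 1,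
        ∫ σ in (0:ℝ)..1, ((Nat.factorial 0 : ℝ)⁻¹ * P 0 τ σ 0) * g.eval σ = g.eval τ)
    (hPn : ∀ n : ℕ, 1 ≤ n → n ≤ r - 1 → ∀ g : Polynomial ℝ, g.natDegree ≤ r - 1 - n →
        ∀ τ ∈ Icc (0:ℝ) 1,
          ∫ σ in (0:ℝ)..1, ((Nat.factorial n : ℝ)⁻¹ * P n τ σ 0) * g.eval σ = 0)
    (w : ℕ → ℝ → ℝ → ℝ)
    (hwcont : ∀ n ≤ r, ContinuousOn (fun q : ℝ × ℝ => w n q.1 q.2)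
        (Icc 0 1 ×ˢ Icc 0 h₀))
    (hwderiv : ∀ n < r, ∀ τ ∈ Icc (0:ℝ) 1, ∀ h ∈ Icc (0:ℝ) h₀,
        HasDerivWithinAt (fun s => w n τ s) (w (n + 1) τ h) (Icc 0 h₀) h)
    (hwreg : ∀ n ≤ r - 1, ∃ q : Polynomial ℝ, q.natDegree ≤ n ∧
        ∀ τ ∈ Icc (0:ℝ) 1, (Nat.factorial n : ℝ)⁻¹ * w n τ 0 = q.eval τ) :
    ∃ C : ℝ, ∀ τ ∈ Icc (0:ℝ) 1, ∀ h ∈ Icc (0:ℝ) h₀,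
      |(∫ σ in (0:ℝ)..1, P 0 τ σ h * w 0 σ h) - w 0 τ h| ≤ C * h ^ r := by
  choose! q hqdeg hq using hwreg
  have hcoeff : ∀ m : ℕ, ∃ C : ℝ, m < r → ∀ τ ∈ Icc (0:ℝ) 1, ∀ h ∈ Icc (0:ℝ) h₀,
      |(∫ σ in (0:ℝ)..1, P 0 τ σ h * (q m).eval σ) - (q m).eval τ| ≤ C * h ^ (r - m) := by
    intro m
    by_cases hm : m < r
    · have hdeg := hqdeg m (by omega)
      obtain ⟨C, hC⟩ := exists_abs_integral_mul_sub_le (r - m) (by omega) h₀ P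
        (fun n hn => hPcont n (by omega)) (fun n hn => hPderiv n (by omega))
        (fun σ => (q m).eval σ) (q m).continuous.continuousOn
        (hP0 (q m) (by omega))
        (fun n hn hnr => hPn n hn (by omega) (q m) (by omega))
      exact ⟨C, fun _ => hC⟩
    · exact ⟨0, fun h => absurd h hm⟩
  choose C hC using hcoeff
  obtain ⟨M, hM⟩ := (isCompact_Icc.prod isCompact_Icc).exists_bound_of_continuousOn
    (hwcont r le_rfl)
  obtain ⟨K, hK⟩ := (isCompact_Icc.prod (isCompact_Icc.prod isCompact_Icc)
    ).exists_bound_of_continuousOn (hPcont 0 (Nat.zero_le r))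
  refine ⟨K * M + ∑ m ∈ Finset.range r, C m + M, fun τ hτ h hh => ?_⟩
  have hrem : ∀ σ ∈ Icc (0:ℝ) 1,
      |w 0 σ h - ∑ m ∈ Finset.range r, (q m).eval σ * h ^ m| ≤ M * h ^ r := by
    intro σ hσ
    have htaylor := abs_sub_taylor_sum_le r h₀ M (fun n => w n σ)
      (fun n hn => hwderiv n hn σ hσ) (fun s hs => hM (σ, s) ⟨hσ, hs⟩) h hh
    rwa [Finset.sum_congr rfl fun m hm => by
      rw [hq m (by have := Finset.mem_range.1 hm; omega) σ hσ]] at htaylor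
  have hPc : ContinuousOn (fun σ => P 0 τ σ h) (Icc 0 1) :=
    (hPcont 0 (Nat.zero_le r)).comp (f := fun σ : ℝ => (τ, σ, h)) (by fun_prop)
      fun σ hσ => ⟨hτ, hσ, hh⟩
  have hwc : ContinuousOn (fun σ => w 0 σ h) (Icc 0 1) :=
    (hwcont 0 (Nat.zero_le r)).comp (f := fun σ : ℝ => (σ, h)) (by fun_prop)
      fun σ hσ => ⟨hσ, hh⟩
  have hterm : ∀ m ∈ Finset.range r, IntervalIntegrable
      (fun σ => P 0 τ σ h * (q m).eval σ * h ^ m) volume 0 1 := fun m _ =>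
    ContinuousOn.intervalIntegrable_of_Icc zero_le_one (by fun_prop)
  have hremint : IntervalIntegrable
      (fun σ => P 0 τ σ h * (w 0 σ h - ∑ m ∈ Finset.range r, (q m).eval σ * h ^ m))
      volume 0 1 :=
    ContinuousOn.intervalIntegrable_of_Icc zero_le_one (by fun_prop)
  have hsplit : ∫ σ in (0:ℝ)..1, P 0 τ σ h * w 0 σ h =
      (∫ σ in (0:ℝ)..1,
        P 0 τ σ h * (w 0 σ h - ∑ m ∈ Finset.range r, (q m).eval σ * h ^ m)) +
      ∑ m ∈ Finset.range r, (∫ σ in (0:ℝ)..1, P 0 τ σ h * (q m).eval σ) * h ^ m := by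
    simp_rw [← intervalIntegral.integral_mul_const]
    rw [← intervalIntegral.integral_finsetSum hterm, ← intervalIntegral.integral_add hremint
      (by simpa only [Finset.sum_fn] using IntervalIntegrable.sum _ hterm)]
    refine intervalIntegral.integral_congr fun σ _ => ?_
    simp only [mul_sub, Finset.mul_sum, mul_assoc, sub_add_cancel]
  have hfirst : |∫ σ in (0:ℝ)..1,
      P 0 τ σ h * (w 0 σ h - ∑ m ∈ Finset.range r, (q m).eval σ * h ^ m)|
      ≤ K * M * h ^ r := by
    have hle := intervalIntegral.norm_integral_le_of_norm_le_const (a := (0:ℝ)) (b := 1)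
      (C := K * M * h ^ r)
      (f := fun σ => P 0 τ σ h * (w 0 σ h - ∑ m ∈ Finset.range r, (q m).eval σ * h ^ m)) ?_
    · simpa using hle
    · intro σ hσ
      rw [uIoc_of_le zero_le_one] at hσ
      have hσ' : σ ∈ Icc (0:ℝ) 1 := Ioc_subset_Icc_self hσ
      have hKσ := hK (τ, σ, h) ⟨hτ, hσ', hh⟩
      rw [norm_mul, mul_assoc]
      exact mul_le_mul hKσ (hrem σ hσ') (norm_nonneg _) ((norm_nonneg _).trans hKσ)
  have hsecond : |∑ m ∈ Finset.range r,
      ((∫ σ in (0:ℝ)..1, P 0 τ σ h * (q m).eval σ) - (q m).eval τ) * h ^ m|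
      ≤ (∑ m ∈ Finset.range r, C m) * h ^ r := by
    rw [Finset.sum_mul]
    refine (Finset.abs_sum_le_sum_abs _ _).trans (Finset.sum_le_sum fun m hm => ?_)
    have hmr := Finset.mem_range.1 hm
    rw [abs_mul, abs_of_nonneg (pow_nonneg hh.1 m)]
    calc _ ≤ C m * h ^ (r - m) * h ^ m :=
          mul_le_mul_of_nonneg_right (hC m hmr τ hτ h hh) (pow_nonneg hh.1 m)
      _ = C m * h ^ r := by rw [mul_assoc, ← pow_add, Nat.sub_add_cancel hmr.le]
  have hthird := hrem τ hτ
  simp only [sub_mul, Finset.sum_sub_distrib] at hsecond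
  rw [hsplit]
  rw [abs_le] at hfirst hsecond hthird ⊢
  constructor <;> linarith [hfirst.1, hfirst.2, hsecond.1, hsecond.2, hthird.1, hthird.2]
end

section
/- Let r ≥ 0, t₀ ∈ ℝ, and let Φ₁, …, Φ_{r+1} : ℝ → ℝ be C^{r+1} functions whose Wronskian matrix (Φ_j^{(i−1)}(t₀))_{1≤i,j≤r+1} is nonsingular, and let d₁ < d₂ < … < d_{r+1} be distinct points in [0,1]. Then there exists h₀ > 0 such that for every 0 < h < h₀ the (r+1)×(r+1) matrix Λ(h) with entries Λ(h)_{ij} = Φ_j(t₀ + d_i h) is nonsingular. -/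
open Set

/-- Iterated Rolle theorem: a `C^n` function with `n + 1` distinct zeros in `[a, b]` has, for
each `k ≤ n`, a zero of its `k`-th derivative in `[a, b]`. -/
theorem exists_iteratedDeriv_eq_zero_of_strictMono {a b : ℝ} {n : ℕ} {f : ℝ → ℝ}
    (hf : ContDiff ℝ n f) {x : Fin (n + 1) → ℝ} (hx : StrictMono x)
    (hmem : ∀ i, x i ∈ Icc a b) (hzero : ∀ i, f (x i) = 0) {k : ℕ} (hk : k ≤ n) :
    ∃ ξ ∈ Icc a b, iteratedDeriv k f ξ = 0 := by
  induction n generalizing f k with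
  | zero =>
    obtain rfl : k = 0 := by omega
    exact ⟨x 0, hmem 0, by simpa using hzero 0⟩
  | succ n ih =>
    cases k with
    | zero => exact ⟨x 0, hmem 0, by simpa using hzero 0⟩
    | succ k =>
      have hrolle : ∀ i : Fin (n + 1), ∃ c ∈ Ioo (x i.castSucc) (x i.succ), deriv f c = 0 :=
        fun i => exists_deriv_eq_zero (hx i.castSucc_lt_succ) hf.continuous.continuousOn
          ((hzero _).trans (hzero _).symm)
      choose y hy hy0 using hrolle
      have hf' : ContDiff ℝ n (deriv f) := by
        have h : ContDiff ℝ ((n : WithTop ℕ∞) + 1) f := by exact_mod_cast hf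
        exact (contDiff_succ_iff_deriv.1 h).2.2
      have hymono : StrictMono y := by
        intro i j hij
        have h : x i.succ ≤ x j.castSucc := hx.monotone (by
          simp only [Fin.le_def, Fin.val_succ, Fin.val_castSucc]
          exact hij)
        exact (hy i).2.trans_le (h.trans (hy j).1.le)
      rw [iteratedDeriv_succ']
      exact ih hf' hymono
        (fun i => ⟨(hmem _).1.trans (hy i).1.le, (hy i).2.le.trans (hmem _).2⟩) hy0 (by omega)

/-- **Nonsingularity of the generalized Lagrange interpolation matrix for small
stepsizes.**  Let `Φ 0, …, Φ r : ℝ → ℝ` be C^{r+1} functions whose Wronskian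
matrix at `t₀` (the matrix with `(i,j)` entry the `i`-th derivative of `Φ j`
at `t₀`, `0`-indexed) is nonsingular, and let `d 0 < d 1 < … < d r` be
distinct points of `[0,1]`.  Then there is `h₀ > 0` such that for every
`0 < h < h₀` the collocation matrix `Λ(h)` with entries
`Λ(h)ᵢⱼ = Φ j (t₀ + d i · h)` is nonsingular. -/
theorem lagrange_collocation_matrix_nonsingular (r : ℕ) (t₀ : ℝ)
    (Φ : Fin (r + 1) → ℝ → ℝ) (hΦ : ∀ j, ContDiff ℝ (r + 1) (Φ j))
    (hW : (Matrix.of fun i j : Fin (r + 1) => iteratedDeriv i (Φ j) t₀).det ≠ 0)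
    (dn : Fin (r + 1) → ℝ) (hmono : StrictMono dn)
    (hd : ∀ i, dn i ∈ Icc (0:ℝ) 1) :
    ∃ h₀ > (0:ℝ), ∀ h : ℝ, 0 < h → h < h₀ →
      (Matrix.of fun i j : Fin (r + 1) => Φ j (t₀ + dn i * h)).det ≠ 0 := by
  have hcont : Continuous fun ξ : Fin (r + 1) → ℝ =>
      (Matrix.of fun i j : Fin (r + 1) => iteratedDeriv i (Φ j) (ξ i)).det := by
    refine Continuous.matrix_det (continuous_matrix fun i j => ?_)
    have hi : ((i : ℕ) : WithTop ℕ∞) ≤ (r : WithTop ℕ∞) + 1 := by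
      exact_mod_cast i.isLt.le
    exact ((hΦ j).continuous_iteratedDeriv i hi).comp (continuous_apply i)
  obtain ⟨δ, hδ, hball⟩ := Metric.eventually_nhds_iff.1
    (hcont.continuousAt.eventually_ne (x := fun _ => t₀) hW)
  refine ⟨δ, hδ, fun h hpos hlt hdet => ?_⟩
  obtain ⟨c, hc, hker⟩ := Matrix.exists_mulVec_eq_zero_iff.2 hdet
  have hcΦ : ∀ j ∈ Finset.univ, ContDiff ℝ r fun t => Φ j t * c j := fun j _ =>
    ((hΦ j).of_le le_self_add).mul contDiff_const
  have hzero : ∀ i, (fun t => ∑ j, Φ j t * c j) (t₀ + dn i * h) = 0 := fun i => congrFun hker i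
  have hξ : ∀ i : Fin (r + 1), ∃ ξ ∈ Icc t₀ (t₀ + h),
      iteratedDeriv i (fun t => ∑ j, Φ j t * c j) ξ = 0 := fun i =>
    exists_iteratedDeriv_eq_zero_of_strictMono (ContDiff.sum hcΦ)
      (x := fun i => t₀ + dn i * h)
      (fun i j hij => by
        have := mul_lt_mul_of_pos_right (hmono hij) hpos
        dsimp only
        linarith)
      (fun i => ⟨by nlinarith [(hd i).1], by nlinarith [(hd i).2]⟩) hzero
      (Nat.lt_succ_iff.1 i.isLt)
  choose ξ hξmem hξ0 using hξ
  refine hball (y := ξ) ?_ (Matrix.exists_mulVec_eq_zero_iff.1 ⟨c, hc, ?_⟩)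
  · refine (dist_pi_lt_iff hδ).2 fun i => ?_
    rw [Real.dist_eq, abs_lt]
    constructor <;> linarith [(hξmem i).1, (hξmem i).2]
  · funext i
    have hi : ((i : ℕ) : WithTop ℕ∞) ≤ (r : WithTop ℕ∞) := by
      exact_mod_cast Nat.lt_succ_iff.1 i.isLt
    have hsum := hξ0 i
    rw [iteratedDeriv_fun_sum fun j hj => ((hcΦ j hj).of_le hi).contDiffAt] at hsum
    simpa [Matrix.mulVec, dotProduct, mul_comm, iteratedDeriv_const_mul_field] using hsum
end

section
/- Let r ≥ 1, t₀ ∈ ℝ, h₀ > 0. Let f : ℝ^d → ℝ^d be C^∞ and let φ₀, …, φ_{r−1} : ℝ → ℝ be C^∞ functions whose Wronskian matrix (φ_j^{(i)}(t₀))_{0≤i,j≤r−1} is nonsingular and such that for every h ∈ (0,h₀] the functions φ̃_i(τ) = φ_i(t₀ + τh), 0 ≤ i ≤ r−1, are linearly independent on [0,1]. Let y : [t₀, t₀+h₀] → ℝ^d satisfy y′(t) = f(y(t)) with y(t₀) = y₀. Suppose that for each h ∈ (0,h₀], u_h : [0,1] → ℝ^d is continuously differentiable with u_h(0) = y₀,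 every component of u_h′ lies in Y_h = span{φ̃₀, …, φ̃_{r−1}}, ∫₀¹ v(τ)(u_h)′_i(τ) dτ = h∫₀¹ v(τ) f(u_h(τ))_i dτ for every v ∈ Y_h and every component i, and u_h → y₀ uniformly on [0,1] as h → 0⁺. Then the method has stage order r: there exist C > 0 and δ ∈ (0,h₀] such that max_{τ∈[0,1]} ‖u_h(τ) − y(t₀ + τh)‖_∞ ≤ C·h^{r+1} for all h ∈ (0,δ]. -/
open MeasureTheory Set Filter

/-- Solutions of an autonomous ODE with smooth right-hand side are smooth. -/
lemma contDiffOn_of_hasDerivAt_comp {E : Type*} [NormedAddCommGroup E] [NormedSpace ℝ E]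
    {f : E → E} (hf : ContDiff ℝ (⊤ : ℕ∞) f) {y : ℝ → E} {a b : ℝ} (hab : a < b)
    (hy : ∀ t ∈ Icc a b, HasDerivAt y (f (y t)) t) (n : ℕ) :
    ContDiffOn ℝ n y (Icc a b) := by
  induction n with
  | zero =>
    exact contDiffOn_zero.2 fun t ht => (hy t ht).continuousAt.continuousWithinAt
  | succ n ih =>
    have hU := uniqueDiffOn_Icc hab
    push_cast
    refine (contDiffOn_succ_iff_derivWithin hU).2
      ⟨fun t ht => (hy t ht).differentiableAt.differentiableWithinAt, by simp, ?_⟩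
    have hfn : ContDiff ℝ n f := hf.of_le (mod_cast le_top)
    exact (hfn.comp_contDiffOn ih).congr fun t ht =>
      (hy t ht).hasDerivWithinAt.derivWithin (hU t ht)

/-- A system with nonsingular Wronskian at `a` reproduces the Taylor polynomial of degree `r - 1`
at `a` of any smooth function. -/
lemma exists_linearCombination_approx {r : ℕ} (hr : 1 ≤ r) {φ : Fin r → ℝ → ℝ} {a b : ℝ}
    (hab : a < b) (hφ : ∀ i, ContDiff ℝ (⊤ : ℕ∞) (φ i))
    (hW : (Matrix.of fun i j : Fin r => iteratedDeriv i (φ j) a).det ≠ 0)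
    {g : ℝ → ℝ} (hg : ContDiffOn ℝ r g (Icc a b)) :
    ∃ (c : Fin r → ℝ) (C : ℝ), ∀ t ∈ Icc a b,
      |g t - ∑ k, c k * φ k t| ≤ C * (t - a) ^ r := by
  obtain ⟨n, rfl⟩ : ∃ n, r = n + 1 := ⟨r - 1, by omega⟩
  have hU := uniqueDiffOn_Icc hab
  have ha : a ∈ Icc a b := left_mem_Icc.2 hab.le
  obtain ⟨c, hc⟩ := Matrix.mulVec_surjective_iff_isUnit.2
    ((Matrix.isUnit_iff_isUnit_det _).2 hW.isUnit)
    (fun i : Fin (n + 1) => iteratedDerivWithin i g (Icc a b) a)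
  have hφ' : ∀ (m : ℕ) i, ContDiff ℝ m (φ i) := fun m i => (hφ i).of_le (mod_cast le_top)
  have hs : ∀ m : ℕ, ContDiff ℝ m (fun t => ∑ k, c k * φ k t) := fun m =>
    ContDiff.sum fun k _ => contDiff_const.mul (hφ' m k)
  have hD : ContDiffOn ℝ (n + 1) (g - fun t => ∑ k, c k * φ k t) (Icc a b) := by
    have := hg.sub (hs (n + 1)).contDiffOn
    exact_mod_cast this
  obtain ⟨C, hC⟩ := exists_taylor_mean_remainder_bound hab.le hD
  refine ⟨c, C, fun t ht => ?_⟩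
  have hT : taylorWithinEval (g - fun t => ∑ k, c k * φ k t) n (Icc a b) a t = 0 := by
    rw [taylor_within_apply]
    refine Finset.sum_eq_zero fun m hm => ?_
    have hm' : m < n + 1 := Finset.mem_range.1 hm
    have hcm := congrFun hc ⟨m, hm'⟩
    simp only [Matrix.mulVec, dotProduct, Matrix.of_apply] at hcm
    rw [iteratedDerivWithin_sub ha hU
        ((hg a ha).of_le (by exact_mod_cast hm'.le)) (hs m).contDiffAt.contDiffWithinAt,
      iteratedDerivWithin_eq_iteratedDeriv hU (hs m).contDiffAt ha,
      iteratedDeriv_fun_sum fun k _ => (contDiff_const.mul (hφ' m k)).contDiffAt, ← hcm]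
    simp [mul_comm]
  have := hC t ht
  rw [hT, sub_zero, Real.norm_eq_abs] at this
  exact this

/-- Cauchy–Schwarz on the unit interval for the `L¹` norm. -/
lemma sq_integral_abs_le {p : ℝ → ℝ} (hp : Continuous p) :
    (∫ τ in (0:ℝ)..1, |p τ|) ^ 2 ≤ ∫ τ in (0:ℝ)..1, p τ * p τ := by
  set q := ∫ τ in (0:ℝ)..1, |p τ| with hq
  have h0 : 0 ≤ ∫ τ in (0:ℝ)..1, (|p τ| - q) ^ 2 :=
    intervalIntegral.integral_nonneg zero_le_one fun _ _ => sq_nonneg _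
  have h1 : ∀ τ, (|p τ| - q) ^ 2 = p τ * p τ - 2 * q * |p τ| + q ^ 2 := fun τ => by
    rw [← abs_mul_abs_self (p τ)]; ring
  simp only [h1] at h0
  rw [intervalIntegral.integral_add, intervalIntegral.integral_sub,
    intervalIntegral.integral_const_mul, ← hq, intervalIntegral.integral_const] at h0
  · simp only [sub_zero, one_smul] at h0
    linarith
  all_goals exact Continuous.intervalIntegrable (by fun_prop) _ _

/-- If `⟨p, p⟩ = ⟨p, q⟩` and `|q| ≤ M` on the unit interval, then the `L¹` norm of `p` is at most
`M`. -/
lemma integral_abs_le_of_integral_mul_self_eq {p q : ℝ → ℝ} (hp : Continuous p)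
    (hq : Continuous q) {M : ℝ} (hM : ∀ τ ∈ Icc (0:ℝ) 1, |q τ| ≤ M)
    (h : ∫ τ in (0:ℝ)..1, p τ * p τ = ∫ τ in (0:ℝ)..1, p τ * q τ) :
    ∫ τ in (0:ℝ)..1, |p τ| ≤ M := by
  have hM0 : 0 ≤ M := (abs_nonneg _).trans (hM 0 (by simp))
  have h1 : ∫ τ in (0:ℝ)..1, p τ * q τ ≤ ∫ τ in (0:ℝ)..1, M * |p τ| := by
    refine intervalIntegral.integral_mono_on zero_le_one
      (Continuous.intervalIntegrable (by fun_prop) _ _)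
      (Continuous.intervalIntegrable (by fun_prop) _ _) fun τ hτ => ?_
    calc p τ * q τ ≤ |p τ| * |q τ| := by rw [← abs_mul]; exact le_abs_self _
      _ ≤ |p τ| * M := by gcongr; exact hM τ hτ
      _ = M * |p τ| := mul_comm _ _
  rw [intervalIntegral.integral_const_mul] at h1
  have h2 := sq_integral_abs_le hp
  by_contra! hlt
  nlinarith

/-- Error bound for one component of the Galerkin approximation: if `U'` and `w` lie in the trial
space, so that the Galerkin relation may be tested with `U' - h w`, then the error is bounded by
the local defects. -/
lemma abs_sub_le_of_galerkin {U U' z g F w : ℝ → ℝ} {h A B : ℝ} (hh : 0 ≤ h)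
    (hU : ∀ τ ∈ Icc (0:ℝ) 1, HasDerivAt U (U' τ) τ) (hU' : Continuous U')
    (hz : ∀ τ ∈ Icc (0:ℝ) 1, HasDerivAt z (h * g τ) τ) (hg : ContinuousOn g (Icc 0 1))
    (hF : Continuous F) (hw : Continuous w) (h0 : U 0 = z 0)
    (hgal : ∫ τ in (0:ℝ)..1, (U' τ - h * w τ) * U' τ
      = h * ∫ τ in (0:ℝ)..1, (U' τ - h * w τ) * F τ)
    (hA : ∀ τ ∈ Icc (0:ℝ) 1, |F τ - g τ| ≤ A) (hB : ∀ τ ∈ Icc (0:ℝ) 1, |g τ - w τ| ≤ B)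
    {τ : ℝ} (hτ : τ ∈ Icc (0:ℝ) 1) :
    |U τ - z τ| ≤ h * A + 2 * h * B := by
  have hp : Continuous fun s => U' s - h * w s := by fun_prop
  have hsub : Icc 0 τ ⊆ Icc (0:ℝ) 1 := Icc_subset_Icc_right hτ.2
  have hpL1 : ∫ s in (0:ℝ)..1, |U' s - h * w s| ≤ h * (A + B) := by
    refine integral_abs_le_of_integral_mul_self_eq hp (q := fun s => h * (F s - w s))
      (by fun_prop) (fun s hs => ?_) ?_
    · rw [abs_mul, abs_of_nonneg hh]
      gcongr
      calc |F s - w s| ≤ |F s - g s| + |g s - w s| := abs_sub_le _ _ _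
        _ ≤ A + B := add_le_add (hA s hs) (hB s hs)
    · have e1 : ∀ s, (U' s - h * w s) * (U' s - h * w s)
          = (U' s - h * w s) * U' s - h * ((U' s - h * w s) * w s) := fun s => by ring
      have e2 : ∀ s, (U' s - h * w s) * (h * (F s - w s))
          = h * ((U' s - h * w s) * F s) - h * ((U' s - h * w s) * w s) := fun s => by ring
      simp only [e1, e2]
      rw [intervalIntegral.integral_sub, intervalIntegral.integral_sub, hgal,
        intervalIntegral.integral_const_mul h fun s => (U' s - h * w s) * F s]
      all_goals exact Continuous.intervalIntegrable (by fun_prop) _ _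
  have hftc : ∫ s in (0:ℝ)..τ, (U' s - h * g s) = U τ - z τ := by
    rw [intervalIntegral.integral_eq_sub_of_hasDerivAt (f := fun s => U s - z s)]
    · simp [h0]
    · intro s hs
      rw [uIcc_of_le hτ.1] at hs
      exact (hU s (hsub hs)).sub (hz s (hsub hs))
    · apply ContinuousOn.intervalIntegrable
      rw [uIcc_of_le hτ.1]
      exact hU'.continuousOn.sub (continuousOn_const.mul (hg.mono hsub))
  have hB0 : 0 ≤ B := (abs_nonneg _).trans (hB τ hτ)
  calc |U τ - z τ| = ‖∫ s in (0:ℝ)..τ, (U' s - h * g s)‖ := by rw [hftc, Real.norm_eq_abs]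
    _ ≤ ∫ s in (0:ℝ)..τ, (|U' s - h * w s| + h * B) := by
      refine intervalIntegral.norm_integral_le_of_norm_le hτ.1 (ae_of_all _ fun s hs => ?_)
        (Continuous.intervalIntegrable (by fun_prop) _ _)
      have hs' := hsub (Ioc_subset_Icc_self hs)
      calc ‖U' s - h * g s‖ ≤ |U' s - h * w s| + |h * w s - h * g s| := abs_sub_le _ _ _
        _ ≤ |U' s - h * w s| + h * B := by
          rw [← mul_sub, abs_mul, abs_of_nonneg hh, abs_sub_comm (w s)]
          gcongr
          exact hB s hs'
    _ ≤ ∫ s in (0:ℝ)..1, (|U' s - h * w s| + h * B) :=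
      intervalIntegral.integral_mono_interval le_rfl hτ.1 hτ.2
        (ae_of_all _ fun s => by simp only [Pi.zero_apply]; positivity)
        (Continuous.intervalIntegrable (by fun_prop) _ _)
    _ = (∫ s in (0:ℝ)..1, |U' s - h * w s|) + h * B := by
      rw [intervalIntegral.integral_add]
      · simp
      all_goals exact Continuous.intervalIntegrable (by fun_prop) _ _
    _ ≤ h * A + 2 * h * B := by linarith

/-- **Stage order `r` of the FFCFE method.**
Let `f` be C^∞ and let `φ 0, …, φ (r-1)` be C^∞ functions whose Wronskian
matrix at `t₀` is nonsingular, such that for every `h ∈ (0,h₀]` the rescaled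
functions `φ̃ᵢ(τ) = φᵢ(t₀ + τh)` are linearly independent on `[0,1]`.  Let `y`
solve `y' = f(y)` on `[t₀, t₀+h₀]` with `y t₀ = y₀`.  Suppose that for each
`h ∈ (0,h₀]` the function `u h : [0,1] → ℝ^d` is C¹ with `u h 0 = y₀`, each
component of its derivative lies in `Y_h = span{φ̃₀, …, φ̃_{r-1}}` (i.e. is a
linear combination of the `φ̃ᵢ` on `[0,1]`), the variational relation
`⟨v, (u h)'_i⟩ = h ⟨v, f(u h ·)_i⟩` holds for every `v ∈ Y_h` and every `i`,
and `u h → y₀` uniformly on `[0,1]` as `h → 0⁺`.  Then there are `C > 0` and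
`δ ∈ (0,h₀]` with `max_{τ∈[0,1]} ‖u h τ − y(t₀+τh)‖∞ ≤ C h^{r+1}` for all
`h ∈ (0,δ]`. -/
theorem ffcfe_stage_order (d r : ℕ) (hr : 1 ≤ r) (t₀ h₀ : ℝ) (hh₀ : 0 < h₀)
    (f : (Fin d → ℝ) → (Fin d → ℝ)) (hf : ContDiff ℝ (⊤ : ℕ∞) f)
    (φ : Fin r → ℝ → ℝ) (hφ : ∀ i, ContDiff ℝ (⊤ : ℕ∞) (φ i))
    (hW : (Matrix.of fun i j : Fin r => iteratedDeriv i (φ j) t₀).det ≠ 0)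
    (hind : ∀ h ∈ Ioc (0:ℝ) h₀, LinearIndependent ℝ
        (fun i : Fin r => (Icc (0:ℝ) 1).restrict (fun τ => φ i (t₀ + τ * h))))
    (y : ℝ → Fin d → ℝ) (y₀ : Fin d → ℝ)
    (hy : ∀ t ∈ Icc t₀ (t₀ + h₀), HasDerivAt y (f (y t)) t) (hy0 : y t₀ = y₀)
    (u : ℝ → ℝ → Fin d → ℝ)
    (hu1 : ∀ h ∈ Ioc (0:ℝ) h₀, ContDiff ℝ 1 (u h))
    (hu0 : ∀ h ∈ Ioc (0:ℝ) h₀, u h 0 = y₀)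
    (huY : ∀ h ∈ Ioc (0:ℝ) h₀, ∀ i : Fin d, ∃ c : Fin r → ℝ,
        ∀ τ ∈ Icc (0:ℝ) 1, deriv (u h) τ i = ∑ k : Fin r, c k * φ k (t₀ + τ * h))
    (hvar : ∀ h ∈ Ioc (0:ℝ) h₀, ∀ v : ℝ → ℝ,
        (∃ c : Fin r → ℝ, ∀ τ ∈ Icc (0:ℝ) 1, v τ = ∑ k : Fin r, c k * φ k (t₀ + τ * h)) →
        ∀ i : Fin d, ∫ τ in (0:ℝ)..1, v τ * deriv (u h) τ i
          = h * ∫ τ in (0:ℝ)..1, v τ * f (u h τ) i)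
    (hconv : TendstoUniformlyOn u (fun _ => y₀) (nhdsWithin 0 (Ioi 0)) (Icc 0 1)) :
    ∃ C > (0:ℝ), ∃ δ ∈ Ioc (0:ℝ) h₀, ∀ h ∈ Ioc (0:ℝ) δ, ∀ τ ∈ Icc (0:ℝ) 1,
      ‖u h τ - y (t₀ + τ * h)‖ ≤ C * h ^ (r + 1) := by
  have hlt : t₀ < t₀ + h₀ := by linarith
  have hyC := contDiffOn_of_hasDerivAt_comp hf hlt hy
  have hfr : ContDiff ℝ r f := hf.of_le (mod_cast le_top)
  have hgC : ∀ i, ContDiffOn ℝ r (fun t => f (y t) i) (Icc t₀ (t₀ + h₀)) := fun i =>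
    contDiffOn_pi.1 (hfr.comp_contDiffOn (hyC r)) i
  choose c B hB using fun i => exists_linearCombination_approx hr hlt hφ hW (hgC i)
  have hf1 : ContDiff ℝ 1 f := hf.of_le (mod_cast le_top)
  obtain ⟨K, s, hs, hK⟩ := (hf1.contDiffAt (x := y₀)).exists_lipschitzOnWith
  obtain ⟨ε, hε, hball⟩ := Metric.mem_nhds_iff.1 hs
  have hycont : ContinuousAt y t₀ := (hy t₀ (left_mem_Icc.2 hlt.le)).continuousAt
  obtain ⟨δ₁, hδ₁, hyδ⟩ := Metric.continuousAt_iff.1 hycont ε hε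
  obtain ⟨δ₂, hδ₂, huδ⟩ := Metric.mem_nhdsWithin_iff.1
    (Metric.tendstoUniformlyOn_iff.1 hconv ε hε)
  have hK1 : (0:ℝ) < 2 * (K + 1) := by positivity
  set S : ℝ := ∑ i, |B i|
  have hS0 : 0 ≤ S := Finset.sum_nonneg fun i _ => abs_nonneg _
  refine ⟨4 * S + 1, by positivity, min (min h₀ (δ₁ / 2)) (min (δ₂ / 2) (1 / (2 * (K + 1)))),
    ⟨by positivity, (min_le_left _ _).trans (min_le_left _ _)⟩, ?_⟩
  rintro h ⟨hh, hle⟩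
  obtain ⟨⟨hle₀, hle₁⟩, hle₂, hle₃⟩ := by simpa only [le_min_iff] using hle
  have hmem : h ∈ Ioc (0:ℝ) h₀ := ⟨hh, hle₀⟩
  have hhK : h * K ≤ 1 / 2 := by
    rw [le_div_iff₀ hK1] at hle₃
    linarith
  have htm : ∀ τ ∈ Icc (0:ℝ) 1, t₀ + τ * h ∈ Icc t₀ (t₀ + h₀) := fun τ hτ =>
    ⟨by nlinarith [hτ.1], by nlinarith [hτ.2]⟩
  have hus : ∀ τ ∈ Icc (0:ℝ) 1, u h τ ∈ s := fun τ hτ => by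
    have hhδ : h ∈ Metric.ball (0:ℝ) δ₂ ∩ Ioi 0 := by
      refine ⟨?_, hh⟩
      rw [Metric.mem_ball, Real.dist_eq, sub_zero, abs_of_pos hh]
      linarith
    have := huδ hhδ τ hτ
    exact hball (by rwa [dist_comm] at this)
  have hys : ∀ τ ∈ Icc (0:ℝ) 1, y (t₀ + τ * h) ∈ s := fun τ hτ => by
    refine hball ?_
    rw [Metric.mem_ball, ← hy0]
    apply hyδ
    rw [Real.dist_eq, add_sub_cancel_left, abs_of_nonneg (mul_nonneg hτ.1 hh.le)]
    nlinarith [hτ.2]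
  have hzd : ∀ τ ∈ Icc (0:ℝ) 1,
      HasDerivAt (fun τ => y (t₀ + τ * h)) (h • f (y (t₀ + τ * h))) τ := fun τ hτ =>
    (hy _ (htm τ hτ)).scomp τ (by simpa using ((hasDerivAt_id τ).mul_const h).const_add t₀)
  have hud : ∀ τ, HasDerivAt (u h) (deriv (u h) τ) τ := fun τ =>
    ((hu1 h hmem).differentiable one_ne_zero τ).hasDerivAt
  have hzc : ContinuousOn (fun τ => y (t₀ + τ * h)) (Icc 0 1) := fun τ hτ =>
    (hzd τ hτ).continuousAt.continuousWithinAt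
  have huc : Continuous (u h) := (hu1 h hmem).continuous
  have hu'c : Continuous (deriv (u h)) := (hu1 h hmem).continuous_deriv le_rfl
  obtain ⟨τm, hτm, hmax⟩ := isCompact_Icc.exists_isMaxOn (nonempty_Icc.2 (zero_le_one (α := ℝ)))
    (huc.continuousOn.sub hzc).norm
  set e : ℝ → Fin d → ℝ := fun τ => u h τ - y (t₀ + τ * h)
  have hmax' : ∀ τ ∈ Icc (0:ℝ) 1, ‖e τ‖ ≤ ‖e τm‖ := fun τ hτ => hmax hτ
  have hbound : ‖e τm‖ ≤ h * (K * ‖e τm‖) + 2 * h * (S * h ^ r) := by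
    refine (pi_norm_le_iff_of_nonneg (by positivity)).2 fun i => ?_
    change |u h τm i - y (t₀ + τm * h) i| ≤ _
    refine abs_sub_le_of_galerkin (U := fun τ => u h τ i) (U' := fun τ => deriv (u h) τ i)
      (z := fun τ => y (t₀ + τ * h) i) (g := fun τ => f (y (t₀ + τ * h)) i)
      (F := fun τ => f (u h τ) i) (w := fun τ => ∑ k, c i k * φ k (t₀ + τ * h))
      hh.le (fun τ _ => hasDerivAt_pi.1 (hud τ) i) ?_ (fun τ hτ => hasDerivAt_pi.1 (hzd τ hτ) i)
      ?_ ?_ ?_ ?_ ?_ ?_ ?_ hτm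
    · exact (continuous_apply i).comp hu'c
    · exact ((continuous_apply i).comp hf.continuous).comp_continuousOn hzc
    · exact (continuous_apply i).comp (hf.continuous.comp huc)
    · have := fun k => (hφ k).continuous
      fun_prop
    · simp [hu0 h hmem, hy0]
    · obtain ⟨b, hb⟩ := huY h hmem i
      refine hvar h hmem _ ⟨fun k => b k - h * c i k, fun τ hτ => ?_⟩ i
      rw [hb τ hτ, Finset.mul_sum, ← Finset.sum_sub_distrib]
      exact Finset.sum_congr rfl fun k _ => by ring
    · intro τ hτ
      calc |f (u h τ) i - f (y (t₀ + τ * h)) i|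
          ≤ ‖f (u h τ) - f (y (t₀ + τ * h))‖ := norm_le_pi_norm (f (u h τ) - f _) i
        _ ≤ K * ‖e τ‖ := hK.norm_sub_le (hus τ hτ) (hys τ hτ)
        _ ≤ K * ‖e τm‖ := by gcongr; exact hmax' τ hτ
    · intro τ hτ
      refine (hB i _ (htm τ hτ)).trans ?_
      have hBS : B i ≤ S := (le_abs_self _).trans
        (Finset.single_le_sum (f := fun i => |B i|) (fun i _ => abs_nonneg _) (Finset.mem_univ i))
      rw [add_sub_cancel_left]
      have hτh : 0 ≤ τ * h := mul_nonneg hτ.1 hh.le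
      gcongr
      exact mul_le_of_le_one_left hh.le hτ.2
  intro τ hτ
  have hhalf : h * (K * ‖e τm‖) ≤ 1 / 2 * ‖e τm‖ := by
    rw [← mul_assoc]; gcongr
  have hpow : 0 < h ^ (r + 1) := by positivity
  calc ‖e τ‖ ≤ ‖e τm‖ := hmax' τ hτ
    _ ≤ 4 * (h * (S * h ^ r)) := by linarith
    _ = 4 * S * h ^ (r + 1) := by ring
    _ ≤ (4 * S + 1) * h ^ (r + 1) := by gcongr; linarith
end

section
/- Let r ≥ 1, t₀ ∈ ℝ, h₀ > 0. Let f : ℝ^d → ℝ^d be C^∞ and let φ₀, …, φ_{r−1} : ℝ → ℝ be C^∞ functions whose Wronskian matrix (φ_j^{(i)}(t₀))_{0≤i,j≤r−1} is nonsingular and such that for every h ∈ (0,h₀] the functions φ̃_i(τ) = φ_i(t₀ + τh), 0 ≤ i ≤ r−1, are linearly independent on [0,1]. Let y : [t₀, t₀+h₀] → ℝ^d satisfy y′(t) = f(y(t)) with y(t₀) = y₀. Suppose that for each h ∈ (0,h₀], u_h : [0,1] → ℝ^d is continuously differentiable with u_h(0) = y₀, every component of u_h′ lies in Y_h = span{φ̃₀,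 …, φ̃_{r−1}}, ∫₀¹ v(τ)(u_h)′_i(τ) dτ = h∫₀¹ v(τ) f(u_h(τ))_i dτ for every v ∈ Y_h and every component i, and u_h → y₀ uniformly on [0,1] as h → 0⁺. Then the method has algebraic order 2r: there exist C > 0 and δ ∈ (0,h₀] such that ‖u_h(1) − y(t₀ + h)‖_∞ ≤ C·h^{2r+1} for all h ∈ (0,δ]. -/
open MeasureTheory Set Filter

open Asymptotics Topology in
/-- Integrating a bound `g' = O((t - t₀) ^ n)` gains one power. -/
theorem isBigO_pow_succ_of_deriv {E : Type*} [NormedAddCommGroup E] [NormedSpace ℝ E]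
    {g : ℝ → E} {t₀ : ℝ} {n : ℕ} (hg : Differentiable ℝ g) (h0 : g t₀ = 0)
    (hg' : deriv g =O[𝓝 t₀] fun t => (t - t₀) ^ n) :
    g =O[𝓝 t₀] fun t => (t - t₀) ^ (n + 1) := by
  obtain ⟨C, hC⟩ := hg'.bound
  obtain ⟨ε, hε, hball⟩ := Metric.eventually_nhds_iff_ball.1 hC
  refine IsBigO.of_bound C ?_
  filter_upwards [Metric.ball_mem_nhds t₀ hε] with t ht
  have hsub : uIcc t₀ t ⊆ Metric.ball t₀ ε := by
    rw [← segment_eq_uIcc]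
    exact (convex_ball t₀ ε).segment_subset (Metric.mem_ball_self hε) ht
  have hC0 : 0 ≤ C ∨ t = t₀ := by
    by_cases h : t = t₀
    · exact Or.inr h
    · left
      have := (norm_nonneg _).trans (hball t ht)
      exact nonneg_of_mul_nonneg_left this (norm_pos_iff.2 (pow_ne_zero _ (sub_ne_zero.2 h)))
  rcases hC0 with hC0 | rfl
  · have key := (convex_uIcc t₀ t).norm_image_sub_le_of_norm_hasDerivWithin_le
      (f := g) (f' := deriv g) (C := C * |t - t₀| ^ n) (x := t₀) (y := t)
      (fun x _ => (hg x).hasDerivAt.hasDerivWithinAt) (fun x hx => by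
        refine (hball x (hsub hx)).trans ?_
        rw [norm_pow, Real.norm_eq_abs]
        have : |x - t₀| ≤ |t - t₀| := abs_sub_left_of_mem_uIcc hx
        gcongr) left_mem_uIcc right_mem_uIcc
    rw [h0, sub_zero] at key
    rw [norm_pow, pow_succ, ← mul_assoc]
    exact key
  · simp [h0]

open Asymptotics Topology in
/-- A smooth function whose first `n` derivatives vanish at `t₀` is `O((t - t₀) ^ n)`. -/
theorem isBigO_pow_of_iteratedDeriv_eq_zero {t₀ : ℝ} (n : ℕ) {g : ℝ → ℝ}
    (hg : ContDiff ℝ (⊤ : ℕ∞) g) (h0 : ∀ i < n, iteratedDeriv i g t₀ = 0) :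
    g =O[𝓝 t₀] fun t => (t - t₀) ^ n := by
  induction n generalizing g with
  | zero => simpa using (hg.continuous.tendsto t₀).isBigO_one ℝ
  | succ n ih =>
    have hd := contDiff_infty_iff_deriv.1 hg
    refine isBigO_pow_succ_of_deriv hd.1 (by simpa using h0 0 (by omega)) (ih hd.2 fun i hi => ?_)
    rw [← iteratedDeriv_succ']
    exact h0 (i + 1) (by omega)

open Asymptotics Topology in
/-- A nonsingular Wronskian at `t₀` lets linear combinations of the `φ k` match any smooth
function up to `O((t - t₀) ^ r)`. -/
theorem exists_linearCombination_isBigO {r : ℕ} {t₀ : ℝ} {φ : Fin r → ℝ → ℝ}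
    (hφ : ∀ i, ContDiff ℝ (⊤ : ℕ∞) (φ i))
    (hW : (Matrix.of fun i j : Fin r => iteratedDeriv i (φ j) t₀).det ≠ 0)
    {g : ℝ → ℝ} (hg : ContDiff ℝ (⊤ : ℕ∞) g) :
    ∃ c : Fin r → ℝ,
      (fun t => g t - ∑ k, c k * φ k t) =O[𝓝 t₀] fun t => (t - t₀) ^ r := by
  have hsurj := Matrix.mulVec_surjective_iff_isUnit.2
    ((Matrix.isUnit_iff_isUnit_det _).2 (isUnit_iff_ne_zero.2 hW))
  obtain ⟨c, hc⟩ := hsurj fun i => iteratedDeriv i g t₀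
  have hsum : ContDiff ℝ (⊤ : ℕ∞) fun t => ∑ k, c k * φ k t :=
    ContDiff.sum fun k _ => contDiff_const.mul (hφ k)
  have hle (n : ℕ) : ((n : ℕ∞) : WithTop ℕ∞) ≤ ((⊤ : ℕ∞) : WithTop ℕ∞) := by
    exact_mod_cast le_top
  refine ⟨c, isBigO_pow_of_iteratedDeriv_eq_zero r (hg.sub hsum) fun i hi => ?_⟩
  rw [iteratedDeriv_fun_sub (hg.of_le (hle i)).contDiffAt (hsum.of_le (hle i)).contDiffAt,
    iteratedDeriv_fun_sum fun k _ => (contDiff_const.mul ((hφ k).of_le (hle i))).contDiffAt]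
  have := congrFun hc ⟨i, hi⟩
  simp only [Matrix.mulVec, dotProduct, Matrix.of_apply] at this
  rw [← this, sub_eq_zero]
  refine Finset.sum_congr rfl fun k _ => ?_
  rw [iteratedDeriv_const_mul_field, mul_comm]

open Asymptotics Topology in
/-- Picard iteration produces smooth approximate solutions of `x' = F x` to any order. -/
theorem exists_approx_solution {X : Type*} [NormedAddCommGroup X] [NormedSpace ℝ X]
    [CompleteSpace X] {F : X → X} (hF : ContDiff ℝ (⊤ : ℕ∞) F) (t₀ : ℝ) (x₀ : X) (n : ℕ) :
    ∃ q : ℝ → X, ContDiff ℝ (⊤ : ℕ∞) q ∧ q t₀ = x₀ ∧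
      (fun t => deriv q t - F (q t)) =O[𝓝 t₀] fun t => (t - t₀) ^ n := by
  induction n with
  | zero =>
    refine ⟨fun _ => x₀, contDiff_const, rfl, ?_⟩
    simpa using isBigO_const_const (c' := (1 : ℝ)) (F x₀) one_ne_zero (𝓝 t₀)
  | succ n ih =>
    obtain ⟨q, hq, hq0, hqO⟩ := ih
    have hFq : ContDiff ℝ (⊤ : ℕ∞) fun t => F (q t) := hF.comp hq
    let p : ℝ → X := fun t => x₀ + ∫ s in t₀..t, F (q s)
    have hp' (t : ℝ) : HasDerivAt p (F (q t)) t :=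
      (hFq.continuous.integral_hasStrictDerivAt t₀ t).hasDerivAt.const_add x₀
    have hdp : deriv p = fun t => F (q t) := funext fun t => (hp' t).deriv
    have hp : ContDiff ℝ (⊤ : ℕ∞) p :=
      contDiff_infty_iff_deriv.2 ⟨fun t => (hp' t).differentiableAt, hdp ▸ hFq⟩
    have hp0 : p t₀ = x₀ := by simp [p]
    have hqd := (contDiff_infty_iff_deriv.1 hq).1
    have hdiff : (fun t => q t - p t) =O[𝓝 t₀] fun t => (t - t₀) ^ (n + 1) := by
      refine isBigO_pow_succ_of_deriv (hqd.sub (contDiff_infty_iff_deriv.1 hp).1)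
        (by simp [hq0, hp0]) ?_
      refine hqO.congr_left fun t => ?_
      exact (((hqd t).hasDerivAt.sub (hp' t)).deriv).symm
    refine ⟨p, hp, hp0, ?_⟩
    have hstrict := (hF.contDiffAt (x := x₀)).hasStrictFDerivAt (by simp)
    have htend : Tendsto (fun t => (q t, p t)) (𝓝 t₀) (𝓝 (x₀, x₀)) := by
      have := (hq.continuous.prodMk hp.continuous).tendsto t₀
      simpa only [hq0, hp0] using this
    rw [hdp]
    exact (hstrict.isBigO_sub.comp_tendsto htend).trans hdiff

/-- If `R` and `g` have the same pairing with `R` on `[0,1]` and `|g| ≤ K`, then the `L¹` norm of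
`R` is at most `K`. -/
theorem integral_abs_le_of_integral_sq_eq {R g : ℝ → ℝ} (hR : Continuous R) (hg : Continuous g)
    {K : ℝ} (hK : 0 < K) (hgK : ∀ τ ∈ Icc (0:ℝ) 1, |g τ| ≤ K)
    (hRg : ∫ τ in (0:ℝ)..1, R τ * R τ = ∫ τ in (0:ℝ)..1, R τ * g τ) :
    ∫ τ in (0:ℝ)..1, |R τ| ≤ K := by
  have h1 : ∫ τ in (0:ℝ)..1, R τ * g τ ≤ ∫ τ in (0:ℝ)..1, K * |R τ| := by
    refine intervalIntegral.integral_mono_on zero_le_one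
      (Continuous.intervalIntegrable (by fun_prop) _ _)
      (Continuous.intervalIntegrable (by fun_prop) _ _) fun τ hτ => ?_
    calc R τ * g τ ≤ |R τ| * |g τ| := by rw [← abs_mul]; exact le_abs_self _
      _ ≤ |R τ| * K := by gcongr; exact hgK τ hτ
      _ = K * |R τ| := mul_comm _ _
  have h2 : ∫ τ in (0:ℝ)..1, 2 * K * |R τ| ≤ ∫ τ in (0:ℝ)..1, (K ^ 2 + R τ * R τ) := by
    refine intervalIntegral.integral_mono_on zero_le_one
      (Continuous.intervalIntegrable (by fun_prop) _ _)
      (Continuous.intervalIntegrable (by fun_prop) _ _) fun τ _ => ?_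
    nlinarith [sq_nonneg (K - |R τ|), sq_abs (R τ)]
  rw [intervalIntegral.integral_const_mul] at h1 h2
  rw [intervalIntegral.integral_add (Continuous.intervalIntegrable (by fun_prop) _ _)
    (Continuous.intervalIntegrable (by fun_prop) _ _), hRg] at h2
  simp only [intervalIntegral.integral_const, sub_zero, one_smul] at h2
  nlinarith

/-- A priori bounds for the Galerkin approximation `U` of `U' = h F`: its distance to an
approximate solution `Q`, and the `L¹` norm of its residual. -/
theorem galerkin_error_le {d : ℕ} {h L a b : ℝ} (hh : 0 < h) (hL : 0 ≤ L) (hhL : 4 * h * L ≤ 1)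
    (ha : 0 ≤ a) (hb : 0 < b) {U Q U' Q' F G : ℝ → Fin d → ℝ}
    (hU : ∀ τ, HasDerivAt U (U' τ) τ) (hQ : ∀ τ, HasDerivAt Q (Q' τ) τ)
    (hU' : Continuous U') (hQ' : Continuous Q') (hF : Continuous F) (h0 : U 0 = Q 0)
    (hFG : ∀ τ ∈ Icc (0:ℝ) 1, ‖F τ - G τ‖ ≤ L * ‖U τ - Q τ‖)
    (hQG : ∀ τ ∈ Icc (0:ℝ) 1, ‖Q' τ - h • G τ‖ ≤ h * a)
    (hp : ∀ j, ∃ p : ℝ → ℝ, Continuous p ∧ (∀ τ ∈ Icc (0:ℝ) 1, |p τ - G τ j| ≤ b) ∧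
      ∫ τ in (0:ℝ)..1, (U' τ j - h * F τ j) * (U' τ j - h * F τ j)
        = ∫ τ in (0:ℝ)..1, (U' τ j - h * F τ j) * (h * (p τ - F τ j))) :
    (∀ τ ∈ Icc (0:ℝ) 1, ‖U τ - Q τ‖ ≤ 2 * h * (a + b)) ∧
      ∀ j, ∫ τ in (0:ℝ)..1, |U' τ j - h * F τ j| ≤ 2 * h * (a + b) := by
  have hUc : Continuous U := continuous_iff_continuousAt.2 fun τ => (hU τ).continuousAt
  have hQc : Continuous Q := continuous_iff_continuousAt.2 fun τ => (hQ τ).continuousAt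
  obtain ⟨σ, hσ, hmax⟩ := (isCompact_Icc (a := (0:ℝ)) (b := 1)).exists_isMaxOn
    (nonempty_Icc.2 zero_le_one) (f := fun τ => ‖U τ - Q τ‖) (by fun_prop)
  set N := ‖U σ - Q σ‖ with hN
  have hN0 : 0 ≤ N := norm_nonneg _
  have hle : ∀ τ ∈ Icc (0:ℝ) 1, ‖U τ - Q τ‖ ≤ N := fun τ hτ => hmax hτ
  have hFGN (τ) (hτ : τ ∈ Icc (0:ℝ) 1) (j : Fin d) : |F τ j - G τ j| ≤ L * N :=
    (norm_le_pi_norm (F τ - G τ) j).trans ((hFG τ hτ).trans (by gcongr; exact hle τ hτ))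
  have hres (j : Fin d) : ∫ τ in (0:ℝ)..1, |U' τ j - h * F τ j| ≤ h * (b + L * N) := by
    obtain ⟨p, hpc, hpb, hpi⟩ := hp j
    refine integral_abs_le_of_integral_sq_eq (by fun_prop) (by fun_prop) (by positivity)
      (fun τ hτ => ?_) hpi
    rw [abs_mul, abs_of_pos hh]
    gcongr
    have h1 := abs_le.1 (hpb τ hτ)
    have h2 := abs_le.1 (hFGN τ hτ j)
    exact abs_le.2 ⟨by linarith, by linarith⟩
  have hNle : N ≤ h * (b + L * N) + (h * (L * N) + h * a) := by
    refine (pi_norm_le_iff_of_nonneg (by positivity)).2 fun j => ?_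
    have hftc : ∫ τ in (0:ℝ)..σ, (U' τ j - Q' τ j) = U σ j - Q σ j := by
      rw [intervalIntegral.integral_eq_sub_of_hasDerivAt (f := fun τ => U τ j - Q τ j)
        (fun τ _ => (hasDerivAt_pi.1 (hU τ) j).sub (hasDerivAt_pi.1 (hQ τ) j))
        (Continuous.intervalIntegrable (by fun_prop) _ _)]
      simp [h0]
    have hpt (τ) (hτ : τ ∈ Icc (0:ℝ) 1) :
        |U' τ j - Q' τ j| ≤ |U' τ j - h * F τ j| + (h * (L * N) + h * a) := by
      have h1 := hFGN τ hτ j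
      have h2 : |Q' τ j - h * G τ j| ≤ h * a :=
        (norm_le_pi_norm (Q' τ - h • G τ) j).trans (hQG τ hτ)
      have h3 : |h * (F τ j - G τ j)| ≤ h * (L * N) := by
        rw [abs_mul, abs_of_pos hh]; gcongr
      have h4 : U' τ j - Q' τ j = (U' τ j - h * F τ j) + (h * (F τ j - G τ j)
          - (Q' τ j - h * G τ j)) := by ring
      rw [h4]
      exact (abs_add_le _ _).trans (by gcongr; exact (abs_sub _ _).trans (by gcongr))
    calc ‖(U σ - Q σ) j‖ = |∫ τ in (0:ℝ)..σ, (U' τ j - Q' τ j)| := by rw [hftc]; rfl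
      _ ≤ ∫ τ in (0:ℝ)..σ, |U' τ j - Q' τ j| :=
        intervalIntegral.abs_integral_le_integral_abs hσ.1
      _ ≤ ∫ τ in (0:ℝ)..1, |U' τ j - Q' τ j| :=
        intervalIntegral.integral_mono_interval le_rfl hσ.1 hσ.2
          (Eventually.of_forall fun τ => abs_nonneg _)
          (Continuous.intervalIntegrable (by fun_prop) _ _)
      _ ≤ ∫ τ in (0:ℝ)..1, (|U' τ j - h * F τ j| + (h * (L * N) + h * a)) :=
        intervalIntegral.integral_mono_on zero_le_one
          (Continuous.intervalIntegrable (by fun_prop) _ _)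
          (Continuous.intervalIntegrable (by fun_prop) _ _) hpt
      _ = (∫ τ in (0:ℝ)..1, |U' τ j - h * F τ j|) + (h * (L * N) + h * a) := by
        rw [intervalIntegral.integral_add (Continuous.intervalIntegrable (by fun_prop) _ _)
          (Continuous.intervalIntegrable (by fun_prop) _ _)]
        simp
      _ ≤ _ := by gcongr; exact hres j
  have hLN : 4 * h * L * N ≤ 1 * N := by gcongr
  have hNfin : N ≤ 2 * h * (a + b) := by nlinarith
  have hha : 0 ≤ h * a := by positivity
  have hhb : 0 ≤ h * b := by positivity
  exact ⟨fun τ hτ => (hle τ hτ).trans hNfin, fun j => (hres j).trans (by nlinarith)⟩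

/-- A variation-of-constants estimate: if the part of `(A e)'` other than `A R` is at most `s`,
and the entries of `A` have small pairing with the components of `R`, then `A e` is small
at the end of the interval. -/
theorem norm_apply_one_le_of_pairing {d : ℕ} {s κ : ℝ} (hs : 0 ≤ s) (hκ : 0 ≤ κ)
    {A A' : ℝ → (Fin d → ℝ) →L[ℝ] (Fin d → ℝ)} {e e' R : ℝ → Fin d → ℝ}
    (hA : ∀ τ, HasDerivAt A (A' τ) τ) (he : ∀ τ, HasDerivAt e (e' τ) τ)
    (hA' : Continuous A') (he' : Continuous e') (hR : Continuous R) (h0 : e 0 = 0)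
    (hsmall : ∀ τ ∈ Icc (0:ℝ) 1, ‖A' τ (e τ) + A τ (e' τ - R τ)‖ ≤ s)
    (hpair : ∀ i j, |∫ τ in (0:ℝ)..1, A τ (Pi.single j 1) i * R τ j| ≤ κ) :
    ‖A 1 (e 1)‖ ≤ s + d * κ := by
  have hAc : Continuous A := continuous_iff_continuousAt.2 fun τ => (hA τ).continuousAt
  have hec : Continuous e := continuous_iff_continuousAt.2 fun τ => (he τ).continuousAt
  refine (pi_norm_le_iff_of_nonneg (by positivity)).2 fun i => ?_
  have hexp (τ : ℝ) : A τ (R τ) i = ∑ j, A τ (Pi.single j 1) i * R τ j := by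
    conv_lhs => rw [pi_eq_sum_univ' (R τ)]
    simp [mul_comm, Pi.single]
  have hint (j : Fin d) : Continuous fun τ => A τ (Pi.single j 1) i * R τ j := by fun_prop
  have hder (τ : ℝ) : HasDerivAt (fun τ => A τ (e τ) i)
      ((A' τ (e τ) + A τ (e' τ - R τ)) i + ∑ j, A τ (Pi.single j 1) i * R τ j) τ := by
    refine (hasDerivAt_pi.1 ((hA τ).clm_apply (he τ)) i).congr_deriv ?_
    rw [← hexp, map_sub]
    simp only [Pi.add_apply, Pi.sub_apply]
    ring
  have hftc := intervalIntegral.integral_eq_sub_of_hasDerivAt (a := 0) (b := 1)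
    (fun τ _ => hder τ) (Continuous.intervalIntegrable (by fun_prop) _ _)
  rw [intervalIntegral.integral_add (Continuous.intervalIntegrable (by fun_prop) _ _)
    (Continuous.intervalIntegrable (by fun_prop) _ _),
    intervalIntegral.integral_finsetSum fun j _ => (hint j).intervalIntegrable _ _] at hftc
  simp only [h0, map_zero, Pi.zero_apply, sub_zero] at hftc
  rw [← hftc]
  refine (norm_add_le _ _).trans (add_le_add ?_ ?_)
  · refine (intervalIntegral.norm_integral_le_of_norm_le_const (C := s) fun τ hτ => ?_).trans
      (by simp)
    rw [uIoc_of_le zero_le_one] at hτ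
    exact (norm_le_pi_norm _ i).trans (hsmall τ (Ioc_subset_Icc_self hτ))
  · refine (norm_sum_le _ _).trans ?_
    refine (Finset.sum_le_sum fun j _ => hpair i j).trans ?_
    simp

/-- Two approximate solutions of the same rescaled equation stay close on `[0,1]`. -/
theorem norm_sub_le_of_approx_solutions {E : Type*} [NormedAddCommGroup E] [NormedSpace ℝ E]
    {h L a : ℝ} (hh : 0 < h) (hL : 0 ≤ L) (hhL : 4 * h * L ≤ 1)
    {Y Q F Q' G : ℝ → E}
    (hY : ∀ τ ∈ Icc (0:ℝ) 1, HasDerivAt Y (h • F τ) τ)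
    (hQ : ∀ τ ∈ Icc (0:ℝ) 1, HasDerivAt Q (Q' τ) τ) (h0 : Y 0 = Q 0)
    (hFG : ∀ τ ∈ Icc (0:ℝ) 1, ‖F τ - G τ‖ ≤ L * ‖Y τ - Q τ‖)
    (hQG : ∀ τ ∈ Icc (0:ℝ) 1, ‖Q' τ - h • G τ‖ ≤ h * a) :
    ‖Y 1 - Q 1‖ ≤ 2 * h * a := by
  have hcont : ContinuousOn (fun τ => ‖Y τ - Q τ‖) (Icc 0 1) := fun τ hτ =>
    ((hY τ hτ).continuousAt.sub (hQ τ hτ).continuousAt).norm.continuousWithinAt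
  obtain ⟨σ, hσ, hmax⟩ := (isCompact_Icc (a := (0:ℝ)) (b := 1)).exists_isMaxOn
    (nonempty_Icc.2 zero_le_one) hcont
  have hle : ∀ τ ∈ Icc (0:ℝ) 1, ‖Y τ - Q τ‖ ≤ ‖Y σ - Q σ‖ := fun τ hτ => hmax hτ
  have h1 := hle 1 (right_mem_Icc.2 zero_le_one)
  set N := ‖Y σ - Q σ‖ with hN
  have ha : 0 ≤ h * a := (norm_nonneg _).trans (hQG σ hσ)
  have hN0 : 0 ≤ N := norm_nonneg _
  have hB : 0 ≤ h * (L * N) + h * a := by positivity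
  have hmv := (convex_Icc (0:ℝ) 1).norm_image_sub_le_of_norm_hasDerivWithin_le
    (f := fun τ => Y τ - Q τ) (f' := fun τ => h • F τ - Q' τ) (C := h * (L * N) + h * a)
    (fun τ hτ => ((hY τ hτ).sub (hQ τ hτ)).hasDerivWithinAt) (fun τ hτ => by
      have : h • F τ - Q' τ = h • (F τ - G τ) - (Q' τ - h • G τ) := by module
      rw [this]
      refine (norm_sub_le _ _).trans (add_le_add ?_ (hQG τ hτ))
      rw [norm_smul, Real.norm_of_nonneg hh.le]
      have := (hFG τ hτ).trans (mul_le_mul_of_nonneg_left (hle τ hτ) hL)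
      gcongr) (left_mem_Icc.2 zero_le_one) hσ
  simp only [h0, sub_self, sub_zero] at hmv
  rw [← hN, Real.norm_of_nonneg hσ.1] at hmv
  have hmv' : N ≤ h * (L * N) + h * a := hmv.trans (mul_le_of_le_one_right hB hσ.2)
  have hLN : 4 * h * L * N ≤ 1 * N := by gcongr
  nlinarith

/-- Second-order Taylor bound on a convex set where the derivative is Lipschitz. -/
theorem norm_sub_sub_fderiv_le {E : Type*} [NormedAddCommGroup E] [NormedSpace ℝ E]
    {f : E → E} (hf : Differentiable ℝ f) {K : NNReal} {s : Set E} (hs : Convex ℝ s)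
    (hK : LipschitzOnWith K (fderiv ℝ f) s) {x y : E} (hx : x ∈ s) (hy : y ∈ s) :
    ‖f y - f x - fderiv ℝ f x (y - x)‖ ≤ K * ‖y - x‖ * ‖y - x‖ := by
  refine (convex_segment x y).norm_image_sub_le_of_norm_hasFDerivWithin_le'
    (fun z _ => (hf z).hasFDerivAt.hasFDerivWithinAt) (fun z hz => ?_)
    (left_mem_segment ℝ x y) (right_mem_segment ℝ x y)
  refine (hK.norm_sub_le (hs.segment_subset hx hy hz) hx).trans ?_
  gcongr
  obtain ⟨θ, hθ, rfl⟩ := segment_eq_image' ℝ x y ▸ hz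
  rw [add_sub_cancel_left, norm_smul, Real.norm_of_nonneg hθ.1]
  exact mul_le_of_le_one_left (norm_nonneg _) hθ.2

open Asymptotics in
/-- Finitely many `O` bounds hold simultaneously with a common positive constant. -/
theorem exists_common_bound {ι α : Type*} [Fintype ι] {l : Filter α} {g : ι → α → ℝ} {k : α → ℝ}
    (h : ∀ i, g i =O[l] k) :
    ∃ C > (0:ℝ), ∀ᶠ t in l, ∀ i, |g i t| ≤ C * ‖k t‖ := by
  obtain ⟨C, hC, hb⟩ := (isBigO_pi.2 h : (fun t i => g i t) =O[l] k).exists_pos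
  refine ⟨C, hC, hb.bound.mono fun t ht i => ?_⟩
  exact (norm_le_pi_norm (fun i => g i t) i).trans ht

open Topology in
/-- Solutions of `q' = f q`, `M' = -M ∘ Df(q)` up to `O((t - t₀) ^ n)`, with `M` starting at the
identity. -/
theorem exists_approx_adjoint_system {E : Type*} [NormedAddCommGroup E] [NormedSpace ℝ E]
    [CompleteSpace E] {f : E → E} (hf : ContDiff ℝ (⊤ : ℕ∞) f) (t₀ : ℝ) (y₀ : E) (n : ℕ) :
    ∃ (q q' : ℝ → E) (M M' : ℝ → E →L[ℝ] E), ∃ C > (0:ℝ),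
      ContDiff ℝ (⊤ : ℕ∞) q ∧ ContDiff ℝ (⊤ : ℕ∞) M ∧
      Continuous q' ∧ Continuous M' ∧ (∀ t, HasDerivAt q (q' t) t) ∧
      (∀ t, HasDerivAt M (M' t) t) ∧ q t₀ = y₀ ∧ M t₀ = ContinuousLinearMap.id ℝ E ∧
      (∀ᶠ t in 𝓝 t₀, ‖q' t - f (q t)‖ ≤ C * ‖(t - t₀) ^ n‖) ∧
      ∀ᶠ t in 𝓝 t₀, ‖M' t + (M t).comp (fderiv ℝ f (q t))‖ ≤ C * ‖(t - t₀) ^ n‖ := by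
  let F : E × (E →L[ℝ] E) → E × (E →L[ℝ] E) := fun x => (f x.1, -x.2.comp (fderiv ℝ f x.1))
  have hF : ContDiff ℝ (⊤ : ℕ∞) F :=
    (hf.comp contDiff_fst).prodMk
      (contDiff_snd.clm_comp ((hf.fderiv_right (m := (⊤ : ℕ∞)) (by simp)).comp contDiff_fst)).neg
  obtain ⟨x, hx, hx0, hxO⟩ := exists_approx_solution hF t₀ (y₀, ContinuousLinearMap.id ℝ E) n
  obtain ⟨C, hC, hb⟩ := hxO.exists_pos
  have hd := contDiff_infty_iff_deriv.1 hx
  refine ⟨fun t => (x t).1, fun t => (deriv x t).1, fun t => (x t).2, fun t => (deriv x t).2,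
    C, hC, contDiff_fst.comp hx, contDiff_snd.comp hx, continuous_fst.comp hd.2.continuous,
    continuous_snd.comp hd.2.continuous, fun t => (hd.1 t).hasDerivAt.fst,
    fun t => (hd.1 t).hasDerivAt.snd, by simp [hx0], by simp [hx0], ?_, ?_⟩
  · exact hb.bound.mono fun t ht => (norm_fst_le _).trans ht
  · refine hb.bound.mono fun t ht => ?_
    have := (norm_snd_le _).trans ht
    simpa [F] using this

open Topology in
/-- **Algebraic order `2r` of the FFCFE method.**
Let `f` be C^∞ and let `φ 0, …, φ (r-1)` be C^∞ functions whose Wronskian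
matrix at `t₀` is nonsingular, such that for every `h ∈ (0,h₀]` the rescaled
functions `φ̃ᵢ(τ) = φᵢ(t₀ + τh)` are linearly independent on `[0,1]`.  Let `y`
solve `y' = f(y)` on `[t₀, t₀+h₀]` with `y t₀ = y₀`.  Suppose that for each
`h ∈ (0,h₀]` the function `u h : [0,1] → ℝ^d` is C¹ with `u h 0 = y₀`, each
component of its derivative lies in `Y_h = span{φ̃₀, …, φ̃_{r-1}}` (i.e. is a
linear combination of the `φ̃ᵢ` on `[0,1]`), the variational relation
`⟨v, (u h)'_i⟩ = h ⟨v, f(u h ·)_i⟩` holds for every `v ∈ Y_h` and every `i`,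
and `u h → y₀` uniformly on `[0,1]` as `h → 0⁺`.  Then there are `C > 0` and
`δ ∈ (0,h₀]` with `‖u h 1 − y(t₀+h)‖∞ ≤ C h^{2r+1}` for all `h ∈ (0,δ]`. -/
theorem ffcfe_algebraic_order (d r : ℕ) (hr : 1 ≤ r) (t₀ h₀ : ℝ) (hh₀ : 0 < h₀)
    (f : (Fin d → ℝ) → (Fin d → ℝ)) (hf : ContDiff ℝ (⊤ : ℕ∞) f)
    (φ : Fin r → ℝ → ℝ) (hφ : ∀ i, ContDiff ℝ (⊤ : ℕ∞) (φ i))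
    (hW : (Matrix.of fun i j : Fin r => iteratedDeriv i (φ j) t₀).det ≠ 0)
    (hind : ∀ h ∈ Ioc (0:ℝ) h₀, LinearIndependent ℝ
        (fun i : Fin r => (Icc (0:ℝ) 1).restrict (fun τ => φ i (t₀ + τ * h))))
    (y : ℝ → Fin d → ℝ) (y₀ : Fin d → ℝ)
    (hy : ∀ t ∈ Icc t₀ (t₀ + h₀), HasDerivAt y (f (y t)) t) (hy0 : y t₀ = y₀)
    (u : ℝ → ℝ → Fin d → ℝ)
    (hu1 : ∀ h ∈ Ioc (0:ℝ) h₀, ContDiff ℝ 1 (u h))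
    (hu0 : ∀ h ∈ Ioc (0:ℝ) h₀, u h 0 = y₀)
    (huY : ∀ h ∈ Ioc (0:ℝ) h₀, ∀ i : Fin d, ∃ c : Fin r → ℝ,
        ∀ τ ∈ Icc (0:ℝ) 1, deriv (u h) τ i = ∑ k : Fin r, c k * φ k (t₀ + τ * h))
    (hvar : ∀ h ∈ Ioc (0:ℝ) h₀, ∀ v : ℝ → ℝ,
        (∃ c : Fin r → ℝ, ∀ τ ∈ Icc (0:ℝ) 1, v τ = ∑ k : Fin r, c k * φ k (t₀ + τ * h)) →
        ∀ i : Fin d, ∫ τ in (0:ℝ)..1, v τ * deriv (u h) τ i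
          = h * ∫ τ in (0:ℝ)..1, v τ * f (u h τ) i)
    (hconv : TendstoUniformlyOn u (fun _ => y₀) (nhdsWithin 0 (Ioi 0)) (Icc 0 1)) :
    ∃ C > (0:ℝ), ∃ δ ∈ Ioc (0:ℝ) h₀, ∀ h ∈ Ioc (0:ℝ) δ,
      ‖u h 1 - y (t₀ + h)‖ ≤ C * h ^ (2 * r + 1) := by
  obtain ⟨q, q', M, M', C₁, hC₁, hq, hM, hq'c, hM'c, hq', hM', hq0, hM0, hqb, hMb⟩ :=
    exists_approx_adjoint_system hf t₀ y₀ (2 * r)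
  have hfq : ContDiff ℝ (⊤ : ℕ∞) fun t => f (q t) := hf.comp hq
  choose c hc using fun j : Fin d =>
    exists_linearCombination_isBigO hφ hW (contDiff_pi.1 hfq j)
  have hMe (i j : Fin d) : ContDiff ℝ (⊤ : ℕ∞) fun t => M t (Pi.single j 1) i :=
    contDiff_pi.1 (hM.clm_apply contDiff_const) i
  choose c' hc' using fun ij : Fin d × Fin d =>
    exists_linearCombination_isBigO hφ hW (hMe ij.1 ij.2)
  obtain ⟨C₂, hC₂, hcb⟩ := exists_common_bound hc
  obtain ⟨C₃, hC₃, hcb'⟩ := exists_common_bound hc'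
  have hf' : ContDiff ℝ (⊤ : ℕ∞) (fderiv ℝ f) := hf.fderiv_right (by simp)
  obtain ⟨L, s₁, hs₁, hL⟩ := (hf.contDiffAt (x := y₀)).of_le (m := 1) (by simp)
    |>.exists_lipschitzOnWith
  obtain ⟨K, s₂, hs₂, hK⟩ := (hf'.contDiffAt (x := y₀)).of_le (m := 1) (by simp)
    |>.exists_lipschitzOnWith
  obtain ⟨ε, hε, hball⟩ := Metric.mem_nhds_iff.1 (inter_mem hs₁ hs₂)
  replace hL := hL.mono (hball.trans inter_subset_left)
  replace hK := hK.mono (hball.trans inter_subset_right)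
  have hqball : ∀ᶠ t in 𝓝 t₀, q t ∈ Metric.ball y₀ ε :=
    hq.continuous.continuousAt.eventually_mem (hq0 ▸ Metric.ball_mem_nhds _ hε)
  have hyball : ∀ᶠ t in 𝓝 t₀, y t ∈ Metric.ball y₀ ε :=
    (hy t₀ (by simp [hh₀.le])).continuousAt.eventually_mem
      (hy0 ▸ Metric.ball_mem_nhds _ hε)
  have hMball : ∀ᶠ t in 𝓝 t₀, ‖M t - ContinuousLinearMap.id ℝ _‖ < 1 / 2 := by
    have := hM.continuous.continuousAt.eventually_mem
      (Metric.ball_mem_nhds (M t₀) (half_pos one_pos))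
    simpa [hM0, dist_eq_norm] using this
  obtain ⟨η, hη, hloc⟩ := Metric.eventually_nhds_iff_ball.1
    (hqb.and (hMb.and (hcb.and (hcb'.and (hqball.and (hyball.and hMball))))))
  have huball := Metric.tendstoUniformlyOn_iff.1 hconv ε hε
  set D : ℝ := 2 * (C₁ + C₂) with hD
  set B : ℝ := 2 * (C₁ * D + 2 * K * D ^ 2 + 2 * C₁ + d * (C₃ * D)) + 2 * C₁ with hB
  suffices hmain : ∀ᶠ h in 𝓝[>] (0:ℝ), h ≤ h₀ ∧ ‖u h 1 - y (t₀ + h)‖ ≤ B * h ^ (2 * r + 1) by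
    obtain ⟨δ, hδ, hsub⟩ := mem_nhdsGT_iff_exists_Ioc_subset.1 hmain
    exact ⟨B, by positivity, δ, ⟨hδ, (hsub (right_mem_Ioc.2 hδ)).1⟩, fun h hh => (hsub hh).2⟩
  have hsmall : ∀ᶠ h : ℝ in 𝓝[>] 0, 4 * h * (L : ℝ) < 1 := by
    refine (ContinuousAt.eventually_lt (by fun_prop) continuousAt_const ?_).filter_mono
      nhdsWithin_le_nhds
    simp
  filter_upwards [huball, hsmall, self_mem_nhdsWithin, Ioc_mem_nhdsGT hh₀,
    Ioc_mem_nhdsGT one_pos, Ioo_mem_nhdsGT hη] with h huε hhL hh hhh₀ hh1 hhη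
  refine ⟨hhh₀.2, ?_⟩
  replace hh : 0 < h := hh
  replace hh1 : h ≤ 1 := hh1.2
  have hmem (τ) (hτ : τ ∈ Icc (0:ℝ) 1) : t₀ + τ * h ∈ Metric.ball t₀ η := by
    rw [Metric.mem_ball, dist_eq_norm, add_sub_cancel_left, Real.norm_of_nonneg
      (mul_nonneg hτ.1 hh.le)]
    exact (mul_le_of_le_one_left hh.le hτ.2).trans_lt hhη.2
  have hpow (n : ℕ) (τ) (hτ : τ ∈ Icc (0:ℝ) 1) : ‖(t₀ + τ * h - t₀) ^ n‖ ≤ h ^ n := by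
    rw [add_sub_cancel_left, norm_pow, Real.norm_of_nonneg (mul_nonneg hτ.1 hh.le)]
    have := mul_nonneg hτ.1 hh.le
    gcongr
    exact mul_le_of_le_one_left hh.le hτ.2
  have hU1 := hu1 h hhh₀
  have hUd (τ : ℝ) : HasDerivAt (u h) (deriv (u h) τ) τ :=
    (hU1.differentiable (by simp) τ).hasDerivAt
  have hU'c : Continuous (deriv (u h)) := hU1.continuous_deriv le_rfl
  have hφc (k : Fin r) := (hφ k).continuous
  have haff (τ : ℝ) : HasDerivAt (fun τ => t₀ + τ * h) h τ := by
    simpa using ((hasDerivAt_id τ).mul_const h).const_add t₀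
  have hqc := hq.continuous
  have hMc := hM.continuous
  have hfc := hf.continuous
  have hUc := hU1.continuous
  have hQd (τ : ℝ) : HasDerivAt (fun τ => q (t₀ + τ * h)) (h • q' (t₀ + τ * h)) τ :=
    (hq' _).scomp τ (haff τ)
  have hAd (τ : ℝ) : HasDerivAt (fun τ => M (t₀ + τ * h)) (h • M' (t₀ + τ * h)) τ :=
    (hM' _).scomp τ (haff τ)
  have hUball (τ) (hτ : τ ∈ Icc (0:ℝ) 1) : u h τ ∈ Metric.ball y₀ ε :=
    Metric.mem_ball'.2 (huε τ hτ)
  have hQball (τ) (hτ : τ ∈ Icc (0:ℝ) 1) : q (t₀ + τ * h) ∈ Metric.ball y₀ ε :=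
    (hloc _ (hmem τ hτ)).2.2.2.2.1
  set a : ℝ := C₁ * h ^ (2 * r) with ha
  set b : ℝ := C₂ * h ^ r with hb
  have hQG (τ) (hτ : τ ∈ Icc (0:ℝ) 1) :
      ‖h • q' (t₀ + τ * h) - h • f (q (t₀ + τ * h))‖ ≤ h * a := by
    rw [← smul_sub, norm_smul, Real.norm_of_nonneg hh.le]
    gcongr
    exact (hloc _ (hmem τ hτ)).1.trans (by rw [ha]; gcongr; exact hpow _ τ hτ)
  have horth (j : Fin d) (v : ℝ → ℝ) (hv : Continuous v) (hvY : ∃ c : Fin r → ℝ,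
      ∀ τ ∈ Icc (0:ℝ) 1, v τ = ∑ k : Fin r, c k * φ k (t₀ + τ * h)) :
      ∫ τ in (0:ℝ)..1, (deriv (u h) τ j - h * f (u h τ) j) * v τ = 0 := by
    have := hvar h hhh₀ v hvY j
    rw [← intervalIntegral.integral_const_mul, ← sub_eq_zero,
      ← intervalIntegral.integral_sub (Continuous.intervalIntegrable (by fun_prop) _ _)
        (Continuous.intervalIntegrable (by fun_prop) _ _)] at this
    rw [← this]
    congr 1
    ext τ
    ring
  obtain ⟨hN, hRes⟩ := galerkin_error_le hh L.2 hhL.le (a := a) (b := b) (by positivity)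
    (by positivity) hUd hQd hU'c (by fun_prop) (F := fun τ => f (u h τ))
    (G := fun τ => f (q (t₀ + τ * h))) (by fun_prop) (by simp [hu0 h hhh₀, hq0])
    (fun τ hτ => hL.norm_sub_le (hUball τ hτ) (hQball τ hτ)) hQG (fun j => by
      refine ⟨fun τ => ∑ k, c j k * φ k (t₀ + τ * h), by fun_prop, fun τ hτ => ?_, ?_⟩
      · rw [abs_sub_comm]
        exact ((hloc _ (hmem τ hτ)).2.2.1 j).trans (by rw [hb]; gcongr; exact hpow _ τ hτ)
      · obtain ⟨cu, hcu⟩ := huY h hhh₀ j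
        have := horth j (fun τ => deriv (u h) τ j - h * ∑ k, c j k * φ k (t₀ + τ * h))
          (by fun_prop) ⟨fun k => cu k - h * c j k, fun τ hτ => by
            simp only [hcu τ hτ, sub_mul, Finset.sum_sub_distrib, Finset.mul_sum, mul_assoc]⟩
        rw [← sub_eq_zero, ← intervalIntegral.integral_sub
          (Continuous.intervalIntegrable (by fun_prop) _ _)
          (Continuous.intervalIntegrable (by fun_prop) _ _), ← this]
        congr 1
        ext τ
        ring)
  set n : ℝ := 2 * h * (a + b) with hn
  have hn0 : 0 ≤ n := by positivity
  have hnD : n ≤ D * h ^ (r + 1) := by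
    have : h ^ (2 * r) ≤ h ^ r := pow_le_pow_of_le_one hh.le hh1 (by omega)
    have : a ≤ C₁ * h ^ r := by rw [ha]; gcongr
    calc n ≤ 2 * h * (C₁ * h ^ r + C₂ * h ^ r) := by rw [hn]; gcongr
      _ = D * h ^ (r + 1) := by rw [hD]; ring
  have hMnorm (τ) (hτ : τ ∈ Icc (0:ℝ) 1) : ‖M (t₀ + τ * h)‖ ≤ 2 := by
    have h1 := (hloc _ (hmem τ hτ)).2.2.2.2.2.2
    have h2 := ContinuousLinearMap.norm_id_le (𝕜 := ℝ) (E := Fin d → ℝ)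
    have h3 := norm_le_norm_sub_add (M (t₀ + τ * h)) (ContinuousLinearMap.id ℝ (Fin d → ℝ))
    linarith
  have hfinal := norm_apply_one_le_of_pairing (s := h * (a * n + 2 * (K * n * n) + 2 * a))
    (κ := C₃ * h ^ r * n) (by positivity) (by positivity) hAd
    (fun τ => (hUd τ).sub (hQd τ)) (by fun_prop) (by fun_prop)
    (R := fun τ => deriv (u h) τ - h • f (u h τ)) (by fun_prop) (by simp [hu0 h hhh₀, hq0])
    (fun τ hτ => by
      set e := u h τ - q (t₀ + τ * h) with he
      have heN : ‖e‖ ≤ n := hN τ hτ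
      have hsplit : (h • M' (t₀ + τ * h)) e + M (t₀ + τ * h)
          (deriv (u h) τ - h • q' (t₀ + τ * h) - (deriv (u h) τ - h • f (u h τ)))
          = h • ((M' (t₀ + τ * h) + (M (t₀ + τ * h)).comp (fderiv ℝ f (q (t₀ + τ * h)))) e
            + M (t₀ + τ * h) (f (u h τ) - f (q (t₀ + τ * h)) - fderiv ℝ f (q (t₀ + τ * h)) e)
            - M (t₀ + τ * h) (q' (t₀ + τ * h) - f (q (t₀ + τ * h)))) := by
        simp only [add_apply, smul_apply,
          ContinuousLinearMap.comp_apply, map_sub, map_smul]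
        module
      refine (congrArg norm hsplit).trans_le ?_
      rw [norm_smul, Real.norm_of_nonneg hh.le]
      gcongr
      refine (norm_sub_le _ _).trans (add_le_add ((norm_add_le _ _).trans
        (add_le_add ?_ ?_)) ?_)
      · refine (ContinuousLinearMap.le_of_opNorm_le_of_le _ ?_ heN)
        exact (hloc _ (hmem τ hτ)).2.1.trans (by rw [ha]; gcongr; exact hpow _ τ hτ)
      · refine (ContinuousLinearMap.le_of_opNorm_le_of_le _ (hMnorm τ hτ) ?_)
        refine (norm_sub_sub_fderiv_le (hf.differentiable (by simp)) (convex_ball y₀ ε) hK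
          (hQball τ hτ) (hUball τ hτ)).trans ?_
        gcongr
      · refine (ContinuousLinearMap.le_of_opNorm_le_of_le _ (hMnorm τ hτ) ?_)
        exact (hloc _ (hmem τ hτ)).1.trans (by rw [ha]; gcongr; exact hpow _ τ hτ))
    (fun i j => by
      have h1 := horth j (fun τ => ∑ k, c' (i, j) k * φ k (t₀ + τ * h)) (by fun_prop)
        ⟨c' (i, j), fun _ _ => rfl⟩
      have h2 : ∫ τ in (0:ℝ)..1, M (t₀ + τ * h) (Pi.single j 1) i
            * (deriv (u h) τ - h • f (u h τ)) j
          = ∫ τ in (0:ℝ)..1, (M (t₀ + τ * h) (Pi.single j 1) i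
              - ∑ k, c' (i, j) k * φ k (t₀ + τ * h)) * (deriv (u h) τ j - h * f (u h τ) j) := by
        rw [← sub_eq_zero, ← intervalIntegral.integral_sub
          (Continuous.intervalIntegrable (by fun_prop) _ _)
          (Continuous.intervalIntegrable (by fun_prop) _ _), ← h1]
        congr 1
        ext τ
        simp only [Pi.sub_apply, Pi.smul_apply, smul_eq_mul]
        ring
      rw [h2]
      calc _ ≤ ∫ τ in (0:ℝ)..1, |(M (t₀ + τ * h) (Pi.single j 1) i
              - ∑ k, c' (i, j) k * φ k (t₀ + τ * h)) * (deriv (u h) τ j - h * f (u h τ) j)| :=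
            intervalIntegral.abs_integral_le_integral_abs zero_le_one
        _ ≤ ∫ τ in (0:ℝ)..1, C₃ * h ^ r * |deriv (u h) τ j - h * f (u h τ) j| := by
            refine intervalIntegral.integral_mono_on zero_le_one
              (Continuous.intervalIntegrable (by fun_prop) _ _)
              (Continuous.intervalIntegrable (by fun_prop) _ _) fun τ hτ => ?_
            rw [abs_mul]
            gcongr
            exact ((hloc _ (hmem τ hτ)).2.2.2.1 (i, j)).trans (by gcongr; exact hpow _ τ hτ)
        _ ≤ C₃ * h ^ r * n := by
            rw [intervalIntegral.integral_const_mul]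
            gcongr
            exact hRes j)
  have h1mem : (1:ℝ) ∈ Icc (0:ℝ) 1 := right_mem_Icc.2 zero_le_one
  have hyQ := norm_sub_le_of_approx_solutions hh L.2 hhL.le (Y := fun τ => y (t₀ + τ * h))
    (F := fun τ => f (y (t₀ + τ * h))) (G := fun τ => f (q (t₀ + τ * h)))
    (fun τ hτ => (hy _ ⟨by nlinarith [hτ.1], by nlinarith [hτ.2, hhh₀.2]⟩).scomp τ (haff τ))
    (fun τ _ => hQd τ) (by simp [hy0, hq0])
    (fun τ hτ => hL.norm_sub_le (hloc _ (hmem τ hτ)).2.2.2.2.2.1 (hQball τ hτ)) hQG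
  have hM1 := (hloc _ (hmem 1 h1mem)).2.2.2.2.2.2
  simp only [one_mul, Pi.sub_apply] at hfinal hyQ hM1
  have he1 : ‖u h 1 - q (t₀ + h)‖ ≤ 2 * ‖M (t₀ + h) (u h 1 - q (t₀ + h))‖ := by
    have h1 := ContinuousLinearMap.le_of_opNorm_le _ hM1.le (u h 1 - q (t₀ + h))
    rw [sub_apply, ContinuousLinearMap.id_apply] at h1
    have h2 := norm_le_norm_add_norm_sub (M (t₀ + h) (u h 1 - q (t₀ + h))) (u h 1 - q (t₀ + h))
    linarith
  have hpow1 (m : ℕ) (hm : 2 * r + 1 ≤ m) : h ^ m ≤ h ^ (2 * r + 1) :=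
    pow_le_pow_of_le_one hh.le hh1 hm
  have hha : h * a = C₁ * h ^ (2 * r + 1) := by rw [ha]; ring
  have e1 : h * (a * n) ≤ C₁ * D * h ^ (2 * r + 1) := by
    calc h * (a * n) ≤ h * (a * (D * h ^ (r + 1))) := by gcongr
      _ = C₁ * D * h ^ (2 * r + 1 + (r + 1)) := by rw [ha]; ring
      _ ≤ _ := by gcongr ?_ * ?_; exact hpow1 _ (by omega)
  have e2 : h * (2 * (K * n * n)) ≤ 2 * K * D ^ 2 * h ^ (2 * r + 1) := by
    calc h * (2 * (K * n * n)) ≤ h * (2 * (K * (D * h ^ (r + 1)) * (D * h ^ (r + 1)))) := by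
          gcongr
      _ = 2 * K * D ^ 2 * h ^ (2 * r + 3) := by ring
      _ ≤ _ := by gcongr ?_ * ?_; exact hpow1 _ (by omega)
  have e3 : d * (C₃ * h ^ r * n) ≤ d * (C₃ * D) * h ^ (2 * r + 1) := by
    calc d * (C₃ * h ^ r * n) ≤ d * (C₃ * h ^ r * (D * h ^ (r + 1))) := by gcongr
      _ = _ := by ring
  calc ‖u h 1 - y (t₀ + h)‖ ≤ ‖u h 1 - q (t₀ + h)‖ + ‖y (t₀ + h) - q (t₀ + h)‖ := by
        rw [norm_sub_rev (y _)]; exact norm_sub_le_norm_sub_add_norm_sub _ _ _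
    _ ≤ B * h ^ (2 * r + 1) := by
        rw [hB]
        linarith
end

section
/- Let f : ℝ^d → ℝ^d, h ∈ ℝ, y₀ ∈ ℝ^d, and s ≥ 1. Let (b_k, c_k), k = 1, …, s, be a symmetric quadrature rule on [0,1], i.e. c_{s+1−k} = 1 − c_k and b_{s+1−k} = b_k for all k, and define the discrete pairing [w₁, w₂] = Σ_{k=1}^s b_k w₁(c_k) w₂(c_k). Let Y be a vector space of real-valued functions on [0,1]. Suppose u : [0,1] → ℝ^d is continuously differentiable with u(0) = y₀ and [v, u′_i] = h[v, f(u(·))_i] for every v ∈ Y and every component index i. Then the reflected function ũ(τ) = u(1−τ) satisfies ũ(0) = u(1), ũ(1) = y₀, and [v, ũ′_i] = −h[v, f(ũ(·))_i] for every v in the reflected space {τ ↦ v(1−τ) : v ∈ Y} and every i. -/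
open Set

/-- **Reflection of a solution of the fully discrete FFCFE scheme (key step of
the symmetry proof for a symmetric quadrature rule).**
Let `(b k, c k)`, `k : Fin s`, be a symmetric quadrature rule on `[0,1]`
(`c (rev k) = 1 - c k` and `b (rev k) = b k`, where `rev k` is the index
`s + 1 - k` in 1-based notation), and let `[w₁, w₂] = Σₖ bₖ w₁(cₖ) w₂(cₖ)` be
the associated discrete pairing.  If `u : [0,1] → ℝ^d` is C¹ with `u 0 = y₀`
and `[v, u'_i] = h [v, f(u(·))_i]` for every `v` in a vector space `Y` of
functions on `[0,1]` and every component `i`, then the reflected function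
`ũ(τ) = u(1-τ)` satisfies `ũ 0 = u 1`, `ũ 1 = y₀`, and
`[v, ũ'_i] = -h [v, f(ũ(·))_i]` for every `v` in the reflected space
`{τ ↦ v(1-τ) : v ∈ Y}` and every `i`. -/
theorem discrete_ffcfe_reflected_solution (d s : ℕ) (hs : 1 ≤ s)
    (f : (Fin d → ℝ) → (Fin d → ℝ)) (h : ℝ) (y₀ : Fin d → ℝ)
    (b c : Fin s → ℝ) (hc : ∀ k, c k ∈ Icc (0:ℝ) 1)
    (hcsym : ∀ k : Fin s, c k.rev = 1 - c k)
    (hbsym : ∀ k : Fin s, b k.rev = b k)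
    (Y : Submodule ℝ (ℝ → ℝ))
    (u : ℝ → Fin d → ℝ) (hu : ContDiff ℝ 1 u) (hu0 : u 0 = y₀)
    (hvar : ∀ v ∈ Y, ∀ i : Fin d,
        ∑ k : Fin s, b k * v (c k) * deriv u (c k) i
          = h * ∑ k : Fin s, b k * v (c k) * f (u (c k)) i) :
    (fun τ => u (1 - τ)) 0 = u 1 ∧
    (fun τ => u (1 - τ)) 1 = y₀ ∧
    ∀ v ∈ Y, ∀ i : Fin d,
      ∑ k : Fin s, b k * v (1 - c k) * deriv (fun σ => u (1 - σ)) (c k) i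
        = -h * ∑ k : Fin s, b k * v (1 - c k) * f (u (1 - c k)) i := by
  refine ⟨by simp, by simpa using hu0, fun v hv i => ?_⟩
  have sum_reflect (g : ℝ → ℝ) :
      ∑ k, b k * v (1 - c k) * g (1 - c k) = ∑ k, b k * v (c k) * g (c k) :=
    Fintype.sum_equiv Fin.revPerm _ _ fun k => by simp [hcsym, hbsym]
  simp only [deriv_comp_const_sub, Pi.neg_apply, mul_neg, Finset.sum_neg_distrib]
  rw [sum_reflect fun τ => deriv u τ i, sum_reflect fun τ => f (u τ) i, hvar v hv i, neg_mul]
end
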